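/- arXiv:2309.06904 — 2 statements merged into one kernel-verified Lean document; each statement's English description precedes it below -/
import Mathlib

section
/- Let D=(V1,V2;A) be a 2-arc-strong split digraph such that every vertex of V1 has out-degree at least 3 and in-degree at least 3 in D. Then D has a strong arc decomposition. -/
/-- A digraph on vertex set `V` given by its arc set `A` is strong if every vertex
can reach every other vertex by a directed path. -/
def DigraphStrong {V : Type*} (A : Finset (V × V)) : Prop :=
  ∀ x y : V, Relation.ReflTransGen (fun a b => (a, b) ∈ A) x y

/-- A digraph is `k`-arc-strong if it remains strong after deleting any set of
at most `k - 1` arcs. -/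
def ArcStrong {V : Type*} [DecidableEq V] (k : ℕ) (A : Finset (V × V)) : Prop :=
  ∀ B ⊆ A, B.card < k → DigraphStrong (A \ B)

/-- A strong arc decomposition: a partition of the arc set into two disjoint sets,
each of which forms a strong spanning subdigraph. -/
def StrongArcDecomp {V : Type*} [DecidableEq V] (A : Finset (V × V)) : Prop :=
  ∃ A₁ A₂ : Finset (V × V), A₁ ∪ A₂ = A ∧ Disjoint A₁ A₂ ∧
    DigraphStrong A₁ ∧ DigraphStrong A₂

/-- `(V₁, V₂; A)` is a split digraph: `V₁, V₂` are nonempty, partition the vertex set,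
there are no loops, `V₁` is an independent set, and the subdigraph induced by `V₂`
is semicomplete. -/
def IsSplitDigraph {V : Type*} [Fintype V] [DecidableEq V]
    (V₁ V₂ : Finset V) (A : Finset (V × V)) : Prop :=
  V₁.Nonempty ∧ V₂.Nonempty ∧ Disjoint V₁ V₂ ∧ V₁ ∪ V₂ = Finset.univ ∧
  (∀ v : V, (v, v) ∉ A) ∧
  (∀ u ∈ V₁, ∀ v ∈ V₁, (u, v) ∉ A) ∧
  (∀ u ∈ V₂, ∀ v ∈ V₂, u ≠ v → (u, v) ∈ A ∨ (v, u) ∈ A)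

/-- The out-degree of a vertex. -/
def outDeg {V : Type*} [DecidableEq V] (A : Finset (V × V)) (t : V) : ℕ :=
  (A.filter fun e => e.1 = t).card

/-- The in-degree of a vertex. -/
def inDeg {V : Type*} [DecidableEq V] (A : Finset (V × V)) (t : V) : ℕ :=
  (A.filter fun e => e.2 = t).card

namespace ArcDecomp

variable {V : Type*} [DecidableEq V]

/-- The number of arcs of `M` from `Y` to `X`. -/
def arcs (M : Multiset (V × V)) (Y X : Finset V) : ℕ :=
  M.countP fun e => e.1 ∈ Y ∧ e.2 ∈ X

/-- Every nonempty proper subset of `U` is entered by at least `k` arcs of `M` lying in `U`. -/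
def Str (k : ℕ) (U : Finset V) (M : Multiset (V × V)) : Prop :=
  ∀ X ⊆ U, X.Nonempty → X ≠ U → k ≤ arcs M (U \ X) X

/-- `M` contains two disjoint strong spanning sub-multidigraphs on `U`. -/
def Dec (U : Finset V) (M : Multiset (V × V)) : Prop :=
  ∃ M₁ M₂, M₁ + M₂ ≤ M ∧ Str 1 U M₁ ∧ Str 1 U M₂

/-- Any two distinct vertices of `U` are joined by an arc of `M`. -/
def Semi (U : Finset V) (M : Multiset (V × V)) : Prop :=
  ∀ u ∈ U, ∀ v ∈ U, u ≠ v → (u, v) ∈ M ∨ (v, u) ∈ M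

lemma arcs_add (M N : Multiset (V × V)) (Y X : Finset V) :
    arcs (M + N) Y X = arcs M Y X + arcs N Y X := by
  simp [arcs]

lemma arcs_mono {M N : Multiset (V × V)} (h : M ≤ N) (Y X : Finset V) :
    arcs M Y X ≤ arcs N Y X :=
  Multiset.countP_le_of_le _ h

lemma arcs_cons (e : V × V) (M : Multiset (V × V)) (Y X : Finset V) :
    arcs (e ::ₘ M) Y X = arcs M Y X + if e.1 ∈ Y ∧ e.2 ∈ X then 1 else 0 := by
  simp [arcs, Multiset.countP_cons]

@[simp] lemma arcs_zero (Y X : Finset V) : arcs 0 Y X = 0 := by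
  simp [arcs]

lemma arcs_singleton (e : V × V) (Y X : Finset V) :
    arcs {e} Y X = if e.1 ∈ Y ∧ e.2 ∈ X then 1 else 0 := by
  rw [← Multiset.cons_zero, arcs_cons, arcs_zero, zero_add]

lemma arcs_pos {M : Multiset (V × V)} {Y X : Finset V} :
    1 ≤ arcs M Y X ↔ ∃ e ∈ M, e.1 ∈ Y ∧ e.2 ∈ X := by
  simp [arcs, Nat.succ_le_iff, Multiset.countP_pos]

lemma arcs_pos_of_mem {M : Multiset (V × V)} {Y X : Finset V} {u v : V} (h : (u, v) ∈ M)
    (hu : u ∈ Y) (hv : v ∈ X) : 1 ≤ arcs M Y X :=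
  arcs_pos.2 ⟨_, h, hu, hv⟩

lemma arcs_union_left (M : Multiset (V × V)) {Y Z : Finset V} (h : Disjoint Y Z) (X : Finset V) :
    arcs M (Y ∪ Z) X = arcs M Y X + arcs M Z X := by
  induction M using Multiset.induction with
  | empty => simp
  | cons e M ih =>
    rw [arcs_cons, arcs_cons, arcs_cons, ih]
    have hYZ : e.1 ∈ Y → e.1 ∉ Z := fun h' => Finset.disjoint_left.1 h h'
    by_cases h1 : e.1 ∈ Y <;> by_cases h2 : e.1 ∈ Z <;> by_cases h3 : e.2 ∈ X <;>
      simp_all <;> omega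

lemma arcs_swap (M : Multiset (V × V)) (Y X : Finset V) :
    arcs (M.map Prod.swap) Y X = arcs M X Y := by
  simp only [arcs, Multiset.countP_map, ← Multiset.countP_eq_card_filter]
  exact Multiset.countP_congr rfl (by simp [and_comm])

lemma arcs_union_right (M : Multiset (V × V)) {Y Z : Finset V} (h : Disjoint Y Z) (X : Finset V) :
    arcs M X (Y ∪ Z) = arcs M X Y + arcs M X Z := by
  simp only [← arcs_swap M _ X, arcs_union_left _ h]

lemma arcs_mono_set (M : Multiset (V × V)) {Y Y' X X' : Finset V} (hY : Y ⊆ Y') (hX : X ⊆ X') :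
    arcs M Y X ≤ arcs M Y' X' := by
  simp only [arcs, Multiset.countP_eq_card_filter]
  exact Multiset.card_le_card
    (Multiset.monotone_filter_right M fun e he => ⟨hY he.1, hX he.2⟩)

lemma arcs_eq_zero {M : Multiset (V × V)} {Y X : Finset V} :
    arcs M Y X = 0 ↔ ∀ e ∈ M, e.1 ∈ Y → e.2 ∉ X := by
  simp [arcs, Multiset.countP_eq_zero]

lemma Str.mono {k : ℕ} {U : Finset V} {M N : Multiset (V × V)} (h : Str k U M) (hMN : M ≤ N) :
    Str k U N :=
  fun X hX hne hU => (h X hX hne hU).trans (arcs_mono hMN _ _)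

lemma Str.swap {k : ℕ} {U : Finset V} {M : Multiset (V × V)} (h : Str k U M) :
    Str k U (M.map Prod.swap) := by
  intro X hX hne hU
  rw [arcs_swap]
  have := h (U \ X) Finset.sdiff_subset
    (Finset.sdiff_nonempty.2 fun h => hU (hX.antisymm h))
    (by rw [Ne, sdiff_eq_left]
        exact fun h => hne.ne_empty (Finset.disjoint_self_iff_empty _ |>.1 (h.mono_left hX)))
  rwa [Finset.sdiff_sdiff_eq_self hX] at this

lemma map_swap_swap {α : Type*} (M : Multiset (α × α)) : (M.map Prod.swap).map Prod.swap = M := by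
  simp [Multiset.map_map]

lemma Dec.of_swap {U : Finset V} {M : Multiset (V × V)} (h : Dec U (M.map Prod.swap)) :
    Dec U M := by
  obtain ⟨M₁, M₂, h, h₁, h₂⟩ := h
  refine ⟨_, _, ?_, h₁.swap, h₂.swap⟩
  have := Multiset.map_le_map (f := Prod.swap) h
  rwa [map_swap_swap, Multiset.map_add] at this

lemma mem_map_swap {α : Type*} {M : Multiset (α × α)} {u v : α} :
    (u, v) ∈ M.map Prod.swap ↔ (v, u) ∈ M := by
  simp

lemma Semi.swap {α : Type*} {U : Finset α} {M : Multiset (α × α)} (h : Semi U M) :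
    Semi U (M.map Prod.swap) := by
  intro u hu v hv huv
  rw [mem_map_swap, mem_map_swap]
  exact (h u hu v hv huv).symm

lemma Semi.mono {α : Type*} {U U' : Finset α} {M N : Multiset (α × α)} (h : Semi U M) (hU : U' ⊆ U)
    (hMN : M ≤ N) : Semi U' N :=
  fun u hu v hv huv => (h u (hU hu) v (hU hv) huv).imp
    (fun h => Multiset.mem_of_le hMN h) (fun h => Multiset.mem_of_le hMN h)

/-- The arcs `ut` and `tw` for the pairs `(u, w)` in `P`. -/
def lift (t : V) (P : Multiset (V × V)) : Multiset (V × V) :=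
  P.map (fun e => (e.1, t)) + P.map (fun e => (t, e.2))

lemma lift_add {α : Type*} (t : α) (P Q : Multiset (α × α)) :
    lift t (P + Q) = lift t P + lift t Q := by
  simp only [lift, Multiset.map_add]
  abel

lemma str_insert {U : Finset V} {t : V} (ht : t ∉ U) {A P N : Multiset (V × V)}
    (h : Str 1 U (A + P)) (hA : A ≤ N) (hP : lift t P ≤ N) (hin : ∃ u ∈ U, (u, t) ∈ N)
    (hout : ∃ w ∈ U, (t, w) ∈ N) : Str 1 (insert t U) N := by
  have key : ∀ X ⊆ U, X.Nonempty → X ≠ U → ∃ e ∈ N, (e.1 ∈ U \ X ∧ e.2 ∈ X) ∨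
      (e.1 ∈ U \ X ∧ e.2 = t ∧ ∃ w ∈ X, (t, w) ∈ N) := by
    intro X hX hne hU
    obtain ⟨e, he, h1, h2⟩ := arcs_pos.1 (h X hX hne hU)
    rcases Multiset.mem_add.1 he with he | he
    · exact ⟨e, Multiset.mem_of_le hA he, Or.inl ⟨h1, h2⟩⟩
    · refine ⟨(e.1, t), Multiset.mem_of_le hP ?_, Or.inr ⟨h1, rfl, e.2, h2,
        Multiset.mem_of_le hP ?_⟩⟩
      · exact Multiset.mem_add.2 (Or.inl (Multiset.mem_map_of_mem _ he))
      · exact Multiset.mem_add.2 (Or.inr (Multiset.mem_map_of_mem _ he))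
  obtain ⟨u, hu, hut⟩ := hin
  obtain ⟨w, hw, htw⟩ := hout
  intro X hX hne hU
  by_cases htX : t ∈ X
  · have hsub : X.erase t ⊆ U := by
      intro a ha
      have := hX (Finset.mem_of_mem_erase ha)
      exact Finset.mem_of_mem_insert_of_ne this (Finset.ne_of_mem_erase ha)
    rcases (X.erase t).eq_empty_or_nonempty with h0 | h0
    · refine arcs_pos_of_mem hut ?_ htX
      have : u ∉ X.erase t := by simp [h0]
      have hne : u ≠ t := fun h => ht (h ▸ hu)
      simp only [Finset.mem_erase, hne, ne_eq, not_false_eq_true, true_and] at this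
      simp [hu, this]
    · obtain ⟨e, he, h⟩ := key _ hsub h0 (by rintro rfl; simp [Finset.insert_erase htX] at hU)
      have h1 : e.1 ∈ U \ X.erase t := by tauto
      refine arcs_pos.2 ⟨e, he, ?_, ?_⟩
      · have hne : e.1 ≠ t := fun h => ht (h ▸ (Finset.mem_sdiff.1 h1).1)
        simp_all
      · rcases h with h | h
        · exact Finset.mem_of_mem_erase h.2
        · rw [h.2.1]; exact htX
  · have hsub : X ⊆ U := fun a ha =>
      Finset.mem_of_mem_insert_of_ne (hX ha) (fun h => htX (h ▸ ha))
    by_cases hXU : X = U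
    · subst hXU
      exact arcs_pos_of_mem htw (by simp [htX]) hw
    · obtain ⟨e, he, h⟩ := key _ hsub hne hXU
      rcases h with h | ⟨-, -, w', hw', h'⟩
      · refine arcs_pos.2 ⟨e, he, ?_, h.2⟩
        have := Finset.mem_sdiff.1 h.1
        simp [this.1, this.2]
      · exact arcs_pos_of_mem h' (by simp [htX]) hw'

lemma exists_split {N₁ N₂ A P : Multiset (V × V)} (h : N₁ + N₂ ≤ A + P) :
    ∃ A₁ A₂ P₁ P₂, A₁ + A₂ = A ∧ P₁ + P₂ = P ∧ N₁ ≤ A₁ + P₁ ∧ N₂ ≤ A₂ + P₂ := by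
  have h' : ∀ e, N₁.count e + N₂.count e ≤ A.count e + P.count e := fun e => by
    simpa using Multiset.le_iff_count.1 h e
  refine ⟨A ∩ N₁, A - A ∩ N₁, P ∩ (N₁ - A), P - P ∩ (N₁ - A), ?_, ?_, ?_, ?_⟩
  · exact add_tsub_cancel_of_le (Multiset.inter_le_left)
  · exact add_tsub_cancel_of_le (Multiset.inter_le_left)
  all_goals
    rw [Multiset.le_iff_count]
    intro e
    have := h' e
    simp only [Multiset.count_add, Multiset.count_inter, Multiset.count_sub]
    omega

lemma Str.filter {k : ℕ} {U : Finset V} {M : Multiset (V × V)} (h : Str k U M) :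
    Str k U (M.filter fun e => e.1 ∈ U ∧ e.2 ∈ U) := by
  intro X hX hne hU
  refine (h X hX hne hU).trans_eq ?_
  rw [arcs, arcs, Multiset.countP_filter]
  refine Multiset.countP_congr rfl fun e _ => ?_
  have := @hX e.2
  simp only [Finset.mem_sdiff]
  simp only [eq_iff_iff]
  tauto

/-- Re-inserting a vertex `t`, the pairs of `P` being replaced by paths through `t`. -/
lemma dec_insert {U : Finset V} {t : V} (ht : t ∉ U) {M P E : Multiset (V × V)}
    (hPU : ∀ e ∈ P, e.1 ∈ U ∧ e.2 ∈ U) (hP : lift t P + E ≤ M) (hE : ∀ e ∈ E, e.1 = t ∨ e.2 = t)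
    (h : Dec U (M + P))
    (hc : (∃ X ⊆ U, X.Nonempty ∧ X ≠ U ∧ arcs M (U \ X) X = 0) ∨
      (P ≠ 0 ∧ ∃ u ∈ U, ∃ w ∈ U, (u, t) ∈ E ∧ (t, w) ∈ E)) : Dec (insert t U) M := by
  obtain ⟨N₁, N₂, hN, h₁, h₂⟩ := h
  set p : V × V → Prop := fun e => e.1 ∈ U ∧ e.2 ∈ U
  have hN' : N₁.filter p + N₂.filter p ≤ M.filter p + P := by
    have := Multiset.filter_le_filter p hN
    rwa [Multiset.filter_add, Multiset.filter_add, Multiset.filter_eq_self.2 hPU] at this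
  obtain ⟨A₁, A₂, P₁, P₂, hA, hPP, hl₁, hl₂⟩ := exists_split hN'
  replace h₁ : Str 1 U (A₁ + P₁) := h₁.filter.mono hl₁
  replace h₂ : Str 1 U (A₂ + P₂) := h₂.filter.mono hl₂
  have hle : A₁ + A₂ + (lift t P₁ + lift t P₂ + E) ≤ M := by
    rw [hA, ← lift_add, hPP]
    conv_rhs => rw [← Multiset.filter_add_not p M]
    gcongr
    refine Multiset.le_filter.2 ⟨hP, ?_⟩
    · intro e he hpe
      have : e.1 = t ∨ e.2 = t := by
        rcases Multiset.mem_add.1 he with he | he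
        · rcases Multiset.mem_add.1 he with he | he <;>
          · obtain ⟨a, -, rfl⟩ := Multiset.mem_map.1 he
            simp
        · exact hE e he
      rcases this with h | h
      · exact ht (h ▸ hpe.1)
      · exact ht (h ▸ hpe.2)
  have hin : ∀ Q ≤ P, Q ≠ 0 → (∃ u ∈ U, (u, t) ∈ lift t Q) ∧ (∃ w ∈ U, (t, w) ∈ lift t Q) := by
    intro Q hQ h0
    obtain ⟨e, he⟩ := Multiset.exists_mem_of_ne_zero h0
    have := hPU e (Multiset.mem_of_le hQ he)
    exact ⟨⟨e.1, this.1, Multiset.mem_add.2 (Or.inl (Multiset.mem_map_of_mem _ he))⟩,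
      ⟨e.2, this.2, Multiset.mem_add.2 (Or.inr (Multiset.mem_map_of_mem _ he))⟩⟩
  have hin₁ := hin P₁ (hPP ▸ Multiset.le_add_right _ _)
  have hin₂ := hin P₂ (hPP ▸ Multiset.le_add_left _ _)
  have main : ∀ E₁ E₂, E₁ + E₂ = E → (P₁ = 0 → ∃ u ∈ U, ∃ w ∈ U, (u, t) ∈ E₁ ∧ (t, w) ∈ E₁) →
      (P₂ = 0 → ∃ u ∈ U, ∃ w ∈ U, (u, t) ∈ E₂ ∧ (t, w) ∈ E₂) → Dec (insert t U) M := by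
    intro E₁ E₂ hEE q₁ q₂
    refine ⟨A₁ + (lift t P₁ + E₁), A₂ + (lift t P₂ + E₂), le_trans (le_of_eq ?_) hle, ?_, ?_⟩
    · rw [← hEE]; abel
    · have : (∃ u ∈ U, (u, t) ∈ lift t P₁ + E₁) ∧ (∃ w ∈ U, (t, w) ∈ lift t P₁ + E₁) := by
        by_cases h0 : P₁ = 0
        · obtain ⟨u, hu, w, hw, h, h'⟩ := q₁ h0
          exact ⟨⟨u, hu, Multiset.mem_add.2 (Or.inr h)⟩, ⟨w, hw, Multiset.mem_add.2 (Or.inr h')⟩⟩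
        · obtain ⟨⟨u, hu, h⟩, ⟨w, hw, h'⟩⟩ := hin₁ h0
          exact ⟨⟨u, hu, Multiset.mem_add.2 (Or.inl h)⟩, ⟨w, hw, Multiset.mem_add.2 (Or.inl h')⟩⟩
      obtain ⟨⟨u, hu, h⟩, ⟨w, hw, h'⟩⟩ := this
      exact str_insert ht h₁ (Multiset.le_add_right _ _)
        ((Multiset.le_add_right _ _).trans (Multiset.le_add_left _ _))
        ⟨u, hu, Multiset.mem_add.2 (Or.inr h)⟩ ⟨w, hw, Multiset.mem_add.2 (Or.inr h')⟩
    · have : (∃ u ∈ U, (u, t) ∈ lift t P₂ + E₂) ∧ (∃ w ∈ U, (t, w) ∈ lift t P₂ + E₂) := by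
        by_cases h0 : P₂ = 0
        · obtain ⟨u, hu, w, hw, h, h'⟩ := q₂ h0
          exact ⟨⟨u, hu, Multiset.mem_add.2 (Or.inr h)⟩, ⟨w, hw, Multiset.mem_add.2 (Or.inr h')⟩⟩
        · obtain ⟨⟨u, hu, h⟩, ⟨w, hw, h'⟩⟩ := hin₂ h0
          exact ⟨⟨u, hu, Multiset.mem_add.2 (Or.inl h)⟩, ⟨w, hw, Multiset.mem_add.2 (Or.inl h')⟩⟩
      obtain ⟨⟨u, hu, h⟩, ⟨w, hw, h'⟩⟩ := this
      exact str_insert ht h₂ (Multiset.le_add_right _ _)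
        ((Multiset.le_add_right _ _).trans (Multiset.le_add_left _ _))
        ⟨u, hu, Multiset.mem_add.2 (Or.inr h)⟩ ⟨w, hw, Multiset.mem_add.2 (Or.inr h')⟩
  have hAM : A₁ + A₂ ≤ M := (Multiset.le_add_right _ _).trans hle
  rcases hc with ⟨X, hX, hne, hXU, h0⟩ | ⟨hP0, hE'⟩
  · have no : ∀ A' ≤ M, ¬ Str 1 U (A' + 0) := by
      intro A' hA' hs
      have := (hs X hX hne hXU).trans (arcs_mono (by simpa using hA') _ _)
      omega
    refine main 0 E (by simp) (fun h => ?_) (fun h => ?_)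
    · exact absurd (h ▸ h₁) (no _ ((Multiset.le_add_right _ _).trans hAM))
    · exact absurd (h ▸ h₂) (no _ ((Multiset.le_add_left _ _).trans hAM))
  · by_cases hP₁ : P₁ = 0
    · refine main E 0 (by simp) (fun _ => hE') (fun h => absurd ?_ hP0)
      rw [← hPP, hP₁, h, add_zero]
    · exact main 0 E (by simp) (fun h => absurd h hP₁) (fun _ => hE')

/-- Submodularity on subsets of `S`, with the surplus that a semicomplete digraph provides. -/
def Submod (S : Finset V) (f : Finset V → ℕ) : Prop :=
  ∀ X ⊆ S, ∀ Y ⊆ S, f (X ∩ Y) + f (X ∪ Y) + (X \ Y).card * (Y \ X).card ≤ f X + f Y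

/-- Nonempty proper subsets. -/
def Proper (S X : Finset V) : Prop :=
  X ⊆ S ∧ X.Nonempty ∧ X ≠ S

lemma Proper.compl {S X : Finset V} (h : Proper S X) : Proper S (S \ X) := by
  obtain ⟨hX, hne, hU⟩ := h
  refine ⟨Finset.sdiff_subset, Finset.sdiff_nonempty.2 fun h => hU (hX.antisymm h), ?_⟩
  rw [Ne, sdiff_eq_left]
  exact fun h => hne.ne_empty (Finset.disjoint_self_iff_empty _ |>.1 (h.mono_left hX))

lemma Proper.ssubset {α : Type*} {S X : Finset α} (h : Proper S X) : X ⊂ S :=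
  h.1.ssubset_of_ne h.2.2

lemma proper_singleton {α : Type*} {S : Finset α} (hS : 2 ≤ S.card) {x : α} (hx : x ∈ S) :
    Proper S {x} := by
  refine ⟨by simpa using hx, by simp, ?_⟩
  rintro rfl
  simp at hS

lemma Submod.compl {S : Finset V} {f : Finset V → ℕ} (h : Submod S f) :
    Submod S fun X => f (S \ X) := by
  intro X hX Y hY
  have h1 := h (S \ X) Finset.sdiff_subset (S \ Y) Finset.sdiff_subset
  have e1 : (S \ X) ∩ (S \ Y) = S \ (X ∪ Y) := by ext; simp; tauto
  have e2 : (S \ X) ∪ (S \ Y) = S \ (X ∩ Y) := by ext; simp; tauto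
  have e3 : (S \ X) \ (S \ Y) = Y \ X := by
    ext a; have := @hY a; simp; tauto
  have e4 : (S \ Y) \ (S \ X) = X \ Y := by
    ext a; have := @hX a; simp; tauto
  rw [e1, e2, e3, e4, mul_comm] at h1
  dsimp only
  omega

lemma Submod.disjoint {S : Finset V} {f : Finset V → ℕ} (h : Submod S f) {X Y : Finset V}
    (hX : X ⊆ S) (hY : Y ⊆ S) (hd : Disjoint X Y) :
    f (X ∪ Y) + X.card * Y.card ≤ f X + f Y := by
  have := h X hX Y hY
  rw [Finset.sdiff_eq_self_of_disjoint hd, Finset.sdiff_eq_self_of_disjoint hd.symm] at this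
  omega

lemma mul_card_pos {X Y : Finset V} (h : ¬ X ⊆ Y) (h' : ¬ Y ⊆ X) :
    1 ≤ (X \ Y).card * (Y \ X).card :=
  Nat.mul_pos (Finset.card_pos.2 (Finset.sdiff_nonempty.2 h))
    (Finset.card_pos.2 (Finset.sdiff_nonempty.2 h'))

/-- A family of sets met by `O` and closed under intersections of crossing members has a common
point in `O` or two disjoint members. -/
lemma common_or_disjoint (G : Finset V → Prop) (O : Multiset V) (hO : ∀ X, G X → ∃ w ∈ O, w ∈ X)
    (hG : ∀ X Y, G X → G Y → (X ∩ Y).Nonempty → ¬ X ⊆ Y → ¬ Y ⊆ X → G (X ∩ Y)) {X₀ : Finset V}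
    (hX₀ : G X₀) :
    (∃ w ∈ O, ∀ X, G X → w ∈ X) ∨ ∃ X Y, G X ∧ G Y ∧ Disjoint X Y ∧ X.card ≤ Y.card := by
  classical
  have hex : ∃ k, ∃ X, G X ∧ X.card = k := ⟨_, X₀, hX₀, rfl⟩
  obtain ⟨X, hX, hXc⟩ := Nat.find_spec hex
  have hmin : ∀ Y, G Y → X.card ≤ Y.card := fun Y hY =>
    hXc ▸ Nat.find_min' hex ⟨Y, hY, rfl⟩
  by_cases hd : ∃ Y, G Y ∧ Disjoint X Y
  · obtain ⟨Y, hY, hd⟩ := hd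
    exact Or.inr ⟨X, Y, hX, hY, hd, hmin Y hY⟩
  · left
    obtain ⟨w, hw, hwX⟩ := hO X hX
    refine ⟨w, hw, fun Y hY => ?_⟩
    by_cases h1 : X ⊆ Y
    · exact h1 hwX
    by_cases h2 : Y ⊆ X
    · exact (Finset.eq_of_subset_of_card_le h2 (hmin Y hY)) ▸ hwX
    have hi : (X ∩ Y).Nonempty := by
      rw [Finset.nonempty_iff_ne_empty, Ne, ← Finset.disjoint_iff_inter_eq_empty]
      exact fun h => hd ⟨Y, hY, h⟩
    have := hmin _ (hG X Y hX hY hi h1 h2)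
    have := Finset.eq_of_subset_of_card_le Finset.inter_subset_left this
    exact absurd (Finset.inter_eq_left.1 this) h1

lemma exists_mem_of_countP {O : Multiset V} {X : Finset V} (h : 1 ≤ O.countP (· ∈ X)) :
    ∃ w ∈ O, w ∈ X := by
  simpa [Nat.succ_le_iff, Multiset.countP_pos] using h

lemma card_eq_one_of_mul_le {a b : ℕ} (ha : 1 ≤ a) (hb : 1 ≤ b) (h : a * b ≤ 1) :
    a = 1 ∧ b = 1 := by
  constructor <;> nlinarith

/-- The structure of the sets of value one when no nonempty proper set has value zero. -/
lemma tight_of_pos {S : Finset V} {f : Finset V → ℕ} (hS : 4 ≤ S.card) (hf : Submod S f)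
    (h1 : ∀ X, Proper S X → 1 ≤ f X) {O : Multiset V} (hO : O ≠ 0)
    (h2 : ∀ X, Proper S X → 2 ≤ f X + O.countP (· ∈ X)) :
    (∃ w ∈ O, ∀ X, Proper S X → f X = 1 → w ∈ X) ∨
    ∃ x ∈ S, ∃ y ∈ S, x ≠ y ∧ f {x} = 1 ∧ f {y} = 1 ∧
      ∀ X, Proper S X → f X = 1 → X = {x} ∨ X = {y} ∨ (x ∈ X ∧ y ∈ X) := by
  by_cases he : ∃ X₀, Proper S X₀ ∧ f X₀ = 1
  swap
  · obtain ⟨w, hw⟩ := Multiset.exists_mem_of_ne_zero hO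
    exact Or.inl ⟨w, hw, fun X hX hX1 => absurd ⟨X, hX, hX1⟩ he⟩
  obtain ⟨X₀, hX₀, hX₀1⟩ := he
  have disj : ∀ X Y, Proper S X → Proper S Y → f X = 1 → f Y = 1 → Disjoint X Y →
      X.card = 1 ∧ Y.card = 1 ∧ f (X ∪ Y) = 1 := by
    intro X Y hX hY hX1 hY1 hd
    have hs := hf.disjoint hX.1 hY.1 hd
    have p1 := hX.2.1.card_pos
    have p2 := hY.2.1.card_pos
    have hu : X ∪ Y ≠ S := by
      intro hu
      have hc : X.card + Y.card = S.card := by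
        rw [← hu, Finset.card_union_of_disjoint hd]
      rw [hX1, hY1] at hs
      have : 3 ≤ X.card * Y.card := by nlinarith [Nat.mul_le_mul p1 p2]
      omega
    have := h1 (X ∪ Y) ⟨Finset.union_subset hX.1 hY.1, hX.2.1.mono Finset.subset_union_left, hu⟩
    obtain ⟨h3, h4⟩ := card_eq_one_of_mul_le p1 p2 (by omega)
    exact ⟨h3, h4, by rw [h3, h4] at hs; omega⟩
  rcases common_or_disjoint (fun X => Proper S X ∧ f X = 1) O
    (fun X hX => exists_mem_of_countP (by have := h2 X hX.1; omega)) (by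
      rintro X Y ⟨hX, hX1⟩ ⟨hY, hY1⟩ hi hXY hYX
      have hp : Proper S (X ∩ Y) := ⟨Finset.inter_subset_left.trans hX.1, hi, fun h =>
        hX.2.2 (hX.1.antisymm (h ▸ Finset.inter_subset_left))⟩
      have := h1 _ hp
      have := hf X hX.1 Y hY.1
      have := mul_card_pos hXY hYX
      exact ⟨hp, by omega⟩) ⟨hX₀, hX₀1⟩ with ⟨w, hw, h⟩ | ⟨X, Y, ⟨hX, hX1⟩, ⟨hY, hY1⟩, hd, -⟩
  · exact Or.inl ⟨w, hw, fun X hX hX1 => h X ⟨hX, hX1⟩⟩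
  right
  obtain ⟨hxc, hyc, hxy⟩ := disj X Y hX hY hX1 hY1 hd
  obtain ⟨x, rfl⟩ := Finset.card_eq_one.1 hxc
  obtain ⟨y, rfl⟩ := Finset.card_eq_one.1 hyc
  have hne : x ≠ y := by simpa using hd
  have hxS : x ∈ S := by simpa using hX.1
  have hyS : y ∈ S := by simpa using hY.1
  refine ⟨x, hxS, y, hyS, hne, hX1, hY1, fun T hT hT1 => ?_⟩
  by_cases hx : x ∈ T <;> by_cases hy : y ∈ T
  · exact Or.inr (Or.inr ⟨hx, hy⟩)
  · obtain ⟨h3, -⟩ := disj T {y} hT hY hT1 hY1 (by simpa using hy)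
    obtain ⟨z, rfl⟩ := Finset.card_eq_one.1 h3
    left; simpa [eq_comm] using hx
  · obtain ⟨h3, -⟩ := disj T {x} hT hX hT1 hX1 (by simpa using hx)
    obtain ⟨z, rfl⟩ := Finset.card_eq_one.1 h3
    right; left; simpa [eq_comm] using hy
  · exfalso
    have hp : Proper S ({x} ∪ {y}) := by
      refine ⟨Finset.union_subset hX.1 hY.1, by simp, ?_⟩
      rintro rfl
      have := Finset.card_union_le {x} ({y} : Finset V)
      simp only [Finset.card_singleton] at this
      omega
    obtain ⟨-, h4, -⟩ := disj T _ hT hp hT1 hxy (by simp [hx, hy])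
    rw [Finset.card_union_of_disjoint hd] at h4
    simp at h4

lemma exists_pair_le {O : Multiset V} {C : Finset V} (h : 2 ≤ O.countP (· ∈ C)) {w : V}
    (hw : w ∈ O) (hwC : w ∈ C) : ∃ w' ∈ C, {w, w'} ≤ O := by
  have hm : w ∈ O.filter (· ∈ C) := Multiset.mem_filter.2 ⟨hw, hwC⟩
  have hc : 0 < ((O.filter (· ∈ C)).erase w).card := by
    rw [Multiset.card_erase_of_mem hm, ← Multiset.countP_eq_card_filter]
    exact Nat.sub_pos_of_lt h
  obtain ⟨w', hw'⟩ := Multiset.card_pos_iff_exists_mem.1 hc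
  refine ⟨w', (Multiset.mem_filter.1 (Multiset.mem_of_mem_erase hw')).2, ?_⟩
  refine le_trans ?_ (Multiset.filter_le (· ∈ C) O)
  rw [Multiset.insert_eq_cons, ← Multiset.cons_erase hm]
  exact Multiset.cons_le_cons _ (Multiset.singleton_le.2 hw')

lemma tight_subset_or {S C : Finset V} {f : Finset V → ℕ} (hf : Submod S f) (hC : Proper S C)
    (hC0 : f C = 0) (hmin : ∀ X, Proper S X → f X = 0 → C ⊆ X) {T : Finset V} (hT : Proper S T)
    (hT1 : f T = 1) (hd : ¬ Disjoint T C) : C ⊆ T ∨ T ⊂ C := by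
  by_cases h : C ⊆ T
  · exact Or.inl h
  refine Or.inr ⟨?_, h⟩
  by_contra h'
  have hp : Proper S (T ∩ C) := by
    refine ⟨Finset.inter_subset_left.trans hT.1, ?_, fun h => hT.2.2 (hT.1.antisymm
      (h ▸ Finset.inter_subset_left))⟩
    rwa [Finset.nonempty_iff_ne_empty, Ne, ← Finset.disjoint_iff_inter_eq_empty]
  have : 1 ≤ f (T ∩ C) := by
    by_contra h0
    exact h ((hmin _ hp (by omega)).trans Finset.inter_subset_left)
  have := hf T hT.1 C hC.1
  have := mul_card_pos h' h
  omega

/-- Hitting the sets of value one inside a minimal set `C` of value zero. -/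
lemma exists_hitting {S C : Finset V} {f : Finset V → ℕ} (hf : Submod S f) (hC : Proper S C)
    (hC0 : f C = 0) (hmin : ∀ X, Proper S X → f X = 0 → C ⊆ X) {O : Multiset V}
    (h2 : ∀ X, Proper S X → 2 ≤ f X + O.countP (· ∈ X)) :
    (∃ w₁ ∈ C, ∃ w₂ ∈ C, {w₁, w₂} ≤ O ∧
      ∀ T, T.Nonempty → T ⊂ C → f T = 1 → w₁ ∈ T ∨ w₂ ∈ T) ∨
    ∃ x y v, x ≠ y ∧ x ≠ v ∧ y ≠ v ∧ C = {x, y, v} ∧ f {x} = 1 ∧ f {y} = 1 ∧ f {v} = 1 := by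
  have hCO : 2 ≤ O.countP (· ∈ C) := by have := h2 C hC; omega
  have prop : ∀ T, T.Nonempty → T ⊂ C → Proper S T := fun T hne hT =>
    ⟨hT.subset.trans hC.1, hne, fun h => hT.2 (h ▸ hC.1)⟩
  have pos : ∀ T, T.Nonempty → T ⊂ C → 1 ≤ f T := fun T hne hT => by
    by_contra h0
    exact hT.2 (hmin T (prop T hne hT) (by omega))
  have hit : ∀ T, T.Nonempty → T ⊂ C → f T = 1 → ∃ w ∈ O, w ∈ T := fun T hne hT h1 =>
    exists_mem_of_countP (by have := h2 T (prop T hne hT); omega)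
  have inter : ∀ X Y, X ⊂ C → f X = 1 → Y ⊂ C → f Y = 1 →
      (X ∩ Y).Nonempty → ¬ X ⊆ Y → ¬ Y ⊆ X → X ∩ Y ⊂ C ∧ f (X ∩ Y) = 1 := by
    intro X Y hX hX1 hY hY1 hi hXY hYX
    have hs : X ∩ Y ⊂ C := Finset.inter_subset_left.trans_ssubset hX
    have := pos _ hi hs
    have := hf X (hX.subset.trans hC.1) Y (hY.subset.trans hC.1)
    have := mul_card_pos hXY hYX
    exact ⟨hs, by omega⟩
  by_cases he : ∃ X₀ : Finset V, X₀.Nonempty ∧ X₀ ⊂ C ∧ f X₀ = 1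
  swap
  · obtain ⟨w, hw, hwC⟩ := exists_mem_of_countP (X := C) (by omega : 1 ≤ O.countP (· ∈ C))
    obtain ⟨w', hw', hle⟩ := exists_pair_le hCO hw hwC
    exact Or.inl ⟨w, hwC, w', hw', hle, fun T hne hT h1 => absurd ⟨T, hne, hT, h1⟩ he⟩
  obtain ⟨X₀, hX₀⟩ := he
  rcases common_or_disjoint (fun X => X.Nonempty ∧ X ⊂ C ∧ f X = 1) O
    (fun X hX => hit X hX.1 hX.2.1 hX.2.2)
    (fun X Y hX hY hi h h' => ⟨hi, inter X Y hX.2.1 hX.2.2 hY.2.1 hY.2.2 hi h h'⟩) hX₀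
    with ⟨w, hw, h⟩ | ⟨X, Y, ⟨hXn, hXC, hX1⟩, ⟨hYn, hYC, hY1⟩, hd, hle⟩
  · have hwC : w ∈ C := hX₀.2.1.subset (h _ hX₀)
    obtain ⟨w', hw', hle⟩ := exists_pair_le hCO hw hwC
    exact Or.inl ⟨w, hwC, w', hw', hle, fun T hne hT h1 => Or.inl (h T ⟨hne, hT, h1⟩)⟩
  have hXc : X.card = 1 := by
    have hs := hf.disjoint (hXC.subset.trans hC.1) (hYC.subset.trans hC.1) hd
    have p1 := hXn.card_pos
    have p2 := hYn.card_pos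
    by_contra hne
    have : 2 * 2 ≤ X.card * Y.card := Nat.mul_le_mul (by omega) (by omega)
    omega
  obtain ⟨x, rfl⟩ := Finset.card_eq_one.1 hXc
  have hxC : x ∈ C := hXC.subset (by simp)
  have hxO : x ∈ O := by
    obtain ⟨w, hw, h⟩ := hit _ hXn hXC hX1
    rwa [← Finset.mem_singleton.1 h]
  have hxY : x ∉ Y := by simpa using hd
  rcases common_or_disjoint (fun X => X.Nonempty ∧ X ⊂ C ∧ f X = 1 ∧ x ∉ X) O
    (fun X hX => hit X hX.1 hX.2.1 hX.2.2.1)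
    (fun X Y hX hY hi h h' => by
      obtain ⟨h3, h4⟩ := inter X Y hX.2.1 hX.2.2.1 hY.2.1 hY.2.2.1 hi h h'
      exact ⟨hi, h3, h4, fun hx => hX.2.2.2 (Finset.mem_inter.1 hx).1⟩) ⟨hYn, hYC, hY1, hxY⟩
    with ⟨w, hw, h⟩ | ⟨P, Q, ⟨hPn, hPC, hP1, hxP⟩, ⟨hQn, hQC, hQ1, hxQ⟩, hPQ, -⟩
  · have hwY := h _ ⟨hYn, hYC, hY1, hxY⟩
    refine Or.inl ⟨x, hxC, w, hYC.subset hwY, ?_, fun T hne hT h1 => ?_⟩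
    · refine (Multiset.le_iff_subset ?_).2 ?_
      · simp only [Multiset.insert_eq_cons, Multiset.nodup_cons, Multiset.mem_singleton,
          Multiset.nodup_singleton, and_true]
        rintro rfl
        exact hxY hwY
      · intro a ha
        simp only [Multiset.insert_eq_cons, Multiset.mem_cons, Multiset.mem_singleton] at ha
        rcases ha with rfl | rfl <;> assumption
    · by_cases hxT : x ∈ T
      · exact Or.inl hxT
      · exact Or.inr (h T ⟨hne, hT, h1, hxT⟩)
  · right
    have hPQC : P ∪ Q ⊂ C := by
      refine ⟨Finset.union_subset hPC.subset hQC.subset, fun h => ?_⟩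
      have := h hxC
      simp_all
    have hs := hf.disjoint (hPC.subset.trans hC.1) (hQC.subset.trans hC.1) hPQ
    have := pos _ (hPn.mono Finset.subset_union_left) hPQC
    obtain ⟨h3, h4⟩ := card_eq_one_of_mul_le hPn.card_pos hQn.card_pos (by omega)
    obtain ⟨y, rfl⟩ := Finset.card_eq_one.1 h3
    obtain ⟨v, rfl⟩ := Finset.card_eq_one.1 h4
    have hyv : y ≠ v := by simpa using hPQ
    have hxy : x ≠ y := by simpa using hxP
    have hxv : x ≠ v := by simpa using hxQ
    refine ⟨x, y, v, hxy, hxv, hyv, ?_, hX1, hP1, hQ1⟩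
    have hs' := hf.disjoint (hXC.subset.trans hC.1) (hPQC.subset.trans hC.1)
      (by simp [hxy, hxv])
    rw [Finset.card_union_of_disjoint hPQ] at hs'
    simp only [Finset.card_singleton] at hs hs'
    have hsub : ({x} ∪ ({y} ∪ {v}) : Finset V) ⊆ C :=
      Finset.union_subset hXC.subset hPQC.subset
    have := hmin _ ⟨hsub.trans hC.1, by simp, fun h => hC.2.2 (hC.1.antisymm (h ▸ hsub))⟩
      (by omega)
    exact Finset.Subset.antisymm this hsub

lemma pair_le_of_mem {α : Type*} {O : Multiset α} {x y : α} (hxy : x ≠ y) (hx : x ∈ O)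
    (hy : y ∈ O) : {x, y} ≤ O := by
  refine (Multiset.le_iff_subset (by simpa using hxy)).2 fun a ha => ?_
  simp only [Multiset.insert_eq_cons, Multiset.mem_cons, Multiset.mem_singleton] at ha
  rcases ha with rfl | rfl <;> assumption

lemma triple_le_of_mem {α : Type*} {O : Multiset α} {x y v : α} (hxy : x ≠ y) (hxv : x ≠ v)
    (hyv : y ≠ v) (hx : x ∈ O) (hy : y ∈ O) (hv : v ∈ O) : {x, y, v} ≤ O := by
  refine (Multiset.le_iff_subset (by simp [hxy, hxv, hyv])).2 fun a ha => ?_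
  simp only [Multiset.insert_eq_cons, Multiset.mem_cons, Multiset.mem_singleton] at ha
  rcases ha with rfl | rfl | rfl <;> assumption

lemma exists_cons_le {O : Multiset V} {w : V} (hw : w ∈ O) (h : 2 ≤ O.card) :
    ∃ w', {w, w'} ≤ O := by
  have : 0 < (O.erase w).card := by
    rw [Multiset.card_erase_of_mem hw]; exact Nat.sub_pos_of_lt h
  obtain ⟨w', hw'⟩ := Multiset.card_pos_iff_exists_mem.1 this
  refine ⟨w', ?_⟩
  rw [Multiset.insert_eq_cons, ← Multiset.cons_erase hw]
  exact Multiset.cons_le_cons _ (Multiset.singleton_le.2 hw')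

/-- Two singletons of value one such that every other set of value one contains both. -/
def Twin (S : Finset V) (f : Finset V → ℕ) (x y : V) : Prop :=
  x ∈ S ∧ y ∈ S ∧ x ≠ y ∧ f {x} = 1 ∧ f {y} = 1 ∧
    ∀ X, Proper S X → f X = 1 → X = {x} ∨ X = {y} ∨ (x ∈ X ∧ y ∈ X)

lemma Twin.mem {S : Finset V} {f : Finset V → ℕ} {x y : V} (h : Twin S f x y) (hS : 2 ≤ S.card)
    {O : Multiset V} (h2 : ∀ X, Proper S X → 2 ≤ f X + O.countP (· ∈ X)) : x ∈ O ∧ y ∈ O := by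
  obtain ⟨hx, hy, -, hx1, hy1, -⟩ := h
  constructor
  · obtain ⟨w, hw, h⟩ := exists_mem_of_countP (O := O) (X := {x})
      (by have := h2 _ (proper_singleton hS hx); omega)
    rwa [← Finset.mem_singleton.1 h]
  · obtain ⟨w, hw, h⟩ := exists_mem_of_countP (O := O) (X := {y})
      (by have := h2 _ (proper_singleton hS hy); omega)
    rwa [← Finset.mem_singleton.1 h]

lemma two_le_of_cross {S X : Finset V} {f : Finset V → ℕ} {P : Multiset (V × V)}
    (h1 : 1 ≤ f X) (h : f X = 1 → ∃ e ∈ P, e.1 ∈ S \ X ∧ e.2 ∈ X) :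
    2 ≤ f X + arcs P (S \ X) X := by
  by_cases h0 : f X = 1
  · have := arcs_pos.2 (h h0)
    omega
  · omega

/-- The case of `exists_pairs_of_pos` with one twin pair. -/
lemma exists_pairs_of_twin {S : Finset V} {f : Finset V → ℕ} (hS : 4 ≤ S.card)
    (h1 : ∀ X, Proper S X → 1 ≤ f X) {O I : Multiset V} (hIS : ∀ u ∈ I, u ∈ S) (hI : 2 ≤ I.card)
    (hO2 : ∀ X, Proper S X → 2 ≤ f X + O.countP (· ∈ X)) {x y u : V} (ht : Twin S f x y)
    (hu : u ∈ I) (huX : ∀ X, Proper S X → f X = 1 → u ∉ X) :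
    ∃ P : Multiset (V × V), P.map Prod.fst ≤ I ∧ P.map Prod.snd ≤ O ∧ P.card = 2 ∧
      ∀ X, Proper S X → 2 ≤ f X + arcs P (S \ X) X := by
  obtain ⟨hxO, hyO⟩ := ht.mem (by omega) hO2
  obtain ⟨hx, hy, hxy, hx1, hy1, hT⟩ := ht
  obtain ⟨u', hu'⟩ := exists_cons_le hu hI
  have huS := hIS u hu
  have hu'S := hIS u' (Multiset.mem_of_le hu' (by simp))
  have hux : u ≠ x := by simpa using huX _ (proper_singleton (by omega) hx) hx1
  have huy : u ≠ y := by simpa using huX _ (proper_singleton (by omega) hy) hy1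
  by_cases h : u' = y
  · refine ⟨{(u, y), (u', x)}, by simpa using hu', ?_, by simp, fun X hX =>
      two_le_of_cross (h1 X hX) fun hX1 => ?_⟩
    · simpa using pair_le_of_mem hxy.symm hyO hxO
    · have := huX X hX hX1
      subst h
      rcases hT X hX hX1 with rfl | rfl | ⟨hxX, hyX⟩
      · exact ⟨(u', x), by simp, by simp [hu'S, hxy.symm], by simp⟩
      · exact ⟨(u, u'), by simp, by simp [huS, huy], by simp⟩
      · exact ⟨(u, u'), by simp, by simp [huS, this], by simpa using hyX⟩
  · refine ⟨{(u, x), (u', y)}, by simpa using hu', ?_, by simp, fun X hX =>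
      two_le_of_cross (h1 X hX) fun hX1 => ?_⟩
    · simpa using pair_le_of_mem hxy hxO hyO
    · have := huX X hX hX1
      rcases hT X hX hX1 with rfl | rfl | ⟨hxX, hyX⟩
      · exact ⟨(u, x), by simp, by simp [huS, hux], by simp⟩
      · exact ⟨(u', y), by simp, by simp [hu'S, h], by simp⟩
      · exact ⟨(u, x), by simp, by simp [huS, this], by simpa using hxX⟩

lemma map_fst_swap {α : Type*} (P : Multiset (α × α)) :
    (P.map Prod.swap).map Prod.fst = P.map Prod.snd := by
  simp [Multiset.map_map]

lemma map_snd_swap {α : Type*} (P : Multiset (α × α)) :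
    (P.map Prod.swap).map Prod.snd = P.map Prod.fst := by
  simp [Multiset.map_map]

lemma cross_swap {S : Finset V} {f : Finset V → ℕ} {P : Multiset (V × V)}
    (h : ∀ X, Proper S X → 2 ≤ f (S \ X) + arcs P (S \ X) X) :
    ∀ X, Proper S X → 2 ≤ f X + arcs (P.map Prod.swap) (S \ X) X := by
  intro X hX
  have := h _ hX.compl
  rwa [Finset.sdiff_sdiff_eq_self hX.1, ← arcs_swap] at this

/-- Choice of pairs when every nonempty proper subset has positive value. -/
lemma exists_pairs_of_pos {S : Finset V} {f : Finset V → ℕ} (hS : 4 ≤ S.card) (hf : Submod S f)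
    (h1 : ∀ X, Proper S X → 1 ≤ f X) {O I : Multiset V} (hOS : ∀ u ∈ O, u ∈ S)
    (hIS : ∀ u ∈ I, u ∈ S) (hO : 2 ≤ O.card) (hI : 2 ≤ I.card)
    (hO2 : ∀ X, Proper S X → 2 ≤ f X + O.countP (· ∈ X))
    (hI2 : ∀ X, Proper S X → 2 ≤ f (S \ X) + I.countP (· ∈ X)) :
    ∃ P : Multiset (V × V), P.map Prod.fst ≤ I ∧ P.map Prod.snd ≤ O ∧
      (∀ X, Proper S X → 2 ≤ f X + arcs P (S \ X) X) ∧
      (P.card = 1 ∨ P.card = 2 ∧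
        ((∃ x y, Twin S f x y) ∨ ∃ x y, Twin S (fun X => f (S \ X)) x y)) := by
  have h1' : ∀ X, Proper S X → 1 ≤ f (S \ X) := fun X hX => h1 _ hX.compl
  have hO0 : O ≠ 0 := by rintro rfl; simp at hO
  have hI0 : I ≠ 0 := by rintro rfl; simp at hI
  have back : ∀ X, Proper S X → f X = 1 → f (S \ (S \ X)) = 1 := fun X hX h => by
    rwa [Finset.sdiff_sdiff_eq_self hX.1]
  rcases tight_of_pos hS hf h1 hO0 hO2 with ⟨w, hw, hwX⟩ | ⟨x, hx, y, hy, hxy⟩ <;>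
    rcases tight_of_pos hS hf.compl h1' hI0 hI2 with ⟨u, hu, huX⟩ | ⟨p, hp, q, hq, hpq⟩
  · refine ⟨{(u, w)}, by simpa using hu, by simpa using hw, fun X hX =>
      two_le_of_cross (h1 X hX) fun hX1 => ⟨(u, w), by simp, ?_, hwX X hX hX1⟩, Or.inl (by simp)⟩
    exact huX _ hX.compl (back X hX hX1)
  · have ht : Twin S (fun X => f (S \ X)) p q := ⟨hp, hq, hpq⟩
    obtain ⟨P, hP1, hP2, hPc, hP⟩ := exists_pairs_of_twin hS h1' hOS hO hI2 ht hw
      (fun X hX hX1 h => (Finset.mem_sdiff.1 (hwX _ hX.compl hX1)).2 h)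
    exact ⟨P.map Prod.swap, by rwa [map_fst_swap], by rwa [map_snd_swap], cross_swap hP,
      Or.inr ⟨by rwa [Multiset.card_map], Or.inr ⟨p, q, ht⟩⟩⟩
  · have ht : Twin S f x y := ⟨hx, hy, hxy⟩
    obtain ⟨P, hP1, hP2, hPc, hP⟩ := exists_pairs_of_twin hS h1 hIS hI hO2 ht hu
      (fun X hX hX1 h => (Finset.mem_sdiff.1 (huX _ hX.compl (back X hX hX1))).2 h)
    exact ⟨P, hP1, hP2, hP, Or.inr ⟨hPc, Or.inl ⟨x, y, ht⟩⟩⟩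
  · have ht : Twin S f x y := ⟨hx, hy, hxy⟩
    have ht' : Twin S (fun X => f (S \ X)) p q := ⟨hp, hq, hpq⟩
    obtain ⟨hxO, hyO⟩ := ht.mem (by omega) hO2
    obtain ⟨hpI, hqI⟩ := ht'.mem (by omega) hI2
    refine ⟨{(p, x), (q, y)}, by simpa using pair_le_of_mem hpq.1 hpI hqI,
      by simpa using pair_le_of_mem hxy.1 hxO hyO, fun X hX =>
      two_le_of_cross (h1 X hX) fun hX1 => ?_, Or.inr ⟨by simp, Or.inl ⟨x, y, ht⟩⟩⟩
    obtain ⟨hxy, hx1, hy1, hT⟩ := hxy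
    obtain ⟨hpq, -, -, hT'⟩ := hpq
    have key : ∀ z ∈ S, f {z} = 1 → z ≠ p ∧ z ≠ q := by
      intro z hz hz1
      have hzp := proper_singleton (S := S) (by omega) hz
      have hc : (S \ {z}).card + 1 = S.card := by
        have := Finset.card_sdiff_add_card_eq_card hzp.1
        rwa [Finset.card_singleton] at this
      have hn : ∀ r, S \ {z} ≠ {r} := by
        intro r h
        rw [h, Finset.card_singleton] at hc
        omega
      rcases hT' _ hzp.compl (back _ hzp hz1) with h | h | ⟨h3, h4⟩
      · exact absurd h (hn _)
      · exact absurd h (hn _)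
      · simp only [Finset.mem_sdiff, Finset.mem_singleton] at h3 h4
        exact ⟨fun h => h3.2 h.symm, fun h => h4.2 h.symm⟩
    rcases hT X hX hX1 with rfl | rfl | ⟨hxX, hyX⟩
    · exact ⟨(p, x), by simp, by simp [hp, (key x hx hx1).1.symm], by simp⟩
    · exact ⟨(q, y), by simp, by simp [hq, (key y hy hy1).2.symm], by simp⟩
    · have : p ∈ S \ X ∨ q ∈ S \ X := by
        rcases hT' _ hX.compl (back X hX hX1) with h | h | h <;> simp [h]
      rcases this with h | h
      · exact ⟨(p, x), by simp, h, hxX⟩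
      · exact ⟨(q, y), by simp, h, hyX⟩

/-- `C` and `Z` are the smallest and the largest nonempty proper sets of value zero, and every
set of value one is comparable to both of them. -/
structure ZeroCut (S : Finset V) (f : Finset V → ℕ) (C Z : Finset V) : Prop where
  submod : Submod S f
  properC : Proper S C
  zeroC : f C = 0
  min : ∀ X, Proper S X → f X = 0 → C ⊆ X
  properZ : Proper S Z
  zeroZ : f Z = 0
  max : ∀ X, Proper S X → f X = 0 → X ⊆ Z
  out : ∀ T, Proper S T → f T = 1 → C ⊆ T ∨ T ⊂ C
  inn : ∀ T, Proper S T → f T = 1 → T ⊆ Z ∨ Z ⊂ T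

lemma compl_ssubset {S X Y : Finset V} (hY : Y ⊆ S) (h : X ⊂ Y) : S \ Y ⊂ S \ X :=
  ⟨Finset.sdiff_subset_sdiff (Finset.Subset.refl S) h.subset, fun hs => h.2 fun a ha => by
    by_contra hX
    exact (Finset.mem_sdiff.1 (hs (Finset.mem_sdiff.2 ⟨hY ha, hX⟩))).2 ha⟩

lemma ZeroCut.compl {S C Z : Finset V} {f : Finset V → ℕ} (h : ZeroCut S f C Z) :
    ZeroCut S (fun X => f (S \ X)) (S \ Z) (S \ C) where
  submod := h.submod.compl
  properC := h.properZ.compl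
  zeroC := by
    rw [Finset.sdiff_sdiff_eq_self h.properZ.1]
    exact h.zeroZ
  min X hX h0 := by
    have := Finset.sdiff_subset_sdiff (Finset.Subset.refl S) (h.max _ hX.compl h0)
    rwa [Finset.sdiff_sdiff_eq_self hX.1] at this
  properZ := h.properC.compl
  zeroZ := by
    rw [Finset.sdiff_sdiff_eq_self h.properC.1]
    exact h.zeroC
  max X hX h0 := by
    have := Finset.sdiff_subset_sdiff (Finset.Subset.refl S) (h.min _ hX.compl h0)
    rwa [Finset.sdiff_sdiff_eq_self hX.1] at this
  out T hT h1 := by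
    rw [← Finset.sdiff_sdiff_eq_self hT.1]
    exact (h.inn _ hT.compl h1).imp (Finset.sdiff_subset_sdiff (Finset.Subset.refl S))
      (compl_ssubset hT.compl.1)
  inn T hT h1 := by
    rw [← Finset.sdiff_sdiff_eq_self hT.1]
    exact (h.out _ hT.compl h1).imp (Finset.sdiff_subset_sdiff (Finset.Subset.refl S))
      (compl_ssubset h.properC.1)

lemma exists_min_zero {S : Finset V} {f : Finset V → ℕ} (hf : Submod S f)
    (h : ∃ X, Proper S X ∧ f X = 0) :
    ∃ C, Proper S C ∧ f C = 0 ∧ ∀ X, Proper S X → f X = 0 → C ⊆ X := by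
  classical
  obtain ⟨X₀, hX₀⟩ := h
  have hex : ∃ k, ∃ X, (Proper S X ∧ f X = 0) ∧ X.card = k := ⟨_, X₀, hX₀, rfl⟩
  obtain ⟨C, ⟨hC, hC0⟩, hCc⟩ := Nat.find_spec hex
  refine ⟨C, hC, hC0, fun X hX hX0 => ?_⟩
  by_contra h
  have h' : ¬ X ⊆ C := fun h' => h (Finset.eq_of_subset_of_card_le h'
    (hCc ▸ Nat.find_min' hex ⟨X, ⟨hX, hX0⟩, rfl⟩)).symm.subset
  have := hf C hC.1 X hX.1
  have := mul_card_pos h h'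
  omega

lemma singletons_of_disjoint {S : Finset V} {f : Finset V → ℕ} (hf : Submod S f) {C T : Finset V}
    (hC : Proper S C) (hC0 : f C = 0) (hT : Proper S T) (hT1 : f T = 1) (hd : Disjoint T C) :
    ∃ x z, x ≠ z ∧ C = {x} ∧ T = {z} ∧ f {x, z} = 0 := by
  have h := hf.disjoint hC.1 hT.1 hd.symm
  obtain ⟨h3, h4⟩ := card_eq_one_of_mul_le hC.2.1.card_pos hT.2.1.card_pos (by omega)
  rw [h3, h4, hC0, hT1] at h
  obtain ⟨x, rfl⟩ := Finset.card_eq_one.1 h3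
  obtain ⟨z, rfl⟩ := Finset.card_eq_one.1 h4
  exact ⟨x, z, by simpa using hd.symm, rfl, rfl, by simpa [← Finset.insert_eq] using h⟩

/-- Either the extreme sets of value zero exist, or a degenerate pair of singletons does. -/
lemma exists_zeroCut {S : Finset V} {f : Finset V → ℕ} (hf : Submod S f)
    (h : ∃ X, Proper S X ∧ f X = 0) :
    (∃ C Z, ZeroCut S f C Z) ∨
    (∃ x ∈ S, ∃ z ∈ S, x ≠ z ∧ f {x} = 0 ∧ f {z} = 1 ∧ f {x, z} = 0) ∨
    (∃ x ∈ S, ∃ z ∈ S, x ≠ z ∧ f (S \ {x}) = 0 ∧ f (S \ {z}) = 1 ∧ f (S \ {x, z}) = 0) := by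
  obtain ⟨C, hC, hC0, hmin⟩ := exists_min_zero hf h
  have h' : ∃ X, Proper S X ∧ f (S \ X) = 0 := by
    obtain ⟨X, hX, h0⟩ := h
    exact ⟨_, hX.compl, by rwa [Finset.sdiff_sdiff_eq_self hX.1]⟩
  obtain ⟨K, hK, hK0, hKmin⟩ := exists_min_zero hf.compl h'
  by_cases hc : ∃ T, Proper S T ∧ f T = 1 ∧ Disjoint T C
  · obtain ⟨T, hT, hT1, hd⟩ := hc
    obtain ⟨x, z, hxz, rfl, rfl, h0⟩ := singletons_of_disjoint hf hC hC0 hT hT1 hd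
    exact Or.inr (Or.inl ⟨x, by simpa using hC.1, z, by simpa using hT.1, hxz, hC0, hT1, h0⟩)
  by_cases hk : ∃ T, Proper S T ∧ f (S \ T) = 1 ∧ Disjoint T K
  · obtain ⟨T, hT, hT1, hd⟩ := hk
    obtain ⟨x, z, hxz, rfl, rfl, h0⟩ := singletons_of_disjoint hf.compl hK hK0 hT hT1 hd
    exact Or.inr (Or.inr ⟨x, by simpa using hK.1, z, by simpa using hT.1, hxz, hK0, hT1, h0⟩)
  left
  have back : ∀ X, Proper S X → f (S \ (S \ X)) = f X := fun X hX => by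
    rw [Finset.sdiff_sdiff_eq_self hX.1]
  refine ⟨C, S \ K, hf, hC, hC0, hmin, hK.compl, hK0, fun X hX hX0 => ?_, fun T hT hT1 =>
    tight_subset_or hf hC hC0 hmin hT hT1 fun hd => hc ⟨T, hT, hT1, hd⟩, fun T hT hT1 => ?_⟩
  · have := Finset.sdiff_subset_sdiff (Finset.Subset.refl S)
      (hKmin _ hX.compl ((back X hX).trans hX0))
    rwa [Finset.sdiff_sdiff_eq_self hX.1] at this
  · have := tight_subset_or hf.compl hK hK0 hKmin hT.compl ((back T hT).trans hT1) fun hd =>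
      hk ⟨_, hT.compl, (back T hT).trans hT1, hd⟩
    rw [← Finset.sdiff_sdiff_eq_self hT.1]
    exact this.imp (Finset.sdiff_subset_sdiff (Finset.Subset.refl S))
      (compl_ssubset hK.1)

lemma ZeroCut.subset {S C Z : Finset V} {f : Finset V → ℕ} (h : ZeroCut S f C Z) : C ⊆ Z :=
  h.min Z h.properZ h.zeroZ

/-- A criterion for a family of pairs to raise all values to two. -/
lemma ZeroCut.two_le {S C Z : Finset V} {f : Finset V → ℕ} (h : ZeroCut S f C Z)
    {R : Multiset (V × V)} {u₁ u₂ w₁ w₂ : V} (hu₁ : u₁ ∈ S \ Z) (hu₂ : u₂ ∈ S \ Z) (hw₁ : w₁ ∈ C)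
    (hw₂ : w₂ ∈ C)
    (hC : ∀ T, T.Nonempty → T ⊂ C → f T = 1 →
      ∃ e ∈ (u₁, w₁) ::ₘ (u₂, w₂) ::ₘ R, e.1 ∈ S \ T ∧ e.2 ∈ T)
    (hZ : ∀ T, T ⊂ S → Z ⊂ T → f T = 1 →
      ∃ e ∈ (u₁, w₁) ::ₘ (u₂, w₂) ::ₘ R, e.1 ∈ S \ T ∧ e.2 ∈ T) :
    ∀ X, Proper S X → 2 ≤ f X + arcs ((u₁, w₁) ::ₘ (u₂, w₂) ::ₘ R) (S \ X) X := by
  intro X hX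
  rcases Nat.lt_or_ge 1 (f X) with h2 | h2
  · omega
  rcases Nat.le_one_iff_eq_zero_or_eq_one.1 h2 with h0 | h1
  · have h3 := h.min X hX h0
    have h4 := Finset.sdiff_subset_sdiff (Finset.Subset.refl S) (h.max X hX h0)
    rw [arcs_cons, arcs_cons, if_pos ⟨h4 hu₂, h3 hw₂⟩, if_pos ⟨h4 hu₁, h3 hw₁⟩]
    omega
  · refine two_le_of_cross h1.ge fun _ => ?_
    rcases h.inn X hX h1 with h3 | h3
    · rcases h.out X hX h1 with h4 | h4
      · exact ⟨(u₁, w₁), by simp, Finset.sdiff_subset_sdiff (Finset.Subset.refl S) h3 hu₁,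
          h4 hw₁⟩
      · exact hC X hX.2.1 h4 h1
    · exact hZ X hX.ssubset h3 h1

lemma ZeroCut.cross {S C Z T : Finset V} {f : Finset V → ℕ} (h : ZeroCut S f C Z) {u : V}
    (hu : u ∈ S \ Z) (hT : T ⊆ C) : u ∈ S \ T :=
  Finset.sdiff_subset_sdiff (Finset.Subset.refl S) (hT.trans h.subset) hu

/-- Every set inside `C` of value one contains one of `w₁`, `w₂`. -/
def Hits (f : Finset V → ℕ) (C : Finset V) (O : Multiset V) (w₁ w₂ : V) : Prop :=
  w₁ ∈ C ∧ w₂ ∈ C ∧ {w₁, w₂} ≤ O ∧ ∀ T, T.Nonempty → T ⊂ C → f T = 1 → w₁ ∈ T ∨ w₂ ∈ T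

lemma Hits.compl {S Z T : Finset V} {f : Finset V → ℕ} {I : Multiset V} {u₁ u₂ : V}
    (h : Hits (fun X => f (S \ X)) (S \ Z) I u₁ u₂) (hT : T ⊂ S) (hZT : Z ⊂ T)
    (hT1 : f T = 1) : u₁ ∈ S \ T ∨ u₂ ∈ S \ T :=
  h.2.2.2 (S \ T) (Finset.sdiff_nonempty.2 hT.2) (compl_ssubset hT.subset hZT)
    ((congrArg f (Finset.sdiff_sdiff_eq_self hT.subset)).trans hT1)

lemma ZeroCut.exists_pairs_of_hits {S C Z : Finset V} {f : Finset V → ℕ} (h : ZeroCut S f C Z)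
    {O I : Multiset V} {w₁ w₂ u₁ u₂ : V} (hw : Hits f C O w₁ w₂)
    (hu : Hits (fun X => f (S \ X)) (S \ Z) I u₁ u₂) :
    ∃ P : Multiset (V × V), P.map Prod.fst ≤ I ∧ P.map Prod.snd ≤ O ∧ P.card = 2 ∧
      ∀ X, Proper S X → 2 ≤ f X + arcs P (S \ X) X := by
  refine ⟨{(u₁, w₁), (u₂, w₂)}, by simpa using hu.2.2.1, by simpa using hw.2.2.1, by simp,
    h.two_le hu.1 hu.2.1 hw.1 hw.2.1 (fun T hT hTC hT1 => ?_) (fun T hT hZT hT1 => ?_)⟩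
  · rcases hw.2.2.2 T hT hTC hT1 with h' | h'
    · exact ⟨(u₁, w₁), by simp, h.cross hu.1 hTC.subset, h'⟩
    · exact ⟨(u₂, w₂), by simp, h.cross hu.2.1 hTC.subset, h'⟩
  · have hCT := h.subset.trans hZT.subset
    rcases hu.compl hT hZT hT1 with h' | h'
    · exact ⟨(u₁, w₁), by simp, h', hCT hw.1⟩
    · exact ⟨(u₂, w₂), by simp, h', hCT hw.2.1⟩

lemma ZeroCut.two_le_of_triple {S Z : Finset V} {f : Finset V → ℕ} {x y v : V}
    (h : ZeroCut S f {x, y, v} Z) {u₁ u₂ u₃ : V} (hu₁ : u₁ ∈ S \ Z) (hu₂ : u₂ ∈ S \ Z)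
    (hu₃ : u₃ ∈ S) (hv : u₃ ≠ v)
    (hZ : ∀ T, T ⊂ S → Z ⊂ T → f T = 1 → u₁ ∈ S \ T ∨ u₂ ∈ S \ T ∨ u₃ ∈ S \ T) :
    ∀ X, Proper S X → 2 ≤ f X + arcs {(u₁, x), (u₂, y), (u₃, v)} (S \ X) X := by
  refine h.two_le hu₁ hu₂ (by simp) (by simp) (fun T hT hTC _ => ?_) (fun T hT hZT hT1 => ?_)
  · by_cases hx : x ∈ T
    · exact ⟨(u₁, x), by simp, h.cross hu₁ hTC.subset, hx⟩
    by_cases hy : y ∈ T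
    · exact ⟨(u₂, y), by simp, h.cross hu₂ hTC.subset, hy⟩
    have hTv : T ⊆ {v} := by
      intro a ha
      have := hTC.subset ha
      simp only [Finset.mem_insert, Finset.mem_singleton] at this ⊢
      rcases this with rfl | rfl | rfl
      · exact absurd ha hx
      · exact absurd ha hy
      · rfl
    refine ⟨(u₃, v), by simp, Finset.mem_sdiff.2 ⟨hu₃, fun hm => hv (by simpa using hTv hm)⟩, ?_⟩
    obtain ⟨a, ha⟩ := hT
    rwa [← Finset.mem_singleton.1 (hTv ha)]
  · have hCT := h.subset.trans hZT.subset
    rcases hZ T hT hZT hT1 with h' | h' | h'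
    · exact ⟨(u₁, x), by simp, h', hCT (by simp)⟩
    · exact ⟨(u₂, y), by simp, h', hCT (by simp)⟩
    · exact ⟨(u₃, v), by simp, h', hCT (by simp)⟩

lemma mem_of_tight_singleton {S : Finset V} {f : Finset V → ℕ} (hS : 2 ≤ S.card) {O : Multiset V}
    (h2 : ∀ X, Proper S X → 2 ≤ f X + O.countP (· ∈ X)) {x : V} (hx : x ∈ S) (h1 : f {x} = 1) :
    x ∈ O := by
  obtain ⟨w, hw, h⟩ := exists_mem_of_countP (O := O) (X := {x})
    (by have := h2 _ (proper_singleton hS hx); omega)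
  rwa [← Finset.mem_singleton.1 h]

lemma ZeroCut.exists_pairs_of_triple_hits {S Z : Finset V} {f : Finset V → ℕ} {x y v : V}
    (hS : 2 ≤ S.card)
    (h : ZeroCut S f {x, y, v} Z) {O I : Multiset V} (hIS : ∀ u ∈ I, u ∈ S) (hI : 3 ≤ I.card)
    (hO2 : ∀ X, Proper S X → 2 ≤ f X + O.countP (· ∈ X)) (hxy : x ≠ y) (hxv : x ≠ v)
    (hyv : y ≠ v) (hx1 : f {x} = 1) (hy1 : f {y} = 1) (hv1 : f {v} = 1) {u₁ u₂ : V}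
    (hu : Hits (fun X => f (S \ X)) (S \ Z) I u₁ u₂) :
    ∃ P : Multiset (V × V), P.map Prod.fst ≤ I ∧ P.map Prod.snd ≤ O ∧
      ∀ X, Proper S X → 2 ≤ f X + arcs P (S \ X) X := by
  have hxO := mem_of_tight_singleton hS hO2 (h.properC.1 (by simp)) hx1
  have hyO := mem_of_tight_singleton hS hO2 (h.properC.1 (by simp)) hy1
  have hvO := mem_of_tight_singleton hS hO2 (h.properC.1 (by simp)) hv1
  obtain ⟨u₃, hu₃⟩ : ∃ u₃, {u₁, u₂, u₃} ≤ I := by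
    have hc : 0 < (I - {u₁, u₂}).card := by
      rw [Multiset.card_sub hu.2.2.1]
      exact Nat.sub_pos_of_lt hI
    obtain ⟨u₃, h₃⟩ := Multiset.card_pos_iff_exists_mem.1 hc
    refine ⟨u₃, ?_⟩
    rw [← add_tsub_cancel_of_le hu.2.2.1]
    exact le_trans (le_of_eq (by rfl : ({u₁, u₂, u₃} : Multiset V) = {u₁, u₂} + {u₃}))
      (by gcongr; exact Multiset.singleton_le.2 h₃)
  have hu₃S := hIS u₃ (Multiset.mem_of_le hu₃ (by simp))
  have hZ : ∀ T, T ⊂ S → Z ⊂ T → f T = 1 → u₁ ∈ S \ T ∨ u₂ ∈ S \ T ∨ u₃ ∈ S \ T :=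
    fun T hT hZT hT1 => by have := hu.compl hT hZT hT1; tauto
  by_cases hv : u₃ = v
  · have hp : ({x, y, v} : Finset V) = {x, v, y} := by ext; simp; tauto
    rw [hp] at h
    exact ⟨{(u₁, x), (u₂, v), (u₃, y)}, by simpa using hu₃,
      by simpa using triple_le_of_mem hxv hxy hyv.symm hxO hvO hyO,
      h.two_le_of_triple hu.1 hu.2.1 hu₃S (hv ▸ hyv.symm) hZ⟩
  · exact ⟨{(u₁, x), (u₂, y), (u₃, v)}, by simpa using hu₃,
      by simpa using triple_le_of_mem hxy hxv hyv hxO hyO hvO,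
      h.two_le_of_triple hu.1 hu.2.1 hu₃S hv hZ⟩

/-- Choice of pairs when some nonempty proper subset has value zero. -/
lemma exists_pairs_of_zero {S : Finset V} {f : Finset V → ℕ} (hS : 4 ≤ S.card) (hf : Submod S f)
    (h0 : ∃ X, Proper S X ∧ f X = 0) {O I : Multiset V} (hOS : ∀ u ∈ O, u ∈ S)
    (hIS : ∀ u ∈ I, u ∈ S) (hO : 3 ≤ O.card) (hI : 3 ≤ I.card) (hOn : O.Nodup) (hIn : I.Nodup)
    (hO2 : ∀ X, Proper S X → 2 ≤ f X + O.countP (· ∈ X))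
    (hI2 : ∀ X, Proper S X → 2 ≤ f (S \ X) + I.countP (· ∈ X)) :
    ∃ P : Multiset (V × V), P.map Prod.fst ≤ I ∧ P.map Prod.snd ≤ O ∧
      ∀ X, Proper S X → 2 ≤ f X + arcs P (S \ X) X := by
  have hle : ∀ {O : Multiset V}, O.Nodup → ∀ x, O.countP (· ∈ ({x} : Finset V)) ≤ 1 := by
    intro O hOn x
    have := Multiset.nodup_iff_count_le_one.1 hOn x
    refine le_trans (le_of_eq (Multiset.countP_congr rfl fun a _ => ?_)) this
    simp [eq_comm]
  rcases exists_zeroCut hf h0 with ⟨C, Z, h⟩ | ⟨x, hx, -, -, -, h0, -⟩ | ⟨x, hx, -, -, -, h0, -⟩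
  rotate_left
  · have := hO2 _ (proper_singleton (by omega) hx)
    have := hle hOn x
    omega
  · have := hI2 _ (proper_singleton (by omega) hx)
    have := hle hIn x
    omega
  have h' := h.compl
  rcases exists_hitting hf h.properC h.zeroC h.min hO2 with
    ⟨w₁, hw₁, w₂, hw₂, hw, hwT⟩ | ⟨x, y, v, hxy, hxv, hyv, rfl, hx1, hy1, hv1⟩ <;>
  rcases exists_hitting hf.compl h'.properC h'.zeroC h'.min hI2 with
    ⟨u₁, hu₁, u₂, hu₂, hu, huT⟩ | ⟨p, q, r, hpq, hpr, hqr, hZ, hp1, hq1, hr1⟩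
  · obtain ⟨P, h1, h2, -, h3⟩ := h.exists_pairs_of_hits ⟨hw₁, hw₂, hw, hwT⟩ ⟨hu₁, hu₂, hu, huT⟩
    exact ⟨P, h1, h2, h3⟩
  · have hw' : Hits (fun X => f (S \ (S \ X))) (S \ (S \ C)) O w₁ w₂ := by
      rw [Finset.sdiff_sdiff_eq_self h.properC.1]
      refine ⟨hw₁, hw₂, hw, fun T hT hTC hT1 => hwT T hT hTC (Eq.trans ?_ hT1)⟩
      exact congrArg f (Finset.sdiff_sdiff_eq_self (hTC.subset.trans h.properC.1)).symm
    rw [hZ] at h'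
    obtain ⟨P, h1, h2, h3⟩ := h'.exists_pairs_of_triple_hits (by omega) hOS hO hI2 hpq hpr hqr
      hp1 hq1 hr1 hw'
    exact ⟨P.map Prod.swap, by rwa [map_fst_swap], by rwa [map_snd_swap], cross_swap h3⟩
  · exact h.exists_pairs_of_triple_hits (by omega) hIS hI hO2 hxy hxv hyv hx1 hy1 hv1
      ⟨hu₁, hu₂, hu, huT⟩
  · have hxO := mem_of_tight_singleton (by omega) hO2 (h.properC.1 (by simp)) hx1
    have hyO := mem_of_tight_singleton (by omega) hO2 (h.properC.1 (by simp)) hy1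
    have hvO := mem_of_tight_singleton (by omega) hO2 (h.properC.1 (by simp)) hv1
    have hsub := h'.properC.1
    rw [hZ] at hsub
    have hpI := mem_of_tight_singleton (by omega) hI2 (hsub (by simp)) hp1
    have hqI := mem_of_tight_singleton (by omega) hI2 (hsub (by simp)) hq1
    have hrI := mem_of_tight_singleton (by omega) hI2 (hsub (by simp)) hr1
    have hr : r ∈ S \ Z := by simp [hZ]
    refine ⟨{(p, x), (q, y), (r, v)}, by simpa using triple_le_of_mem hpq hpr hqr hpI hqI hrI,
      by simpa using triple_le_of_mem hxy hxv hyv hxO hyO hvO,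
      h.two_le_of_triple (by simp [hZ]) (by simp [hZ]) (hsub (by simp)) ?_ fun T hT hZT hT1 => ?_⟩
    · rintro rfl
      exact (Finset.mem_sdiff.1 hr).2 (h.subset (by simp))
    · have h1 : S \ T ⊆ {p, q, r} := hZ ▸ Finset.sdiff_subset_sdiff (Finset.Subset.refl S)
        hZT.subset
      obtain ⟨a, ha⟩ := Finset.sdiff_nonempty.2 hT.2
      have := h1 ha
      simp only [Finset.mem_insert, Finset.mem_singleton] at this
      rcases this with rfl | rfl | rfl <;> simp [ha]

/-- The tails in `S` of the arcs entering `t`. -/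
def inN (M : Multiset (V × V)) (S : Finset V) (t : V) : Multiset V :=
  (M.filter fun e => e.2 = t ∧ e.1 ∈ S).map Prod.fst

/-- The heads in `S` of the arcs leaving `t`. -/
def outN (M : Multiset (V × V)) (S : Finset V) (t : V) : Multiset V :=
  (M.filter fun e => e.1 = t ∧ e.2 ∈ S).map Prod.snd

lemma mem_inN {M : Multiset (V × V)} {S : Finset V} {t u : V} :
    u ∈ inN M S t ↔ u ∈ S ∧ (u, t) ∈ M := by
  simp only [inN, Multiset.mem_map, Multiset.mem_filter, Prod.exists]
  constructor
  · rintro ⟨a, b, ⟨h, rfl, h'⟩, rfl⟩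
    exact ⟨h', h⟩
  · rintro ⟨h, h'⟩
    exact ⟨u, t, ⟨h', rfl, h⟩, rfl⟩

lemma mem_outN {M : Multiset (V × V)} {S : Finset V} {t u : V} :
    u ∈ outN M S t ↔ u ∈ S ∧ (t, u) ∈ M := by
  simp only [outN, Multiset.mem_map, Multiset.mem_filter, Prod.exists]
  constructor
  · rintro ⟨a, b, ⟨h, rfl, h'⟩, rfl⟩
    exact ⟨h', h⟩
  · rintro ⟨h, h'⟩
    exact ⟨t, u, ⟨h', rfl, h⟩, rfl⟩

lemma outN_swap (M : Multiset (V × V)) (S : Finset V) (t : V) :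
    outN (M.map Prod.swap) S t = inN M S t := by
  simp only [outN, inN, Multiset.filter_map, Multiset.map_map]
  rfl

lemma inN_swap (M : Multiset (V × V)) (S : Finset V) (t : V) :
    inN (M.map Prod.swap) S t = outN M S t := by
  rw [← outN_swap, map_swap_swap]

lemma countP_outN {M : Multiset (V × V)} {S X : Finset V} (hX : X ⊆ S) (t : V) :
    (outN M S t).countP (· ∈ X) = arcs M {t} X := by
  rw [outN, arcs, Multiset.countP_map, ← Multiset.countP_eq_card_filter, Multiset.countP_filter]
  refine Multiset.countP_congr rfl fun e _ => ?_
  have := @hX e.2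
  simp only [Finset.mem_singleton, eq_iff_iff]
  tauto

lemma countP_inN {M : Multiset (V × V)} {S X : Finset V} (hX : X ⊆ S) (t : V) :
    (inN M S t).countP (· ∈ X) = arcs M X {t} := by
  rw [← outN_swap, countP_outN hX, arcs_swap]

lemma card_outN (M : Multiset (V × V)) (S : Finset V) (t : V) :
    (outN M S t).card = arcs M {t} S := by
  rw [← countP_outN (Finset.Subset.refl S), eq_comm, Multiset.countP_eq_card]
  exact fun a ha => (mem_outN.1 ha).1

lemma card_inN (M : Multiset (V × V)) (S : Finset V) (t : V) :
    (inN M S t).card = arcs M S {t} := by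
  rw [← outN_swap, card_outN, arcs_swap]

lemma map_inN (M : Multiset (V × V)) (S : Finset V) (t : V) :
    (inN M S t).map (fun u => (u, t)) = M.filter fun e => e.2 = t ∧ e.1 ∈ S := by
  rw [inN, Multiset.map_map]
  refine (Multiset.map_congr rfl fun e he => ?_).trans (Multiset.map_id _)
  have := (Multiset.mem_filter.1 he).2.1
  simp [← this]

lemma map_outN (M : Multiset (V × V)) (S : Finset V) (t : V) :
    (outN M S t).map (fun u => (t, u)) = M.filter fun e => e.1 = t ∧ e.2 ∈ S := by
  rw [outN, Multiset.map_map]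
  refine (Multiset.map_congr rfl fun e he => ?_).trans (Multiset.map_id _)
  have := (Multiset.mem_filter.1 he).2.1
  simp [← this]

lemma lift_le {M P : Multiset (V × V)} {S : Finset V} {t : V} (ht : t ∉ S) {Ei Eo : Multiset V}
    (hI : P.map Prod.fst + Ei ≤ inN M S t) (hO : P.map Prod.snd + Eo ≤ outN M S t) :
    lift t P + (Ei.map (fun u => (u, t)) + Eo.map (fun w => (t, w))) ≤ M := by
  have h1 := Multiset.map_le_map (f := fun u => (u, t)) hI
  have h2 := Multiset.map_le_map (f := fun w => (t, w)) hO
  rw [map_inN, Multiset.map_add, Multiset.map_map] at h1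
  rw [map_outN, Multiset.map_add, Multiset.map_map] at h2
  calc lift t P + (Ei.map (fun u => (u, t)) + Eo.map (fun w => (t, w)))
      = (P.map (fun e => (e.1, t)) + Ei.map (fun u => (u, t))) +
        (P.map (fun e => (t, e.2)) + Eo.map (fun w => (t, w))) := by
        rw [lift]; abel
    _ ≤ (M.filter fun e => e.2 = t ∧ e.1 ∈ S) + M.filter fun e => ¬ (e.2 = t ∧ e.1 ∈ S) := by
        refine add_le_add h1 (h2.trans (Multiset.monotone_filter_right M ?_))
        rintro e ⟨h3, h4⟩ ⟨h5, -⟩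
        exact ht (h5 ▸ h4)
    _ = M := Multiset.filter_add_not _ _

/-- Re-inserting a vertex whose elimination has been compensated by the arcs of `P`. -/
lemma dec_of_erase {U : Finset V} {t : V} (ht : t ∉ U) {M P : Multiset (V × V)}
    (hI : P.map Prod.fst ≤ inN M U t) (hO : P.map Prod.snd ≤ outN M U t) (h : Dec U (M + P))
    (hc : (∃ X, Proper U X ∧ arcs M (U \ X) X = 0) ∨
      (P ≠ 0 ∧ P.card < (inN M U t).card ∧ P.card < (outN M U t).card)) :
    Dec (insert t U) M := by
  have hPU : ∀ e ∈ P, e.1 ∈ U ∧ e.2 ∈ U := fun e he =>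
    ⟨(mem_inN.1 (Multiset.mem_of_le hI (Multiset.mem_map_of_mem _ he))).1,
      (mem_outN.1 (Multiset.mem_of_le hO (Multiset.mem_map_of_mem _ he))).1⟩
  rcases hc with ⟨X, hX, h0⟩ | ⟨hP, hci, hco⟩
  · refine dec_insert ht hPU (E := 0) ?_ (by simp) h (Or.inl ⟨X, hX.1, hX.2.1, hX.2.2, h0⟩)
    simpa using lift_le ht (Ei := 0) (Eo := 0) (by simpa using hI) (by simpa using hO)
  · have ex : ∀ {A B : Multiset V}, A ≤ B → A.card < B.card → ∃ a, A + {a} ≤ B := by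
      intro A B hAB hc
      have : 0 < (B - A).card := by
        rw [Multiset.card_sub hAB]; exact Nat.sub_pos_of_lt hc
      obtain ⟨a, ha⟩ := Multiset.card_pos_iff_exists_mem.1 this
      refine ⟨a, ?_⟩
      calc A + {a} ≤ A + (B - A) := by gcongr; exact Multiset.singleton_le.2 ha
        _ = B := add_tsub_cancel_of_le hAB
    obtain ⟨u, hu⟩ := ex hI (by simpa using hci)
    obtain ⟨w, hw⟩ := ex hO (by simpa using hco)
    refine dec_insert ht hPU (lift_le ht hu hw) ?_ h (Or.inr ⟨hP, u, ?_, w, ?_, ?_⟩)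
    · intro e he
      simp only [Multiset.map_singleton, Multiset.mem_add, Multiset.mem_singleton] at he
      rcases he with rfl | rfl <;> simp
    · exact (mem_inN.1 (Multiset.mem_of_le hu (by simp))).1
    · exact (mem_outN.1 (Multiset.mem_of_le hw (by simp))).1
    · simp

lemma cut_insert_of_notMem {M : Multiset (V × V)} {U X : Finset V} {t : V} (ht : t ∉ U)
    (hX : X ⊆ U) :
    arcs M (insert t U \ X) X = arcs M (U \ X) X + (outN M U t).countP (· ∈ X) := by
  have htX : t ∉ X := fun h => ht (hX h)
  rw [Finset.insert_sdiff_of_notMem _ htX, Finset.insert_eq, arcs_union_left, countP_outN hX,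
    add_comm]
  simp [ht]

lemma cut_insert_insert {M : Multiset (V × V)} {U X : Finset V} {t : V} (ht : t ∉ U) (hX : X ⊆ U) :
    arcs M (insert t U \ insert t X) (insert t X) =
      arcs M (U \ X) X + (inN M U t).countP (· ∈ U \ X) := by
  have htX : t ∉ X := fun h => ht (hX h)
  have h : insert t U \ insert t X = U \ X := by
    ext a
    simp only [Finset.mem_sdiff, Finset.mem_insert]
    have : a = t → a ∉ U := by rintro rfl; exact ht
    tauto
  rw [h, Finset.insert_eq, arcs_union_right _ (by simpa using htX),
    countP_inN Finset.sdiff_subset, add_comm]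

lemma Str.two_le_out {k : ℕ} {M : Multiset (V × V)} {U X : Finset V} {t : V} (ht : t ∉ U)
    (h : Str k (insert t U) M) (hX : X ⊆ U) (hne : X.Nonempty) :
    k ≤ arcs M (U \ X) X + (outN M U t).countP (· ∈ X) := by
  rw [← cut_insert_of_notMem ht hX]
  refine h X (hX.trans (Finset.subset_insert _ _)) hne ?_
  rintro rfl
  exact ht (hX (Finset.mem_insert_self _ _))

lemma Str.two_le_in {k : ℕ} {M : Multiset (V × V)} {U X : Finset V} {t : V} (ht : t ∉ U)
    (h : Str k (insert t U) M) (hX : X ⊆ U) (hne : X ≠ U) :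
    k ≤ arcs M (U \ X) X + (inN M U t).countP (· ∈ U \ X) := by
  rw [← cut_insert_insert ht hX]
  refine h _ (Finset.insert_subset_insert _ hX) (by simp) fun he => hne ?_
  have htX : t ∉ X := fun h => ht (hX h)
  rw [← Finset.erase_insert htX, he, Finset.erase_insert ht]

lemma Str.le_card_out {k : ℕ} {M : Multiset (V × V)} {U : Finset V} {t : V} (ht : t ∉ U)
    (h : Str k (insert t U) M) (hne : U.Nonempty) : k ≤ (outN M U t).card := by
  have := h.two_le_out ht (Finset.Subset.refl U) hne
  rw [countP_outN (Finset.Subset.refl U), ← card_outN] at this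
  simpa [arcs] using this

lemma Str.le_card_in {k : ℕ} {M : Multiset (V × V)} {U : Finset V} {t : V} (ht : t ∉ U)
    (h : Str k (insert t U) M) (hne : U.Nonempty) : k ≤ (inN M U t).card := by
  have := h.two_le_in ht (Finset.empty_subset U) hne.ne_empty.symm
  rw [Finset.sdiff_empty, countP_inN (Finset.Subset.refl U), ← card_inN] at this
  simpa [arcs] using this

lemma cut_submod (M : Multiset (V × V)) {U X Y : Finset V} (hX : X ⊆ U) (hY : Y ⊆ U) :
    arcs M (U \ (X ∩ Y)) (X ∩ Y) + arcs M (U \ (X ∪ Y)) (X ∪ Y) +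
      (arcs M (X \ Y) (Y \ X) + arcs M (Y \ X) (X \ Y)) ≤
    arcs M (U \ X) X + arcs M (U \ Y) Y := by
  induction M using Multiset.induction with
  | empty => simp
  | cons e M ih =>
    simp only [arcs_cons]
    refine le_trans ?_ (le_trans (add_le_add_left ih
      ((if e.1 ∈ U \ X ∧ e.2 ∈ X then 1 else 0) + (if e.1 ∈ U \ Y ∧ e.2 ∈ Y then 1 else 0)))
      (by omega))
    have h1 := @hX e.1
    have h2 := @hY e.1
    have key : (if e.1 ∈ U \ (X ∩ Y) ∧ e.2 ∈ X ∩ Y then 1 else 0) +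
        (if e.1 ∈ U \ (X ∪ Y) ∧ e.2 ∈ X ∪ Y then 1 else 0) +
        ((if e.1 ∈ X \ Y ∧ e.2 ∈ Y \ X then 1 else 0) +
          (if e.1 ∈ Y \ X ∧ e.2 ∈ X \ Y then 1 else 0)) ≤
        (if e.1 ∈ U \ X ∧ e.2 ∈ X then 1 else 0) + (if e.1 ∈ U \ Y ∧ e.2 ∈ Y then 1 else 0) := by
      simp only [Finset.mem_sdiff, Finset.mem_inter, Finset.mem_union]
      by_cases a1 : e.1 ∈ U <;> by_cases a2 : e.1 ∈ X <;> by_cases a3 : e.1 ∈ Y <;>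
        by_cases a4 : e.2 ∈ X <;> by_cases a5 : e.2 ∈ Y <;> simp_all
    omega

lemma card_mul_card_le {S : Finset V} {M : Multiset (V × V)} (h : Semi S M) {A B : Finset V}
    (hA : A ⊆ S) (hB : B ⊆ S) (hd : Disjoint A B) :
    A.card * B.card ≤ arcs M A B + arcs M B A := by
  have one : ∀ a ∈ S, ∀ B ⊆ S, a ∉ B → B.card ≤ arcs M {a} B + arcs M B {a} := by
    intro a ha B hB haB
    induction B using Finset.induction with
    | empty => simp
    | insert b B hb ih =>
      rw [Finset.card_insert_of_notMem hb, Finset.insert_eq, arcs_union_left _ (by simpa),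
        arcs_union_right _ (by simpa)]
      have := ih ((Finset.subset_insert _ _).trans hB) fun h => haB (Finset.mem_insert_of_mem h)
      have hab : a ≠ b := fun h => haB (h ▸ Finset.mem_insert_self _ _)
      have : 1 ≤ arcs M {a} {b} + arcs M {b} {a} := by
        rcases h a ha b (hB (Finset.mem_insert_self _ _)) hab with h | h
        · have := arcs_pos_of_mem h (Y := {a}) (X := {b}) (by simp) (by simp)
          omega
        · have := arcs_pos_of_mem h (Y := {b}) (X := {a}) (by simp) (by simp)
          omega
      omega
  induction A using Finset.induction with
  | empty => simp
  | insert a A ha ih =>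
    rw [Finset.card_insert_of_notMem ha, Finset.insert_eq, arcs_union_left _ (by simpa),
      arcs_union_right _ (by simpa), add_mul, one_mul]
    rw [Finset.disjoint_insert_left] at hd
    have := ih ((Finset.subset_insert _ _).trans hA) hd.2
    have := one a (hA (Finset.mem_insert_self _ _)) B hB hd.1
    omega

lemma submod_cut {M : Multiset (V × V)} {U : Finset V} (h : Semi U M) :
    Submod U fun X => arcs M (U \ X) X := by
  intro X hX Y hY
  have := cut_submod M hX hY
  have := card_mul_card_le h (Finset.sdiff_subset.trans hX : X \ Y ⊆ U)
    (Finset.sdiff_subset.trans hY : Y \ X ⊆ U) (by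
      rw [Finset.disjoint_left]; intro a; simp; tauto)
  dsimp only
  omega

/-- The least number of arcs entering a set whose trace on the semicomplete part is `X`. -/
def traceCut (M : Multiset (V × V)) (S T X : Finset V) : ℕ :=
  T.powerset.inf' ⟨∅, Finset.empty_mem_powerset T⟩ fun R => arcs M ((S ∪ T) \ (X ∪ R)) (X ∪ R)

lemma traceCut_le {M : Multiset (V × V)} {S T X R : Finset V} (hR : R ⊆ T) :
    traceCut M S T X ≤ arcs M ((S ∪ T) \ (X ∪ R)) (X ∪ R) :=
  Finset.inf'_le _ (Finset.mem_powerset.2 hR)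

lemma exists_traceCut (M : Multiset (V × V)) (S T X : Finset V) :
    ∃ R ⊆ T, traceCut M S T X = arcs M ((S ∪ T) \ (X ∪ R)) (X ∪ R) := by
  obtain ⟨R, hR, h⟩ := Finset.exists_mem_eq_inf' ⟨∅, Finset.empty_mem_powerset T⟩
    fun R => arcs M ((S ∪ T) \ (X ∪ R)) (X ∪ R)
  exact ⟨R, Finset.mem_powerset.1 hR, h⟩

lemma submod_traceCut {M : Multiset (V × V)} {S T : Finset V} (hST : Disjoint S T)
    (h : Semi S M) : Submod S (traceCut M S T) := by
  intro X hX Y hY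
  obtain ⟨A, hA, hXA⟩ := exists_traceCut M S T X
  obtain ⟨B, hB, hYB⟩ := exists_traceCut M S T Y
  have key : ∀ a ∈ S, a ∉ T := fun a ha => Finset.disjoint_left.1 hST ha
  have h1 : X ∩ Y ∪ A ∩ B = (X ∪ A) ∩ (Y ∪ B) := by
    ext a
    have := key a; have := @hX a; have := @hY a; have := @hA a; have := @hB a
    simp only [Finset.mem_union, Finset.mem_inter]
    tauto
  have h2 : X ∪ Y ∪ (A ∪ B) = (X ∪ A) ∪ (Y ∪ B) := by
    ext a
    simp only [Finset.mem_union]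
    tauto
  have h3 := traceCut_le (M := M) (S := S) (X := X ∩ Y)
    ((Finset.inter_subset_left.trans hA : A ∩ B ⊆ T))
  have h4 := traceCut_le (M := M) (S := S) (X := X ∪ Y) (Finset.union_subset hA hB)
  rw [h1] at h3
  rw [h2] at h4
  have h5 := cut_submod M (Finset.union_subset_union hX hA) (Finset.union_subset_union hY hB)
  have h6 := card_mul_card_le h (Finset.sdiff_subset.trans hX : X \ Y ⊆ S)
    (Finset.sdiff_subset.trans hY : Y \ X ⊆ S) (by
      rw [Finset.disjoint_left]; intro a; simp; tauto)
  have h7 : X \ Y ⊆ (X ∪ A) \ (Y ∪ B) := by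
    intro a
    have := key a; have := @hX a; have := @hB a
    simp only [Finset.mem_union, Finset.mem_sdiff]
    tauto
  have h8 : Y \ X ⊆ (Y ∪ B) \ (X ∪ A) := by
    intro a
    have := key a; have := @hY a; have := @hA a
    simp only [Finset.mem_union, Finset.mem_sdiff]
    tauto
  have h9 := arcs_mono_set M h7 h8
  have h10 := arcs_mono_set M h8 h7
  omega

/-- A semicomplete part `S` and independent vertices `T` of large degree joined to `S` by
simple arcs. -/
structure Split (S T : Finset V) (M : Multiset (V × V)) : Prop where
  disjoint : Disjoint S T
  semi : Semi S M
  indep : ∀ e ∈ M, e.1 ∈ T → e.2 ∉ T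
  nodup_in : ∀ t ∈ T, (inN M S t).Nodup
  nodup_out : ∀ t ∈ T, (outN M S t).Nodup
  card_in : ∀ t ∈ T, 3 ≤ (inN M S t).card
  card_out : ∀ t ∈ T, 3 ≤ (outN M S t).card

lemma inN_union {S T : Finset V} {M : Multiset (V × V)} {t : V}
    (h : ∀ u ∈ T, (u, t) ∉ M) : inN M (S ∪ T) t = inN M S t := by
  unfold inN
  refine congrArg _ (Multiset.filter_congr ?_)
  rintro ⟨u, v⟩ he
  have := h u
  simp only [Finset.mem_union]
  constructor
  · rintro ⟨rfl, h | h⟩ <;> tauto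
  · rintro ⟨rfl, h3⟩; exact ⟨rfl, Or.inl h3⟩

lemma outN_union {S T : Finset V} {M : Multiset (V × V)} {t : V}
    (h : ∀ u ∈ T, (t, u) ∉ M) : outN M (S ∪ T) t = outN M S t := by
  rw [← inN_swap, ← inN_swap, inN_union]
  simpa using h

lemma countP_union_of_subset {O : Multiset V} {S T X R : Finset V} (hST : Disjoint S T)
    (hO : ∀ u ∈ O, u ∈ S) (hR : R ⊆ T) : O.countP (· ∈ X ∪ R) = O.countP (· ∈ X) := by
  refine Multiset.countP_congr rfl fun a ha => ?_
  have : a ∉ R := fun h => Finset.disjoint_left.1 hST (hO a ha) (hR h)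
  simp [this]

/-- Elimination of one vertex of the independent part. -/
lemma Split.eliminate {S T : Finset V} {t : V} {M : Multiset (V × V)} (ht : t ∉ T)
    (h : Split S (insert t T) M) (hM : Str 2 (insert t (S ∪ T)) M) (hS : 4 ≤ S.card) :
    ∃ P, Split S T (M + P) ∧ Str 2 (S ∪ T) (M + P) ∧
      (Dec (S ∪ T) (M + P) → Dec (insert t (S ∪ T)) M) := by
  have htT : t ∈ insert t T := Finset.mem_insert_self _ _
  have hTT : T ⊆ insert t T := Finset.subset_insert _ _
  have hST : Disjoint S T := h.disjoint.mono_right hTT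
  have htS : t ∉ S := fun hs => Finset.disjoint_left.1 h.disjoint hs htT
  have htU : t ∉ S ∪ T := by simp [htS, ht]
  have hin : inN M (S ∪ T) t = inN M S t :=
    inN_union fun u hu hm => h.indep _ hm (hTT hu) htT
  have hout : outN M (S ∪ T) t = outN M S t :=
    outN_union fun u hu hm => h.indep _ hm htT (hTT hu)
  have hIS : ∀ u ∈ inN M S t, u ∈ S := fun u hu => (mem_inN.1 hu).1
  have hOS : ∀ u ∈ outN M S t, u ∈ S := fun u hu => (mem_outN.1 hu).1
  have trace : ∀ X ⊆ S, ∀ R ⊆ T, (X ∪ R) ∩ S = X := by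
    intro X hX R hR
    rw [Finset.union_inter_distrib_right, Finset.inter_eq_left.2 hX,
      Finset.disjoint_iff_inter_eq_empty.1 (hST.symm.mono_left hR), Finset.union_empty]
  have hf := submod_traceCut (T := T) hST h.semi
  have hO2 : ∀ X, Proper S X → 2 ≤ traceCut M S T X + (outN M S t).countP (· ∈ X) := by
    intro X hX
    obtain ⟨R, hR, hXR⟩ := exists_traceCut M S T X
    have := hM.two_le_out htU (Finset.union_subset_union hX.1 hR)
      (hX.2.1.mono Finset.subset_union_left)
    rwa [hout, countP_union_of_subset hST hOS hR, ← hXR] at this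
  have hI2 : ∀ X, Proper S X → 2 ≤ traceCut M S T (S \ X) + (inN M S t).countP (· ∈ X) := by
    intro X hX
    obtain ⟨R, hR, hXR⟩ := exists_traceCut M S T (S \ X)
    have := hM.two_le_in htU (Finset.union_subset_union Finset.sdiff_subset hR) (fun he => by
      have h1 := trace (S \ X) Finset.sdiff_subset R hR
      rw [he, Finset.union_inter_cancel_left] at h1
      exact hX.compl.2.2 h1.symm)
    rw [hin, ← hXR] at this
    refine this.trans_eq (congrArg _ (Multiset.countP_congr rfl fun a ha => ?_))
    have h1 := hIS a ha
    have h2 : a ∉ T := Finset.disjoint_left.1 hST h1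
    have h3 : a ∉ R := fun h => h2 (hR h)
    simp [h1, h3]
  have hex : ∃ P : Multiset (V × V), P.map Prod.fst ≤ inN M S t ∧ P.map Prod.snd ≤ outN M S t ∧
      (∀ X, Proper S X → 2 ≤ traceCut M S T X + arcs P (S \ X) X) ∧
      ((∃ X, Proper S X ∧ traceCut M S T X = 0) ∨ (P ≠ 0 ∧ P.card ≤ 2)) := by
    have c1 := h.card_in t htT
    have c2 := h.card_out t htT
    by_cases h0 : ∃ X, Proper S X ∧ traceCut M S T X = 0
    · obtain ⟨P, h1, h2, h3⟩ := exists_pairs_of_zero hS hf h0 hOS hIS c2 c1 (h.nodup_out t htT)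
        (h.nodup_in t htT) hO2 hI2
      exact ⟨P, h1, h2, h3, Or.inl h0⟩
    · obtain ⟨P, h1, h2, h3, h4⟩ := exists_pairs_of_pos hS hf
        (fun X hX => Nat.one_le_iff_ne_zero.2 fun hX0 => h0 ⟨X, hX, hX0⟩) hOS hIS
        (by omega) (by omega) hO2 hI2
      refine ⟨P, h1, h2, h3, Or.inr ⟨?_, by omega⟩⟩
      rintro rfl
      simp at h4
  obtain ⟨P, hPI, hPO, hP, hc⟩ := hex
  have hPS : ∀ e ∈ P, e.1 ∈ S ∧ e.2 ∈ S := fun e he =>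
    ⟨hIS _ (Multiset.mem_of_le hPI (Multiset.mem_map_of_mem _ he)),
      hOS _ (Multiset.mem_of_le hPO (Multiset.mem_map_of_mem _ he))⟩
  have hPin : ∀ s ∈ T, inN (M + P) S s = inN M S s := by
    intro s hs
    have h0 : P.filter (fun e => e.2 = s ∧ e.1 ∈ S) = 0 := by
      refine Multiset.filter_eq_nil.2 ?_
      rintro e he ⟨rfl, -⟩
      exact Finset.disjoint_left.1 hST (hPS e he).2 hs
    rw [inN, Multiset.filter_add, h0, add_zero, ← inN]
  have hPout : ∀ s ∈ T, outN (M + P) S s = outN M S s := by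
    intro s hs
    have h0 : P.filter (fun e => e.1 = s ∧ e.2 ∈ S) = 0 := by
      refine Multiset.filter_eq_nil.2 ?_
      rintro e he ⟨rfl, -⟩
      exact Finset.disjoint_left.1 hST (hPS e he).1 hs
    rw [outN, Multiset.filter_add, h0, add_zero, ← outN]
  refine ⟨P, ⟨hST, h.semi.mono (Finset.Subset.refl S) (Multiset.le_add_right _ _), ?_,
    fun s hs => hPin s hs ▸ h.nodup_in s (hTT hs), fun s hs => hPout s hs ▸ h.nodup_out s (hTT hs),
    fun s hs => hPin s hs ▸ h.card_in s (hTT hs),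
    fun s hs => hPout s hs ▸ h.card_out s (hTT hs)⟩, ?_, fun hd => ?_⟩
  · intro e he h1 h2
    rcases Multiset.mem_add.1 he with he | he
    · exact h.indep e he (hTT h1) (hTT h2)
    · exact Finset.disjoint_left.1 hST (hPS e he).1 h1
  · intro X hX hne hXU
    rcases (X ∩ S).eq_empty_or_nonempty with h0 | h0
    · obtain ⟨s, hs⟩ := hne
      have hXS : ∀ a ∈ X, a ∉ S := fun a ha has => by
        have : a ∈ X ∩ S := Finset.mem_inter.2 ⟨ha, has⟩
        simp [h0] at this
      have hsT : s ∈ T := (Finset.mem_union.1 (hX hs)).resolve_left (hXS s hs)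
      have c := h.card_in s (hTT hsT)
      rw [card_inN] at c
      have := arcs_mono_set M (Y := S) (Y' := (S ∪ T) \ X) (X := {s}) (X' := X)
        (fun a ha => by
          simp only [Finset.mem_sdiff, Finset.mem_union]
          exact ⟨Or.inl ha, fun h => hXS a h ha⟩) (by simpa using hs)
      rw [arcs_add]
      omega
    by_cases h1 : X ∩ S = S
    · obtain ⟨s, hs⟩ := Finset.sdiff_nonempty.2 fun h => hXU (hX.antisymm h)
      have hSX : S ⊆ X := Finset.inter_eq_right.1 h1
      have hsT : s ∈ T := by
        have h2 := Finset.mem_sdiff.1 hs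
        exact (Finset.mem_union.1 h2.1).resolve_left fun h => h2.2 (hSX h)
      have c := h.card_out s (hTT hsT)
      rw [card_outN] at c
      have := arcs_mono_set M (Y := {s}) (Y' := (S ∪ T) \ X) (X := S) (X' := X)
        (by simpa using hs) hSX
      rw [arcs_add]
      omega
    · have h2 := hP (X ∩ S) ⟨Finset.inter_subset_right, h0, h1⟩
      have hXe : X ∩ S ∪ X ∩ T = X := by
        rw [← Finset.inter_union_distrib_left, Finset.inter_eq_left.2 hX]
      have h3 := traceCut_le (M := M) (S := S) (X := X ∩ S) (Finset.inter_subset_right : X ∩ T ⊆ T)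
      rw [hXe] at h3
      have h4 := arcs_mono_set P (Y := S \ (X ∩ S)) (Y' := (S ∪ T) \ X) (X := X ∩ S) (X' := X)
        (fun a ha => by
          simp only [Finset.mem_sdiff, Finset.mem_union, Finset.mem_inter] at ha ⊢
          tauto) Finset.inter_subset_left
      rw [arcs_add]
      omega
  · refine dec_of_erase htU (hin ▸ hPI) (hout ▸ hPO) hd ?_
    rcases hc with ⟨X, hX, h0⟩ | ⟨h1, h2⟩
    · obtain ⟨R, hR, hXR⟩ := exists_traceCut M S T X
      refine Or.inl ⟨X ∪ R, ⟨Finset.union_subset_union hX.1 hR,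
        hX.2.1.mono Finset.subset_union_left, fun he => ?_⟩, by omega⟩
      have h1 := trace X hX.1 R hR
      rw [he, Finset.union_inter_cancel_left] at h1
      exact hX.2.2 h1.symm
    · have c1 := h.card_in t htT
      have c2 := h.card_out t htT
      exact Or.inr ⟨h1, by rw [hin]; omega, by rw [hout]; omega⟩

lemma two_le_arcs {M : Multiset (V × V)} {Y X : Finset V} {a b c d : V} (h : (a, b) ∈ M)
    (h' : (c, d) ∈ M) (hne : (a, b) ≠ (c, d)) (ha : a ∈ Y) (hb : b ∈ X) (hc : c ∈ Y) (hd : d ∈ X) :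
    2 ≤ arcs M Y X := by
  refine le_trans ?_ (arcs_mono (pair_le_of_mem hne h h') _ _)
  rw [Multiset.insert_eq_cons, arcs_cons, arcs_singleton]
  simp [ha, hb, hc, hd]

lemma card_le_arcs {M : Multiset (V × V)} {X : Finset V} {z : V} (h : ∀ w ∈ X, (z, w) ∈ M)
    {Y X' : Finset V} (hz : z ∈ Y) (hX : X ⊆ X') : X.card ≤ arcs M Y X' := by
  refine le_trans ?_ (arcs_mono_set M (Finset.singleton_subset_iff.2 hz) hX)
  clear hX
  induction X using Finset.induction with
  | empty => simp
  | insert a X ha ih =>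
    rw [Finset.card_insert_of_notMem ha, Finset.insert_eq, arcs_union_right _ (by simpa)]
    have := ih fun w hw => h w (Finset.mem_insert_of_mem hw)
    have := arcs_pos_of_mem (h a (Finset.mem_insert_self _ _)) (Y := {z}) (X := {a}) (by simp)
      (by simp)
    omega

lemma arcs_le_arcs {M : Multiset (V × V)} {Y X Y' X' : Finset V}
    (h : ∀ u v, (u, v) ∈ M → u ∈ Y → v ∈ X → u ∈ Y' ∧ v ∈ X') : arcs M Y X ≤ arcs M Y' X' := by
  have : arcs M Y X = arcs (M.filter fun e => e.1 ∈ Y' ∧ e.2 ∈ X') Y X := by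
    rw [arcs, arcs, Multiset.countP_filter]
    refine Multiset.countP_congr rfl fun e he => ?_
    have := h e.1 e.2 he
    simp only [eq_iff_iff]
    tauto
  rw [this]
  refine (Multiset.countP_le_card _ _).trans ?_
  rw [arcs, Multiset.countP_eq_card_filter]

lemma exists_mem_of_arcs_pos {M : Multiset (V × V)} {a b : V} (h : 1 ≤ arcs M {a} {b}) :
    (a, b) ∈ M := by
  obtain ⟨⟨c, d⟩, he, h3, h4⟩ := arcs_pos.1 h
  simp only [Finset.mem_singleton] at h3 h4
  rwa [← h3, ← h4]

/-- Every 2-arc-strong semicomplete multidigraph on `n` vertices is decomposable. -/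
def SemiDec (V : Type*) [DecidableEq V] (n : ℕ) : Prop :=
  ∀ (S : Finset V) (M : Multiset (V × V)), S.card = n → Semi S M → Str 2 S M → Dec S M

lemma SemiDec.of_pairs {n : ℕ} (ih : SemiDec V n) {U : Finset V} {t : V} (ht : t ∈ U)
    (hU : U.card = n + 1) {M P : Multiset (V × V)} (hM : Semi U M)
    (hI : P.map Prod.fst ≤ inN M (U.erase t) t) (hO : P.map Prod.snd ≤ outN M (U.erase t) t)
    (hP : ∀ X, Proper (U.erase t) X → 2 ≤ arcs M (U.erase t \ X) X + arcs P (U.erase t \ X) X)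
    (hc : (∃ X, Proper (U.erase t) X ∧ arcs M (U.erase t \ X) X = 0) ∨
      (P ≠ 0 ∧ P.card < (inN M (U.erase t) t).card ∧ P.card < (outN M (U.erase t) t).card)) :
    Dec U M := by
  have := dec_of_erase (Finset.notMem_erase t U) hI hO (ih _ _
    (by rw [Finset.card_erase_of_mem ht, hU]; rfl) (hM.mono (Finset.erase_subset _ _)
    (Multiset.le_add_right _ _)) fun X hX hne hXS => ?_) hc
  · rwa [Finset.insert_erase ht] at this
  · rw [arcs_add]
    exact hP X ⟨hX, hne, hXS⟩

lemma SemiDec.of_pair {n : ℕ} (ih : SemiDec V n) {U : Finset V} {t u w : V} (ht : t ∈ U)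
    (hU : U.card = n + 1) {M : Multiset (V × V)} (hM : Semi U M) (h2 : Str 2 U M)
    (huS : u ∈ U) (hwS : w ∈ U) (hut : u ≠ t) (hwt : w ≠ t) (hu : (u, t) ∈ M) (hw : (t, w) ∈ M)
    (hP : ∀ X ⊆ U, t ∉ X → X.Nonempty → X ≠ U.erase t → 2 ≤ arcs M (U.erase t \ X) X ∨
      1 ≤ arcs M (U.erase t \ X) X ∧ u ∉ X ∧ w ∈ X) :
    Dec U M := by
  have huE : u ∈ U.erase t := by simp [hut, huS]
  have hwE : w ∈ U.erase t := by simp [hwt, hwS]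
  rw [← Finset.insert_erase ht] at h2
  refine ih.of_pairs ht hU hM (P := {(u, w)}) ?_ ?_ (fun X hX => ?_) (Or.inr ⟨by simp, ?_, ?_⟩)
  · simpa [mem_inN] using ⟨⟨hut, huS⟩, hu⟩
  · simpa [mem_outN] using ⟨⟨hwt, hwS⟩, hw⟩
  · rw [arcs_singleton]
    rcases hP X (hX.1.trans (Finset.erase_subset _ _))
      (fun h => Finset.notMem_erase t U (hX.1 h)) hX.2.1 hX.2.2 with h | ⟨h, h3, h4⟩
    · omega
    · rw [if_pos ⟨Finset.mem_sdiff.2 ⟨huE, h3⟩, h4⟩]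
      omega
  · exact h2.le_card_in (Finset.notMem_erase t U) ⟨u, huE⟩
  · exact h2.le_card_out (Finset.notMem_erase t U) ⟨u, huE⟩

lemma SemiDec.of_source {n : ℕ} (ih : SemiDec V n) (hn : 4 ≤ n) {U : Finset V} {t x z : V}
    (ht : t ∈ U) (hU : U.card = n + 1) {M : Multiset (V × V)} (hM : Semi U M)
    (h2 : Str 2 U M) (hx : x ∈ U) (hz : z ∈ U) (htx : t ≠ x) (htz : t ≠ z) (hxz : x ≠ z)
    (hfx : arcs M (U.erase t \ {x}) {x} = 0) (hfz : arcs M (U.erase t \ {z}) {z} = 1)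
    (hfxz : arcs M (U.erase t \ {x, z}) {x, z} = 0) : Dec U M := by
  have inx : ∀ u ∈ U, u ≠ t → u ≠ x → (u, x) ∉ M := fun u hu hut hux h => by
    have := arcs_pos_of_mem h (Y := U.erase t \ {x}) (X := {x}) (by simp [hu, hut, hux]) (by simp)
    omega
  have inz : ∀ u ∈ U, u ≠ t → u ≠ x → u ≠ z → (u, z) ∉ M := fun u hu hut hux huz h => by
    have := arcs_pos_of_mem h (Y := U.erase t \ {x, z}) (X := {x, z}) (by simp [hu, hut, hux, huz])
      (by simp)
    omega
  have outx : ∀ u ∈ U, u ≠ t → u ≠ x → (x, u) ∈ M := fun u hu hut hux =>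
    (hM x hx u hu hux.symm).resolve_right (inx u hu hut hux)
  have outz : ∀ u ∈ U, u ≠ t → u ≠ x → u ≠ z → (z, u) ∈ M := fun u hu hut hux huz =>
    (hM z hz u hu huz.symm).resolve_right (inz u hu hut hux huz)
  have htx2 : 2 ≤ arcs M {t} {x} := by
    refine (h2 {x} (by simpa) (by simp) (by rintro rfl; simp [htx] at ht)).trans ?_
    refine arcs_le_arcs fun u v huv hu hv => ?_
    simp only [Finset.mem_sdiff, Finset.mem_singleton] at hu hv ⊢
    subst hv
    exact ⟨by_contra fun hut => inx u hu.1 hut hu.2 huv, rfl⟩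
  have htxM : (t, x) ∈ M := exists_mem_of_arcs_pos (one_le_two.trans htx2)
  have htzM : (t, z) ∈ M := by
    by_contra h
    have : 2 ≤ arcs M (U.erase t \ {z}) {z} := by
      refine (h2 {z} (by simpa) (by simp) (by rintro rfl; simp [htz] at ht)).trans ?_
      refine arcs_le_arcs fun u v huv hu hv => ?_
      simp only [Finset.mem_sdiff, Finset.mem_singleton, Finset.mem_erase] at hu hv ⊢
      subst hv
      refine ⟨⟨⟨?_, hu.1⟩, hu.2⟩, rfl⟩
      rintro rfl
      exact h huv
    omega
  have hW : 2 ≤ (((U.erase t).erase x).erase z).card := by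
    rw [Finset.card_erase_of_mem (by simp [hz, hxz.symm, htz.symm]),
      Finset.card_erase_of_mem (by simp [hx, htx.symm]), Finset.card_erase_of_mem ht]
    omega
  by_cases hw : ∃ w ∈ U, w ≠ t ∧ w ≠ x ∧ w ≠ z ∧ arcs M (U.erase x \ {w}) {w} = 1
  · obtain ⟨w, hwU, hwt, hwx, hwz, hw1⟩ := hw
    have inw : ∀ u ∈ U, u ≠ x → u ≠ z → u ≠ w → (u, w) ∉ M := by
      intro u hu hux huz huw h
      have := two_le_arcs h (outz w hwU hwt hwx hwz) (Y := U.erase x \ {w}) (X := {w})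
        (by simp [huz]) (by simp [huw, hux, hu]) (by simp)
        (by simp [hwz.symm, hz, hxz.symm]) (by simp)
      omega
    have outw : ∀ u ∈ U, u ≠ x → u ≠ z → u ≠ w → (w, u) ∈ M := fun u hu hux huz huw =>
      (hM w hwU u hu huw.symm).resolve_right (inw u hu hux huz huw)
    refine ih.of_pair hz hU hM h2 ht hwU htz hwz htzM (outz w hwU hwt hwx hwz) ?_
    intro X hX hzX hne hXU
    by_cases hxX : x ∈ X <;> by_cases htX : t ∈ X
    · left
      refine (h2 (insert z X) (Finset.insert_subset hz hX) (by simp) ?_).trans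
        (arcs_le_arcs fun u v huv hu hv => ?_)
      · rintro rfl
        simp [hzX] at hXU
      · simp only [Finset.mem_sdiff, Finset.mem_insert, not_or, Finset.mem_erase] at hu hv ⊢
        refine ⟨⟨⟨hu.2.1, hu.1⟩, hu.2.2⟩, hv.resolve_left ?_⟩
        rintro rfl
        exact inz u hu.1 (fun h => hu.2.2 (h ▸ htX)) (fun h => hu.2.2 (h ▸ hxX)) hu.2.1 huv
    · left
      refine htx2.trans (arcs_mono_set M ?_ ?_)
      · simpa [htX, ht] using htz
      · simpa using hxX
    · left
      by_cases hW' : ((U.erase t).erase x).erase z ⊆ X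
      · exact hW.trans (card_le_arcs (z := x) (fun u hu => by
          simp only [Finset.mem_erase] at hu
          exact outx u hu.2.2.2 hu.2.2.1 hu.2.1) (by simp [hx, hxz, hxX]) hW')
      · obtain ⟨u, hu, huX⟩ := Finset.not_subset.1 hW'
        simp only [Finset.mem_erase] at hu
        refine (h2 (insert x (insert z X)) (Finset.insert_subset hx (Finset.insert_subset hz hX))
          (by simp) ?_).trans (arcs_le_arcs fun u v huv hu hv => ?_)
        · rintro rfl
          simp [hu.1, hu.2.1, huX] at hu
        · simp only [Finset.mem_sdiff, Finset.mem_insert, not_or, Finset.mem_erase] at hu hv ⊢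
          have hut : u ≠ t := fun h => hu.2.2.2 (h ▸ htX)
          refine ⟨⟨⟨hu.2.2.1, hu.1⟩, hu.2.2.2⟩, (hv.resolve_left ?_).resolve_left ?_⟩
          · rintro rfl; exact inx u hu.1 hut hu.2.1 huv
          · rintro rfl; exact inz u hu.1 hut hu.2.1 hu.2.2.1 huv
    · have hxo : ∀ u ∈ X, (x, u) ∈ M := fun u hu =>
        outx u (hX hu) (fun h => htX (h ▸ hu)) (fun h => hxX (h ▸ hu))
      by_cases hXw : ∃ u ∈ X, u ≠ w
      · left
        obtain ⟨u, hu, huw⟩ := hXw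
        by_cases hwX : w ∈ X
        · exact two_le_arcs (hxo u hu) (hxo w hwX) (by simp [huw]) (by simp [hx, hxz, hxX]) hu
            (by simp [hx, hxz, hxX]) hwX
        · exact two_le_arcs (hxo u hu)
            (outw u (hX hu) (fun h => hxX (h ▸ hu)) (fun h => hzX (h ▸ hu)) huw)
            (by simp [hwx.symm]) (by simp [hx, hxz, hxX]) hu (by simp [hwU, hwz, hwX]) hu
      · right
        push Not at hXw
        obtain ⟨u, hu⟩ := hne
        have := hXw u hu
        subst this
        exact ⟨arcs_pos_of_mem (hxo u hu) (by simp [hx, hxz, hxX]) hu, htX, hu⟩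
  · refine ih.of_pair hx hU hM h2 ht hz htx hxz.symm htxM (outx z hz htz.symm hxz.symm) ?_
    intro X hX hxX hne hXU
    by_cases htX : t ∈ X
    · left
      refine (h2 (insert x X) (Finset.insert_subset hx hX) (by simp) ?_).trans
        (arcs_le_arcs fun u v huv hu hv => ?_)
      · rintro rfl
        simp [hxX] at hXU
      · simp only [Finset.mem_sdiff, Finset.mem_insert, not_or, Finset.mem_erase] at hu hv ⊢
        refine ⟨⟨⟨hu.2.1, hu.1⟩, hu.2.2⟩, hv.resolve_left ?_⟩
        rintro rfl
        exact inx u hu.1 (fun h => hu.2.2 (h ▸ htX)) hu.2.1 huv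
    by_cases hzX : z ∈ X
    · exact Or.inr ⟨arcs_pos_of_mem htzM (by simp [ht, htx, htX]) hzX, htX, hzX⟩
    · left
      have hzo : ∀ u ∈ X, (z, u) ∈ M := fun u hu =>
        outz u (hX hu) (fun h => htX (h ▸ hu)) (fun h => hxX (h ▸ hu)) (fun h => hzX (h ▸ hu))
      obtain ⟨w, hwX⟩ := hne
      by_cases hXw : ∃ u ∈ X, u ≠ w
      · obtain ⟨u, hu, huw⟩ := hXw
        exact two_le_arcs (hzo u hu) (hzo w hwX) (by simp [huw]) (by simp [hz, hxz.symm, hzX]) hu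
            (by simp [hz, hxz.symm, hzX]) hwX
      · push Not at hXw
        obtain rfl : X = {w} := by
          ext a
          simp only [Finset.mem_singleton]
          exact ⟨hXw a, fun h => h ▸ hwX⟩
        simp only [Finset.mem_singleton, Finset.singleton_subset_iff] at hxX htX hzX hX hzo
        have h1 := arcs_pos_of_mem (hzo w rfl) (Y := U.erase x \ {w}) (X := {w})
          (by simp [hz, hxz.symm, hzX]) (by simp)
        refine lt_of_le_of_ne h1 fun h => hw ⟨w, hX, Ne.symm htX, Ne.symm hxX, Ne.symm hzX, h.symm⟩

lemma SemiDec.of_triple {n : ℕ} (ih : SemiDec V n) (hn : 5 ≤ n) {U : Finset V} {t x y z : V}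
    (ht : t ∈ U) (hU : U.card = n + 1) {M : Multiset (V × V)} (hM : Semi U M)
    (h2 : Str 2 U M) (hx : x ∈ U) (hy : y ∈ U) (hz : z ∈ U) (htx : t ≠ x) (hty : t ≠ y)
    (htz : t ≠ z) (hxy : x ≠ y) (hxz : x ≠ z) (hyz : y ≠ z)
    (h0 : arcs M (U.erase t \ {x, y, z}) {x, y, z} = 0) (htxM : (t, x) ∈ M) (htyM : (t, y) ∈ M)
    (htzM : (t, z) ∈ M) (hxyM : (x, y) ∈ M) (hyzM : (y, z) ∈ M) (hzxM : (z, x) ∈ M)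
    (hyx : (y, x) ∉ M) : Dec U M := by
  have inC : ∀ u ∈ U, u ≠ t → u ≠ x → u ≠ y → u ≠ z → ∀ c, c = x ∨ c = y ∨ c = z → (u, c) ∉ M := by
    intro u hu hut hux huy huz c hc h
    have := arcs_pos_of_mem h (Y := U.erase t \ {x, y, z}) (X := {x, y, z})
      (by simp [hu, hut, hux, huy, huz]) (by simpa using hc)
    omega
  have outC : ∀ c, c = x ∨ c = y ∨ c = z → ∀ u ∈ U, u ≠ t → u ≠ x → u ≠ y → u ≠ z →
      (c, u) ∈ M := by
    intro c hc u hu hut hux huy huz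
    refine (hM c ?_ u hu ?_).resolve_right (inC u hu hut hux huy huz c hc)
    · rcases hc with rfl | rfl | rfl <;> assumption
    · rcases hc with rfl | rfl | rfl <;> apply Ne.symm <;> assumption
  have hR : 2 ≤ ((((U.erase t).erase x).erase y).erase z).card := by
    rw [Finset.card_erase_of_mem (by simp [hz, hyz.symm, hxz.symm, htz.symm]),
      Finset.card_erase_of_mem (by simp [hy, hxy.symm, hty.symm]),
      Finset.card_erase_of_mem (by simp [hx, htx.symm]), Finset.card_erase_of_mem ht]
    omega
  refine ih.of_pair hx hU hM h2 ht hy htx hxy.symm htxM hxyM ?_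
  intro X hX hxX hne hXU
  by_cases hzX : z ∈ X <;> by_cases htX : t ∈ X
  · left
    refine (h2 (insert x X) (Finset.insert_subset hx hX) (by simp) ?_).trans
      (arcs_le_arcs fun u v huv hu hv => ?_)
    · rintro rfl
      simp [hxX] at hXU
    · simp only [Finset.mem_sdiff, Finset.mem_insert, not_or, Finset.mem_erase] at hu hv ⊢
      refine ⟨⟨⟨hu.2.1, hu.1⟩, hu.2.2⟩, hv.resolve_left ?_⟩
      rintro rfl
      have hut : u ≠ t := fun h => hu.2.2 (h ▸ htX)
      have huz : u ≠ z := fun h => hu.2.2 (h ▸ hzX)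
      have huy : u ≠ y := fun h => hyx (h ▸ huv)
      exact inC u hu.1 hut hu.2.1 huy huz _ (Or.inl rfl) huv
  · by_cases hyX : y ∈ X
    · exact Or.inr ⟨arcs_pos_of_mem htyM (by simp [ht, htx, htX]) hyX, htX, hyX⟩
    · exact Or.inl (two_le_arcs htzM hyzM (by simp [hty]) (by simp [ht, htx, htX]) hzX
        (by simp [hy, hxy.symm, hyX]) hzX)
  · left
    by_cases hR' : (((U.erase t).erase x).erase y).erase z ⊆ X
    · exact hR.trans (card_le_arcs (z := z) (fun u hu => by
        simp only [Finset.mem_erase] at hu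
        exact outC z (by simp) u hu.2.2.2.2 hu.2.2.2.1 hu.2.2.1 hu.2.1 hu.1)
        (by simp [hz, hxz.symm, hzX]) hR')
    · obtain ⟨u, hu, huX⟩ := Finset.not_subset.1 hR'
      simp only [Finset.mem_erase] at hu
      refine (h2 (insert x (insert y (insert z X))) (Finset.insert_subset hx
        (Finset.insert_subset hy (Finset.insert_subset hz hX))) (by simp) ?_).trans
        (arcs_le_arcs fun u v huv hu hv => ?_)
      · rintro rfl
        simp [hu.1, hu.2.1, hu.2.2.1, huX] at hu
      · simp only [Finset.mem_sdiff, Finset.mem_insert, not_or, Finset.mem_erase] at hu hv ⊢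
        obtain ⟨huU, hux, huy, huz, huX⟩ := hu
        have hut : u ≠ t := fun h => huX (h ▸ htX)
        have := inC u huU hut hux huy huz v
        refine ⟨⟨⟨hux, huU⟩, huX⟩, ?_⟩
        tauto
  · by_cases hyX : y ∈ X
    · exact Or.inr ⟨arcs_pos_of_mem htyM (by simp [ht, htx, htX]) hyX, htX, hyX⟩
    · left
      obtain ⟨w, hwX⟩ := hne
      have hwM : ∀ c, c = x ∨ c = y ∨ c = z → (c, w) ∈ M := fun c hc =>
        outC c hc w (hX hwX) (fun h => htX (h ▸ hwX)) (fun h => hxX (h ▸ hwX))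
          (fun h => hyX (h ▸ hwX)) (fun h => hzX (h ▸ hwX))
      exact two_le_arcs (hwM y (by simp)) (hwM z (by simp)) (by simp [hyz])
        (by simp [hy, hxy.symm, hyX]) hwX (by simp [hz, hxz.symm, hzX]) hwX

lemma arcs_swap_cut (M : Multiset (V × V)) {S X : Finset V} (hX : X ⊆ S) :
    arcs (M.map Prod.swap) (S \ X) X = arcs M (S \ (S \ X)) (S \ X) := by
  rw [arcs_swap, Finset.sdiff_sdiff_eq_self hX]

lemma SemiDec.of_tight_triple {n : ℕ} (ih : SemiDec V n) (hn : 5 ≤ n) {U : Finset V} {t x y z : V}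
    (ht : t ∈ U) (hU : U.card = n + 1) {M : Multiset (V × V)} (hM : Semi U M)
    (h2 : Str 2 U M) (hC : {x, y, z} ⊆ U.erase t) (hxy : x ≠ y) (hxz : x ≠ z) (hyz : y ≠ z)
    (h0 : arcs M (U.erase t \ {x, y, z}) {x, y, z} = 0) (hx1 : arcs M (U.erase t \ {x}) {x} = 1)
    (hy1 : arcs M (U.erase t \ {y}) {y} = 1) (hz1 : arcs M (U.erase t \ {z}) {z} = 1) :
    Dec U M := by
  have hx : x ∈ U.erase t := hC (by simp)
  have hy : y ∈ U.erase t := hC (by simp)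
  have hz : z ∈ U.erase t := hC (by simp)
  have uniq : ∀ {a b c}, arcs M (U.erase t \ {c}) {c} = 1 → a ∈ U.erase t → b ∈ U.erase t →
      a ≠ c → b ≠ c → a ≠ b → (a, c) ∈ M → (b, c) ∉ M := by
    intro a b c hc ha hb hac hbc hab h h'
    have := two_le_arcs h h' (by simp [hab]) (Y := U.erase t \ {c}) (X := {c})
      (Finset.mem_sdiff.2 ⟨ha, by simpa⟩) (by simp) (Finset.mem_sdiff.2 ⟨hb, by simpa⟩) (by simp)
    omega
  have mem : ∀ {c}, c ∈ U.erase t → arcs M (U.erase t \ {c}) {c} = 1 → (t, c) ∈ M := by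
    intro c hc hc1
    rw [← Finset.insert_erase ht] at h2
    have := h2.two_le_out (Finset.notMem_erase t U) (X := {c}) (by simpa using hc) (by simp)
    rw [countP_outN (by simpa using hc), hc1] at this
    exact exists_mem_of_arcs_pos (by omega)
  simp only [Finset.mem_erase] at hx hy hz
  rcases hM x hx.2 y hy.2 hxy with h | h
  · have hyzM := (hM y hy.2 z hz.2 hyz).resolve_right
      (uniq hy1 (by simp [hx]) (by simp [hz]) hxy hyz.symm hxz h)
    have hzxM := (hM z hz.2 x hx.2 hxz.symm).resolve_right
      (uniq hz1 (by simp [hy]) (by simp [hx]) hyz hxz hxy.symm hyzM)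
    have hyx := uniq hx1 (by simp [hz]) (by simp [hy]) hxz.symm hxy.symm hyz.symm hzxM
    exact ih.of_triple hn ht hU hM h2 hx.2 hy.2 hz.2 hx.1.symm hy.1.symm hz.1.symm hxy hxz hyz h0
      (mem (by simp [hx]) hx1) (mem (by simp [hy]) hy1) (mem (by simp [hz]) hz1) h hyzM hzxM hyx
  · have hxzM := (hM x hx.2 z hz.2 hxz).resolve_right
      (uniq hx1 (by simp [hy]) (by simp [hz]) hxy.symm hxz.symm hyz h)
    have hzyM := (hM z hz.2 y hy.2 hyz.symm).resolve_right
      (uniq hz1 (by simp [hx]) (by simp [hy]) hxz hyz hxy hxzM)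
    have hxy' := uniq hy1 (by simp [hz]) (by simp [hx]) hyz.symm hxy hxz.symm hzyM
    rw [Finset.insert_comm] at h0
    exact ih.of_triple hn ht hU hM h2 hy.2 hx.2 hz.2 hy.1.symm hx.1.symm hz.1.symm hxy.symm hyz hxz
      h0 (mem (by simp [hy]) hy1) (mem (by simp [hx]) hx1) (mem (by simp [hz]) hz1) h hxzM hzyM hxy'

lemma SemiDec.of_zero {n : ℕ} (ih : SemiDec V n) (hn : 5 ≤ n) {U : Finset V} {t : V}
    (ht : t ∈ U) (hU : U.card = n + 1) {M : Multiset (V × V)} (hM : Semi U M)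
    (h2 : Str 2 U M) (h0 : ∃ X, Proper (U.erase t) X ∧ arcs M (U.erase t \ X) X = 0) :
    Dec U M := by
  have hS := Finset.card_erase_of_mem ht
  have hf := submod_cut (hM.mono (Finset.erase_subset t U) le_rfl)
  have h2' := h2
  rw [← Finset.insert_erase ht] at h2'
  have sw : ∀ {X}, X ⊆ U.erase t → arcs (M.map Prod.swap) (U.erase t \ X) X =
    arcs M (U.erase t \ (U.erase t \ X)) (U.erase t \ X) := fun hX => arcs_swap_cut M hX
  rcases exists_zeroCut hf h0 with ⟨C, Z, h⟩ | ⟨x, hx, z, hz, hxz, hfx, hfz, hfxz⟩ |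
    ⟨x, hx, z, hz, hxz, hfx, hfz, hfxz⟩
  · have h' := h.compl
    have hO2 : ∀ X, Proper (U.erase t) X → 2 ≤ arcs M (U.erase t \ X) X +
        (outN M (U.erase t) t).countP (· ∈ X) := fun X hX =>
      h2'.two_le_out (Finset.notMem_erase t U) hX.1 hX.2.1
    have hI2 : ∀ X, Proper (U.erase t) X →
        2 ≤ arcs M (U.erase t \ (U.erase t \ X)) (U.erase t \ X) +
        (inN M (U.erase t) t).countP (· ∈ X) := fun X hX => by
      have := h2'.two_le_in (Finset.notMem_erase t U) hX.compl.1 hX.compl.2.2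
      simpa only [Finset.sdiff_sdiff_eq_self hX.1] using this
    rcases exists_hitting hf h.properC h.zeroC h.min hO2 with
      ⟨w₁, hw₁, w₂, hw₂, hw, hwT⟩ | ⟨x, y, v, hxy, hxv, hyv, rfl, hx1, hy1, hv1⟩
    · rcases exists_hitting hf.compl h'.properC h'.zeroC h'.min hI2 with
        ⟨u₁, hu₁, u₂, hu₂, hu, huT⟩ | ⟨x, y, v, hxy, hxv, hyv, hZ, hx1, hy1, hv1⟩
      · obtain ⟨P, h3, h4, -, h5⟩ := h.exists_pairs_of_hits ⟨hw₁, hw₂, hw, hwT⟩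
          ⟨hu₁, hu₂, hu, huT⟩
        exact ih.of_pairs ht hU hM h3 h4 h5 (Or.inl h0)
      · have hC := h'.properC.1
        have hC0 := h'.zeroC
        rw [hZ] at hC hC0
        have hx : {x} ⊆ U.erase t := Finset.singleton_subset_iff.2 (hC (by simp))
        have hy : {y} ⊆ U.erase t := Finset.singleton_subset_iff.2 (hC (by simp))
        have hv : {v} ⊆ U.erase t := Finset.singleton_subset_iff.2 (hC (by simp))
        exact (ih.of_tight_triple hn ht hU hM.swap h2.swap hC hxy hxv hyv
          ((sw hC).trans hC0) ((sw hx).trans hx1) ((sw hy).trans hy1) ((sw hv).trans hv1)).of_swap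
    · exact ih.of_tight_triple hn ht hU hM h2 h.properC.1 hxy hxv hyv h.zeroC hx1 hy1 hv1
  · simp only [Finset.mem_erase] at hx hz
    exact ih.of_source (by omega) ht hU hM h2 hx.2 hz.2 hx.1.symm hz.1.symm hxz hfx hfz hfxz
  · have hx' := Finset.singleton_subset_iff.2 hx
    have hz' := Finset.singleton_subset_iff.2 hz
    have hxz' := Finset.insert_subset hx hz'
    simp only [Finset.mem_erase] at hx hz
    exact (ih.of_source (by omega) ht hU hM.swap h2.swap hx.2 hz.2 hx.1.symm hz.1.symm hxz
      ((sw hx').trans hfx) ((sw hz').trans hfz) ((sw hxz').trans hfxz)).of_swap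

/-- The configuration at `t` which prevents splitting off a single pair of arcs. -/
def Bad (U : Finset V) (M : Multiset (V × V)) (t : V) : Prop :=
  ∃ x ∈ U, ∃ y ∈ U, x ≠ y ∧ t ≠ x ∧ t ≠ y ∧ (t, x) ∈ M ∧ (t, y) ∈ M ∧ (x, y) ∈ M ∧
    (y, x) ∉ M ∧ arcs M (U \ {x}) {x} = 2 ∧ arcs M (U \ {y}) {y} = 2 ∧
    ∀ u ∈ U, u ≠ y → (u, y) ∈ M → u = t ∨ u = x

lemma three_le_arcs {M : Multiset (V × V)} {X : Finset V} {t a b c : V} (hab : a ≠ b) (hac : a ≠ c)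
    (hbc : b ≠ c) (ha : (t, a) ∈ M) (hb : (t, b) ∈ M) (hc : (t, c) ∈ M) (hX : {a, b, c} ⊆ X) :
    3 ≤ arcs M {t} X := by
  refine le_trans (le_of_eq ?_) (card_le_arcs (X := {a, b, c}) (z := t) ?_ (by simp) hX)
  · rw [Finset.card_eq_three.2 ⟨a, b, c, hab, hac, hbc, rfl⟩]
  · simpa using ⟨ha, hb, hc⟩

lemma not_in_out_two {U : Finset V} {M : Multiset (V × V)} (hU : 6 ≤ U.card) (hM : Semi U M) {t : V}
    (ht : t ∈ U) (hi : arcs M (U \ {t}) {t} = 2) : arcs (M.map Prod.swap) (U \ {t}) {t} ≠ 2 := by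
  have := card_mul_card_le hM (Finset.singleton_subset_iff.2 ht) Finset.sdiff_subset
    (Finset.disjoint_sdiff (s := {t}) (t := U))
  rw [Finset.card_sdiff_of_subset (by simpa), Finset.card_singleton] at this
  rw [arcs_swap]
  omega

lemma arcs_disjoint_union {M : Multiset (V × V)} {U X Y : Finset V} (hM : Semi U M) (hX : X ⊆ U)
    (hY : Y ⊆ U) (h : Disjoint X Y) :
    arcs M (U \ (X ∪ Y)) (X ∪ Y) + X.card * Y.card ≤ arcs M (U \ X) X + arcs M (U \ Y) Y :=
  (submod_cut hM).disjoint hX hY h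

lemma arcs_double {M : Multiset (V × V)} {U : Finset V} {x y : V} (hx : x ∈ U) (hy : y ∈ U)
    (hxy : x ≠ y) (h : (x, y) ∈ M) (h' : (y, x) ∈ M) :
    arcs M (U \ {x, y}) {x, y} + 2 ≤ arcs M (U \ {x}) {x} + arcs M (U \ {y}) {y} := by
  have h1 := cut_submod M (Finset.singleton_subset_iff.2 hx) (Finset.singleton_subset_iff.2 hy)
  have h2 := arcs_pos_of_mem h (Y := {x} \ {y}) (X := {y} \ {x}) (by simpa)
    (by simpa using hxy.symm)
  have h3 := arcs_pos_of_mem h' (Y := {y} \ {x}) (X := {x} \ {y})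
    (by simpa using hxy.symm) (by simpa)
  rw [← Finset.insert_eq] at h1
  omega

lemma not_bad_of_in_two {U : Finset V} {M : Multiset (V × V)} (hU : 6 ≤ U.card) (hM : Semi U M)
    (h2 : Str 2 U M) (hbad : ∀ t ∈ U, Bad U M t ∨ Bad U (M.map Prod.swap) t) {t : V} (ht : t ∈ U)
    (hi : arcs M (U \ {t}) {t} = 2) : ¬ Bad U M t := by
  rintro ⟨x, hx, y, hy, hxy, htx, hty, htxM, htyM, hxyM, hyxM, hx2, hy2, hN⟩
  have proper : ∀ W ⊆ U, W.Nonempty → W.card ≤ 5 → 2 ≤ arcs M (U \ W) W := fun W hW hne hc =>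
    h2 W hW hne (by rintro rfl; omega)
  have two : ∀ {a b : V}, a ≠ b → ({a} ∪ {b} : Finset V).card = 2 := fun h => by
    rw [← Finset.insert_eq, Finset.card_pair h]
  have double : ∀ q ∈ U, q ≠ x → q ≠ y → q ≠ t → arcs M (U \ {q}) {q} = 2 → (y, t) ∉ M := by
    intro q hq hqx hqy hqt hq2 hyt
    have h1 := arcs_double ht hy hty htyM hyt
    have hs : ({t, y} : Finset V) ⊆ U := by simp [Finset.insert_subset_iff, ht, hy]
    have h3 := arcs_disjoint_union hM hs (Finset.singleton_subset_iff.2 hx)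
      (by simp [htx.symm, hxy])
    have hs' := Finset.union_subset hs (Finset.singleton_subset_iff.2 hx)
    have h4 := arcs_disjoint_union hM hs' (Finset.singleton_subset_iff.2 hq)
      (by simp [hqt, hqy, hqx])
    have c2 := Finset.card_pair hty
    have c3 := Finset.card_union_of_disjoint (show Disjoint {t, y} {x} by simp [htx.symm, hxy])
    have c4 := Finset.card_union_of_disjoint (show Disjoint ({t, y} ∪ {x}) {q} by
      simp [hqt, hqy, hqx])
    have h5 := proper _ (Finset.union_subset hs' (Finset.singleton_subset_iff.2 hq)) (by simp)
      (by simp only [Finset.card_singleton] at *; omega)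
    simp only [Finset.card_singleton] at *
    rw [c2] at c3 h3
    rw [c3] at h4
    omega
  rcases hbad y hy with ⟨p, hp, q, hq, hpq, hyp, hyq, hypM, hyqM, -, -, hp2, hq2, -⟩ |
    ⟨p, hp, q, hq, hpq, hyp, hyq, hypM, hyqM, -, -, hp2, hq2, -⟩
  · have hpx : x ≠ p := fun h => hyxM (h ▸ hypM)
    have hqx : x ≠ q := fun h => hyxM (h ▸ hyqM)
    have hpt : t ≠ p := by
      rintro rfl
      exact double q hq hqx.symm hyq.symm hpq.symm hq2 hypM
    have hqt : t ≠ q := by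
      rintro rfl
      exact double p hp hpx.symm hyp.symm hpq hp2 hyqM
    have hs : ({x} ∪ {y} : Finset V) ⊆ U := Finset.union_subset (Finset.singleton_subset_iff.2 hx)
      (Finset.singleton_subset_iff.2 hy)
    have hs' : ({p} ∪ {q} : Finset V) ⊆ U := Finset.union_subset (Finset.singleton_subset_iff.2 hp)
      (Finset.singleton_subset_iff.2 hq)
    have hd : Disjoint ({x} ∪ {y} : Finset V) ({p} ∪ {q}) := by
      simp [hpx.symm, hqx.symm, hyp.symm, hyq.symm]
    have hd' : Disjoint ({x} ∪ {y} ∪ ({p} ∪ {q}) : Finset V) {t} := by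
      simp [htx, hty, hpt, hqt]
    have h1 := arcs_disjoint_union hM (X := {x}) (Y := {y}) (by simpa) (by simpa) (by simpa)
    have h3 := arcs_disjoint_union hM (X := {p}) (Y := {q}) (by simpa) (by simpa) (by simpa)
    have h4 := arcs_disjoint_union hM hs hs' hd
    have h5 := arcs_disjoint_union hM (Finset.union_subset hs hs') (by simpa) hd'
    have c4 := Finset.card_union_of_disjoint hd
    have c5 := Finset.card_union_of_disjoint hd'
    rw [two hxy, two hpq] at h4 c4
    rw [c4] at h5 c5
    simp only [Finset.card_singleton] at h1 h3 h5 c5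
    have h6 := proper _ (Finset.union_subset (Finset.union_subset hs hs')
      (Finset.singleton_subset_iff.2 ht)) (by simp) (by omega)
    omega
  · rw [mem_map_swap] at hypM hyqM
    have := not_in_out_two hU hM ht hi
    have := not_in_out_two hU hM hx hx2
    rcases hN p hp hyp.symm hypM with rfl | rfl <;> contradiction

lemma exists_not_bad {U : Finset V} {M : Multiset (V × V)} (hU : 6 ≤ U.card) (hM : Semi U M)
    (h2 : Str 2 U M) (hbad : ∀ t ∈ U, Bad U M t ∨ Bad U (M.map Prod.swap) t)
    (htwo : ∀ t ∈ U, arcs M (U \ {t}) {t} = 2 ∨ arcs (M.map Prod.swap) (U \ {t}) {t} = 2) :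
    False := by
  have main : ∀ M : Multiset (V × V), Semi U M → Str 2 U M →
      (∀ t ∈ U, Bad U M t ∨ Bad U (M.map Prod.swap) t) →
      ∀ t ∈ U, arcs M (U \ {t}) {t} ≠ 2 := by
    intro M hM h2 hbad v hv hv2
    rcases hbad v hv with h | ⟨x, hx, y, hy, hxy, hvx, hvy, -, -, hxyM, -, hx2, hy2, -⟩
    · exact not_bad_of_in_two hU hM h2 hbad hv hv2 h
    rw [mem_map_swap] at hxyM
    rcases hbad y hy with ⟨p, hp, q, hq, hpq, hyp, hyq, hypM, hyqM, -, -, hp2, hq2, -⟩ | h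
    · have hpx : p ≠ x := by
        rintro rfl
        exact not_in_out_two hU hM hx hp2 hx2
      have hqx : q ≠ x := by
        rintro rfl
        exact not_in_out_two hU hM hx hq2 hx2
      have := three_le_arcs hpq hpx hqx hypM hyqM hxyM (X := U \ {y})
        (by simp [Finset.insert_subset_iff, hp, hq, hx, hyp.symm, hyq.symm, hxy])
      rw [arcs_swap] at hy2
      omega
    · refine not_bad_of_in_two hU hM.swap h2.swap (fun t ht => ?_) hy hy2 h
      rw [map_swap_swap]
      exact (hbad t ht).symm
  obtain ⟨t, ht⟩ := Finset.card_pos.1 (show 0 < U.card by omega)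
  rcases htwo t ht with h | h
  · exact main M hM h2 hbad t ht h
  · refine main _ hM.swap h2.swap (fun t ht => ?_) t ht h
    rw [map_swap_swap]
    exact (hbad t ht).symm

lemma bad_of_tight {U : Finset V} {M : Multiset (V × V)} {t x y : V} (hU : 6 ≤ U.card)
    (hM : Semi U M) (h2 : Str 2 U M) (ht : t ∈ U)
    (h1 : ∀ X, Proper (U.erase t) X → 1 ≤ arcs M (U.erase t \ X) X)
    (htwo : ∀ t ∈ U, arcs M (U \ {t}) {t} = 2 ∨ arcs M {t} (U \ {t}) = 2)
    (hx : x ∈ U.erase t) (hy : y ∈ U.erase t) (hxy : x ≠ y)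
    (hx1 : arcs M (U.erase t \ {x}) {x} = 1) (hy1 : arcs M (U.erase t \ {y}) {y} = 1) :
    Bad U M t := by
  have hc := Finset.card_erase_of_mem ht
  have mem : ∀ {c}, c ∈ U.erase t → arcs M (U.erase t \ {c}) {c} = 1 → (t, c) ∈ M := by
    intro c hc hc1
    rw [← Finset.insert_erase ht] at h2
    have := h2.two_le_out (Finset.notMem_erase t U) (X := {c}) (by simpa using hc) (by simp)
    rw [countP_outN (by simpa using hc), hc1] at this
    exact exists_mem_of_arcs_pos (by omega)
  have din : ∀ {c}, c ∈ U.erase t → arcs M (U.erase t \ {c}) {c} = 1 →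
      arcs M (U \ {c}) {c} = 2 := by
    intro c hc' hc1
    refine (htwo c (Finset.mem_of_mem_erase hc')).resolve_right ?_
    have := card_mul_card_le hM (A := {c}) (B := U.erase t \ {c})
      (by simpa using Finset.mem_of_mem_erase hc')
      (Finset.sdiff_subset.trans (Finset.erase_subset _ _)) Finset.disjoint_sdiff
    rw [Finset.card_sdiff_of_subset (by simpa using hc'), Finset.card_singleton, hc1] at this
    have := arcs_mono_set M (Finset.Subset.refl {c})
      (Finset.sdiff_subset_sdiff (Finset.erase_subset t U) (Finset.Subset.refl {c}))
    omega
  have uniq : ∀ {a b}, arcs M (U.erase t \ {b}) {b} = 1 → a ∈ U.erase t → (a, b) ∈ M → a ≠ b →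
      ∀ u ∈ U, u ≠ b → (u, b) ∈ M → u = t ∨ u = a := by
    intro a b hb1 ha hab hne u hu hub huM
    by_contra hcon
    push Not at hcon
    have := two_le_arcs hab huM (by simp [hcon.2.symm]) (Y := U.erase t \ {b}) (X := {b})
      (Finset.mem_sdiff.2 ⟨ha, by simpa⟩) (by simp) (by simp [hcon.1, hu, hub]) (by simp)
    omega
  have key : ∀ {x y}, x ∈ U.erase t → y ∈ U.erase t → x ≠ y →
      arcs M (U.erase t \ {x}) {x} = 1 → arcs M (U.erase t \ {y}) {y} = 1 → (x, y) ∈ M →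
      Bad U M t := by
    intro x y hx hy hxy hx1 hy1 hxyM
    have hx' := Finset.mem_erase.1 hx
    have hy' := Finset.mem_erase.1 hy
    refine ⟨x, hx'.2, y, hy'.2, hxy, hx'.1.symm, hy'.1.symm, mem hx hx1, mem hy hy1, hxyM, ?_,
      din hx hx1, din hy hy1, uniq hy1 hx hxyM hxy⟩
    intro hyx
    have := h1 {x, y} ⟨by simp only [Finset.insert_subset_iff, Finset.singleton_subset_iff]; tauto,
      by simp, fun h => by have := Finset.card_pair hxy; rw [h] at this; omega⟩
    obtain ⟨⟨u, v⟩, huv, hu, hv⟩ := arcs_pos.1 this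
    simp only [Finset.mem_sdiff, Finset.mem_erase, Finset.mem_insert, Finset.mem_singleton] at hu hv
    rcases hv with rfl | rfl
    · have := uniq hx1 hy hyx hxy.symm u hu.1.2 (by tauto) huv
      tauto
    · have := uniq hy1 hx hxyM hxy u hu.1.2 (by tauto) huv
      tauto
  rcases hM x (Finset.mem_of_mem_erase hx) y (Finset.mem_of_mem_erase hy) hxy with h | h
  · exact key hx hy hxy hx1 hy1 h
  · exact key hy hx hxy.symm hy1 hx1 h

lemma SemiDec.succ {n : ℕ} (ih : SemiDec V n) (hn : 5 ≤ n) : SemiDec V (n + 1) := by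
  intro U M hU hM h2
  by_contra hD
  have hpos : ∀ t ∈ U, ∀ X, Proper (U.erase t) X → 1 ≤ arcs M (U.erase t \ X) X :=
    fun t ht X hX => Nat.one_le_iff_ne_zero.2 fun h0 =>
      hD (ih.of_zero hn ht hU hM h2 ⟨X, hX, h0⟩)
  have hposs : ∀ t ∈ U, ∀ X, Proper (U.erase t) X →
      1 ≤ arcs (M.map Prod.swap) (U.erase t \ X) X :=
    fun t ht X hX => by rw [arcs_swap_cut M hX.1]; exact hpos t ht _ hX.compl
  have main : ∀ t ∈ U, (arcs M (U \ {t}) {t} = 2 ∨ arcs M {t} (U \ {t}) = 2) ∧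
      ((∃ x y, Twin (U.erase t) (fun X => arcs M (U.erase t \ X) X) x y) ∨
        ∃ x y, Twin (U.erase t) (fun X => arcs M (U.erase t \ (U.erase t \ X)) (U.erase t \ X))
          x y) := by
    intro t ht
    have hS := Finset.card_erase_of_mem ht
    have hf := submod_cut (hM.mono (Finset.erase_subset t U) le_rfl)
    have h2' := h2
    rw [← Finset.insert_erase ht] at h2'
    have htS := Finset.notMem_erase t U
    have hne : (U.erase t).Nonempty := Finset.card_pos.1 (by omega)
    have ci := h2'.le_card_in htS hne
    have co := h2'.le_card_out htS hne
    obtain ⟨P, hI, hO, hP, hc⟩ := exists_pairs_of_pos (by omega) hf (hpos t ht)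
      (fun u hu => (mem_outN.1 hu).1) (fun u hu => (mem_inN.1 hu).1) co ci
      (fun X hX => h2'.two_le_out htS hX.1 hX.2.1) (fun X hX => by
        have := h2'.two_le_in htS hX.compl.1 hX.compl.2.2
        simpa only [Finset.sdiff_sdiff_eq_self hX.1] using this)
    have hcard : ¬ (P ≠ 0 ∧ P.card < (inN M (U.erase t) t).card ∧
        P.card < (outN M (U.erase t) t).card) := fun h =>
      hD (ih.of_pairs ht hU hM hI hO hP (Or.inr h))
    have hP0 : P ≠ 0 := by
      rintro rfl
      simp at hc
    rw [card_inN, card_outN] at *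
    rw [Finset.sdiff_singleton_eq_erase]
    rcases hc with hc | ⟨hc, hc'⟩
    · exact absurd ⟨hP0, by omega, by omega⟩ hcard
    · refine ⟨?_, hc'⟩
      by_contra h
      exact hcard ⟨hP0, by omega, by omega⟩
  have htwo' : ∀ t ∈ U, arcs (M.map Prod.swap) (U \ {t}) {t} = 2 ∨
      arcs (M.map Prod.swap) {t} (U \ {t}) = 2 := fun t ht => by
    rw [arcs_swap, arcs_swap]
    exact (main t ht).1.symm
  refine exists_not_bad (by omega) hM h2 (fun t ht => ?_) fun t ht => ?_
  · rcases (main t ht).2 with ⟨x, y, hx, hy, hxy, hx1, hy1, -⟩ | ⟨x, y, hx, hy, hxy, hx1, hy1, -⟩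
    · exact Or.inl (bad_of_tight (by omega) hM h2 ht (hpos t ht) (fun t ht => (main t ht).1) hx hy
        hxy hx1 hy1)
    · refine Or.inr (bad_of_tight (by omega) hM.swap h2.swap ht (hposs t ht) htwo' hx hy hxy ?_ ?_)
      · rw [arcs_swap_cut M (by simpa using hx)]
        exact hx1
      · rw [arcs_swap_cut M (by simpa using hy)]
        exact hy1
  · rw [arcs_swap]
    exact (main t ht).1

lemma SemiDec.of_five (h : SemiDec V 5) {n : ℕ} (hn : 5 ≤ n) : SemiDec V n := by
  induction n, hn using Nat.le_induction with
  | base => exact h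
  | succ n hn ih => exact ih.succ hn

/-- Branching on the first bit of the list, outside `s` and `x`, that is raised. -/
def branch (f : ℕ → ℕ → Bool) (s : ℕ) : List ℕ → ℕ → Bool
  | [], _ => true
  | e :: l, x => bif Nat.beq (Nat.land (Nat.lor s x) (Nat.pow 2 e)) 0 then
      f (Nat.lor s (Nat.pow 2 e)) x &&
        branch f s l (Nat.lor (Nat.lor x (Nat.pow 2 e)) (Nat.pow 2 (Nat.add e 25)))
    else branch f s l x

/-- The condition that more than `slack` (zero or one) of `bits` are present. The number `mask` is
the set of these bits. -/
structure Constraint where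
  slack : ℕ
  bits : List ℕ
  mask : ℕ

def Constraint.ofBits (k : ℕ) (l : List ℕ) : Constraint :=
  ⟨k, l, (l.map (2 ^ ·)).sum⟩

/-- For `slack ≤ 1`, at most `slack` of the bits are present in `s`. -/
def Constraint.fails (s : ℕ) (c : Constraint) : Bool :=
  Nat.beq (Nat.land (Nat.land s c.mask) (Nat.sub (Nat.land s c.mask) c.slack)) 0

/-- Case distinction over the sets of bits satisfying the constraints `cs`. The bits of `s` are
present, those of `x` are absent, and the absence of `e` implies that of `e + 25`. -/
def search (goal : ℕ → Bool) (cs : List Constraint) : ℕ → ℕ → ℕ → Bool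
  | 0, _, _ => false
  | n + 1, s, x => match cs.find? (Constraint.fails s) with
    | none => goal s
    | some c => branch (search goal cs n) s c.bits x

lemma branch_cons (f : ℕ → ℕ → Bool) (s e : ℕ) (l : List ℕ) (x : ℕ) :
    branch f s (e :: l) x = bif s.testBit e || x.testBit e then branch f s l x
      else f (s ||| 2 ^ e) x && branch f s l (x ||| 2 ^ e ||| 2 ^ (e + 25)) := by
  change (bif Nat.beq ((s ||| x) &&& 2 ^ e) 0 then _ else _) = _
  rw [← Nat.testBit_or, Nat.and_two_pow]
  cases h : (s ||| x).testBit e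
  · simp only [Bool.toNat_false, zero_mul]
    rfl
  · rw [show Nat.beq (true.toNat * 2 ^ e) 0 = false by
      rw [← Bool.not_eq_true, Nat.beq_eq]; simp]
    rfl

lemma Constraint.fails_iff {s : ℕ} {c : Constraint} :
    c.fails s ↔ (s &&& c.mask) &&& ((s &&& c.mask) - c.slack) = 0 :=
  Nat.beq_eq ▸ Iff.rfl

section sound

variable {W : ℕ → Prop}

lemma branch_sound (hW : ∀ e, W (e + 25) → W e) {f : ℕ → ℕ → Bool} {s : ℕ}
    (hs : ∀ e, s.testBit e → W e) {Q : Prop}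
    (hf : ∀ s' x, (∀ e, s'.testBit e → W e) → (∀ e, x.testBit e → ¬ W e) → f s' x → Q)
    {l : List ℕ} (hl : ∃ e ∈ l, W e ∧ ¬ s.testBit e) {x : ℕ} (hx : ∀ e, x.testBit e → ¬ W e)
    (h : branch f s l x) : Q := by
  induction l generalizing x with
  | nil => simp at hl
  | cons e l ih =>
    rw [branch_cons] at h
    by_cases hc : (s.testBit e || x.testBit e) = true
    · rw [hc, cond_true] at h
      refine ih ?_ hx h
      obtain ⟨a, ha, haW, has⟩ := hl
      rcases List.mem_cons.1 ha with rfl | ha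
      · rcases Bool.or_eq_true_iff.1 hc with hc | hc
        · exact absurd hc has
        · exact absurd haW (hx _ hc)
      · exact ⟨a, ha, haW, has⟩
    · rw [Bool.not_eq_true] at hc
      rw [hc, cond_false, Bool.and_eq_true] at h
      by_cases he : W e
      · refine hf _ _ (fun a ha => ?_) hx h.1
        rw [Nat.testBit_or, Nat.testBit_two_pow, Bool.or_eq_true, decide_eq_true_iff] at ha
        rcases ha with ha | rfl
        exacts [hs _ ha, he]
      · refine ih ?_ (fun a ha => ?_) h.2
        · obtain ⟨a, ha, haW, has⟩ := hl
          rcases List.mem_cons.1 ha with rfl | ha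
          exacts [absurd haW he, ⟨a, ha, haW, has⟩]
        · rw [Nat.testBit_or, Nat.testBit_or, Nat.testBit_two_pow, Nat.testBit_two_pow,
            Bool.or_eq_true, Bool.or_eq_true, decide_eq_true_iff, decide_eq_true_iff] at ha
          rcases ha with (ha | rfl) | rfl
          exacts [hx _ ha, he, fun h => he (hW _ h)]

/-- `W` contains more than `slack` of the bits, and `mask` is as it should be. -/
def Constraint.Holds (W : ℕ → Prop) (c : Constraint) : Prop :=
  (∀ e ∈ c.bits, c.mask.testBit e) ∧
    (c.slack = 0 ∧ (∃ i ∈ c.bits, W i) ∨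
      c.slack = 1 ∧ ∃ i ∈ c.bits, ∃ j ∈ c.bits, i ≠ j ∧ W i ∧ W j)

lemma Constraint.Holds.exists {c : Constraint} (hc : c.Holds W) {s : ℕ} (h : c.fails s) :
    ∃ e ∈ c.bits, W e ∧ ¬ s.testBit e := by
  obtain ⟨hm, ⟨h0, i, hi, hWi⟩ | ⟨h1, i, hi, j, hj, hij, hWi, hWj⟩⟩ := hc
  · refine ⟨i, hi, hWi, fun hs => ?_⟩
    have h2 : (s &&& c.mask).testBit i = true := by simp [hs, hm i hi]
    rw [fails_iff, h0, Nat.sub_zero, Nat.and_self] at h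
    simp [h] at h2
  · by_contra! hs
    have h2 : (s &&& c.mask).testBit i = true := by simp [hs i hi hWi, hm i hi]
    have h3 : (s &&& c.mask).testBit j = true := by simp [hs j hj hWj, hm j hj]
    rw [fails_iff, h1] at h
    have h0 : s &&& c.mask ≠ 0 := fun h => by simp [h] at h2
    obtain ⟨k, hk⟩ := (Nat.and_sub_one_eq_zero_iff_isPowerOfTwo h0).1 h
    rw [hk, Nat.testBit_two_pow, decide_eq_true_iff] at h2 h3
    exact hij (h2.symm.trans h3)

lemma search_sound (hW : ∀ e, W (e + 25) → W e) {goal : ℕ → Bool} {cs : List Constraint}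
    (hcs : ∀ c ∈ cs, c.Holds W) {n s x : ℕ}
    (hs : ∀ e, s.testBit e → W e) (hx : ∀ e, x.testBit e → ¬ W e) (h : search goal cs n s x) :
    ∃ s', goal s' ∧ ∀ e, s'.testBit e → W e := by
  induction n generalizing s x with
  | zero => simp [search] at h
  | succ n ih =>
    rw [search] at h
    split at h
    · exact ⟨s, h, hs⟩
    · rename_i c hc
      exact branch_sound hW hs (fun _ _ h1 h2 h3 => ih h1 h2 h3)
        ((hcs c (List.mem_of_find?_eq_some hc)).exists (List.find?_some hc)) hx h

end sound

/-- The nonempty proper subsets of `{0, 1, 2, 3, 4}`. -/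
def vertexSets : List (List ℕ) :=
  [[0], [1], [2], [3], [4], [1, 2, 3, 4], [0, 2, 3, 4], [0, 1, 3, 4], [0, 1, 2, 4], [0, 1, 2, 3],
    [0, 1], [0, 2], [0, 3], [0, 4], [1, 2], [1, 3], [1, 4], [2, 3], [2, 4], [3, 4],
    [2, 3, 4], [1, 3, 4], [1, 2, 4], [1, 2, 3], [0, 3, 4], [0, 2, 4], [0, 2, 3], [0, 1, 4],
    [0, 1, 3], [0, 1, 2]]

/-- The codes `5 * a + b` of the arcs `(a, b)` entering `X`. -/
def cut (X : List ℕ) : List ℕ :=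
  ((List.range 5).filter fun a => !X.elem a).flatMap fun a => X.map fun b => 5 * a + b

/-- The constraints for a multidigraph having an arc between any two adjacent vertices: bit `i` is
present if the arc with code `i` is, and bit `i + 25` if it has multiplicity at least two. -/
def pairConstraints (adj : ℕ → ℕ → Bool) : List Constraint :=
  (List.range 5).flatMap fun a =>
    ((List.range a).filter (adj a)).map fun b => .ofBits 0 [5 * a + b, 5 * b + a]

/-- The constraints expressing `Str 2`. -/
def cutConstraints : List Constraint :=
  vertexSets.map fun X => .ofBits 1 (cut X ++ (cut X).map (· + 25))

/-- The constraints expressing `Str 1`. -/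
def connectConstraints : List Constraint :=
  vertexSets.map fun X => .ofBits 0 (cut X)

/-- The Hamiltonian cycles of the complete digraph on `{0, 1, 2, 3, 4}`. -/
def hamCycles : List (List ℕ) :=
  [[0, 1, 2, 3, 4], [0, 1, 2, 4, 3], [0, 1, 3, 2, 4], [0, 1, 3, 4, 2], [0, 1, 4, 2, 3],
    [0, 1, 4, 3, 2], [0, 2, 1, 3, 4], [0, 2, 1, 4, 3], [0, 2, 3, 1, 4], [0, 2, 3, 4, 1],
    [0, 2, 4, 1, 3], [0, 2, 4, 3, 1], [0, 3, 1, 2, 4], [0, 3, 1, 4, 2], [0, 3, 2, 1, 4],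
    [0, 3, 2, 4, 1], [0, 3, 4, 1, 2], [0, 3, 4, 2, 1], [0, 4, 1, 2, 3], [0, 4, 1, 3, 2],
    [0, 4, 2, 1, 3], [0, 4, 2, 3, 1], [0, 4, 3, 1, 2], [0, 4, 3, 2, 1]]

/-- The arcs of the closed walk through the five entries of `p`. -/
def cycleBits (p : List ℕ) : ℕ :=
  ((List.range 5).map fun j => 2 ^ (5 * p.getD j 0 + p.getD ((j + 1) % 5) 0)).sum

/-- The arcs coded by `b` form a strong digraph on `{0, 1, 2, 3, 4}`. -/
def strongBits (b : ℕ) : Bool :=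
  vertexSets.all fun X => (cut X).any b.testBit

/-- Arc sets of strong digraphs on `{0, 1, 2, 3, 4}`. -/
def strongParts : List ℕ :=
  [1581186, 8422918, 2622508, 4228618, 8437798, 2622600, 4235778, 4719874, 2154532, 1581318,
    1589634, 8440068, 2662530, 4327170, 1090178, 2629668, 2244648, 1581574, 1589386, 1574274,
    2630786, 1106050, 1138818, 4759682, 4228866, 5775618, 12617218]

/-- One of the `strongParts` and its complement in `s` are both strong. -/
def hasSplit (s : ℕ) : Bool :=
  strongParts.any fun c =>
    Nat.beq (Nat.land s c) c && (strongBits c && strongBits (s ^^^ c ||| s >>> 25))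

lemma search_cycle : search
    (fun s => hamCycles.any fun p => Nat.beq (Nat.land s (cycleBits p)) (cycleBits p))
    (pairConstraints (fun _ _ => true) ++ connectConstraints) 60 0 0 = true := by
  decide +kernel

lemma search_semi : search hasSplit (pairConstraints (fun _ _ => true) ++ cutConstraints) 60
    (2 ^ 1 + 2 ^ 7 + 2 ^ 13 + 2 ^ 19 + 2 ^ 20) 0 = true := by
  decide +kernel

lemma search_split : search hasSplit
    (pairConstraints (fun a b => !(a == 4 && b == 0)) ++ cutConstraints) 60
    (2 ^ 1 + 2 ^ 2 + 2 ^ 3 + 2 ^ 5 + 2 ^ 10 + 2 ^ 15) (2 ^ 4 + 2 ^ 20 + 2 ^ 29 + 2 ^ 45) =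
      true := by
  decide +kernel

/-- The arc with code `i` in the labelling `f` of the vertices. -/
def arcOf {α : Type*} (f : ℕ → α) (i : ℕ) : α × α :=
  (f (i / 5), f (i % 5))

/-- The meaning of bit `e` for a multidigraph `M` with vertices labelled by `f`. -/
def Bit (f : ℕ → V) (M : Multiset (V × V)) (e : ℕ) : Prop :=
  e / 25 < M.count (arcOf f (e % 25))

lemma Bit.of_add {f : ℕ → V} {M : Multiset (V × V)} {e : ℕ} (h : Bit f M (e + 25)) : Bit f M e := by
  rw [Bit] at *
  rw [Nat.add_mod_right] at h
  omega

lemma arcOf_code {α : Type*} (f : ℕ → α) {a b : ℕ} (hb : b < 5) :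
    arcOf f (5 * a + b) = (f a, f b) := by
  rw [arcOf]
  congr 2 <;> omega

lemma bit_iff {f : ℕ → V} {M : Multiset (V × V)} {i : ℕ} (hi : i < 25) :
    Bit f M i ↔ 1 ≤ M.count (arcOf f i) := by
  rw [Bit, Nat.div_eq_of_lt hi, Nat.mod_eq_of_lt hi, Nat.succ_le_iff]

lemma bit_add_iff {f : ℕ → V} {M : Multiset (V × V)} {i : ℕ} (hi : i < 25) :
    Bit f M (i + 25) ↔ 2 ≤ M.count (arcOf f i) := by
  rw [Bit, Nat.add_mod_right, Nat.mod_eq_of_lt hi, Nat.add_div_right _ (by norm_num),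
    Nat.div_eq_of_lt hi]
  omega

lemma bit_code {f : ℕ → V} {M : Multiset (V × V)} {a b : ℕ} (ha : a < 5) (hb : b < 5) :
    Bit f M (5 * a + b) ↔ (f a, f b) ∈ M := by
  rw [bit_iff (by omega), arcOf_code f hb, Multiset.one_le_count_iff_mem]

lemma mem_cut {X : List ℕ} {i : ℕ} :
    i ∈ cut X ↔ ∃ a < 5, a ∉ X ∧ ∃ b ∈ X, 5 * a + b = i := by
  simp [cut, and_assoc]

lemma lt_of_mem_vertexSets {X : List ℕ} (hX : X ∈ vertexSets) : ∀ b ∈ X, b < 5 := by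
  revert X
  decide

lemma exists_of_mem_vertexSets {X : List ℕ} (hX : X ∈ vertexSets) :
    ∃ a ∈ List.range 5, ∃ b ∈ List.range 5, a ∈ X ∧ b ∉ X := by
  revert X
  decide

lemma filter_mem_vertexSets (p : ℕ → Bool) (h : ∃ a < 5, p a = true) (h' : ∃ b < 5, p b = false) :
    ∃ X ∈ vertexSets, ∀ a < 5, a ∈ X ↔ p a = true := by
  have key : ∀ q : Fin 5 → Bool, (∃ a, q a = true) → (∃ b, q b = false) →
      ∃ X ∈ vertexSets, ∀ a : Fin 5, (a : ℕ) ∈ X ↔ q a = true := by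
    decide +kernel
  obtain ⟨a, ha, hpa⟩ := h
  obtain ⟨b, hb, hpb⟩ := h'
  obtain ⟨X, hX, h⟩ := key (fun i => p i) ⟨⟨a, ha⟩, hpa⟩ ⟨⟨b, hb⟩, hpb⟩
  exact ⟨X, hX, fun a ha => h ⟨a, ha⟩⟩

section labelling

variable {S : Finset V} {M : Multiset (V × V)} {f : ℕ → V}

lemma injOn_of_image_range (hf : (Finset.range 5).image f = S) (hS : S.card = 5) :
    Set.InjOn f (Finset.range 5) := by
  rw [← Finset.card_image_iff, hf, hS, Finset.card_range]

lemma exists_mem_cut (hf : (Finset.range 5).image f = S) {X : List ℕ} (hX : X ∈ vertexSets)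
    {e : V × V} (h1 : e.1 ∈ S \ X.toFinset.image f) (h2 : e.2 ∈ X.toFinset.image f) :
    ∃ i < 25, i ∈ cut X ∧ arcOf f i = e := by
  rw [← hf] at h1
  simp only [Finset.mem_sdiff, Finset.mem_image, Finset.mem_range, List.mem_toFinset] at h1 h2
  obtain ⟨⟨a, ha, h1⟩, haX⟩ := h1
  obtain ⟨b, hb, h2⟩ := h2
  have hb5 := lt_of_mem_vertexSets hX b hb
  refine ⟨5 * a + b, by omega, mem_cut.2 ⟨a, ha, fun h => haX ⟨a, h, h1⟩, b, hb, rfl⟩, ?_⟩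
  rw [arcOf_code f hb5, h1, h2]

lemma Str.le_arcs_image {k : ℕ} (h : Str k S M) (hf : (Finset.range 5).image f = S)
    (hS : S.card = 5) {X : List ℕ} (hX : X ∈ vertexSets) :
    k ≤ arcs M (S \ X.toFinset.image f) (X.toFinset.image f) := by
  have hinj := injOn_of_image_range hf hS
  have hlt := lt_of_mem_vertexSets hX
  obtain ⟨a, ha, b, hb, haX, hbX⟩ := exists_of_mem_vertexSets hX
  refine h _ ?_ ⟨f a, Finset.mem_image_of_mem _ (by simpa)⟩ fun h => hbX ?_
  · rw [← hf]
    exact Finset.image_subset_image fun b hb => by simpa using hlt b (by simpa using hb)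
  · have : f b ∈ X.toFinset.image f := by
      rw [h, ← hf]
      exact Finset.mem_image_of_mem _ (by simpa using hb)
    obtain ⟨c, hc, hcb⟩ := Finset.mem_image.1 this
    rw [List.mem_toFinset] at hc
    rwa [← hinj (by simpa using hlt c hc) (by simpa using hb) hcb]

lemma connectConstraints_holds (h : Str 1 S M) (hf : (Finset.range 5).image f = S)
    (hS : S.card = 5) : ∀ c ∈ connectConstraints, c.Holds (Bit f M) := by
  have hmask : ∀ c ∈ connectConstraints, ∀ e ∈ c.bits, c.mask.testBit e := by decide +kernel
  intro c hc
  refine ⟨hmask c hc, Or.inl ?_⟩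
  obtain ⟨X, hX, rfl⟩ := List.mem_map.1 hc
  obtain ⟨e, he, h1, h2⟩ := arcs_pos.1 (h.le_arcs_image hf hS hX)
  obtain ⟨i, hi, hiX, rfl⟩ := exists_mem_cut hf hX h1 h2
  exact ⟨rfl, i, hiX, (bit_iff hi).2 (Multiset.one_le_count_iff_mem.2 he)⟩

lemma cutConstraints_holds (h : Str 2 S M) (hf : (Finset.range 5).image f = S)
    (hS : S.card = 5) : ∀ c ∈ cutConstraints, c.Holds (Bit f M) := by
  have hmask : ∀ c ∈ cutConstraints, ∀ e ∈ c.bits, c.mask.testBit e := by decide +kernel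
  intro c hc
  refine ⟨hmask c hc, Or.inr ?_⟩
  obtain ⟨X, hX, rfl⟩ := List.mem_map.1 hc
  have h' := h.le_arcs_image hf hS hX
  rw [arcs, Multiset.countP_eq_card_filter] at h'
  obtain ⟨e, e', ht⟩ : ∃ e e', ({e, e'} : Multiset _) ≤
      M.filter fun e => e.1 ∈ S \ X.toFinset.image f ∧ e.2 ∈ X.toFinset.image f := by
    obtain ⟨e, he⟩ := Multiset.card_pos_iff_exists_mem.1 (two_pos.trans_le h')
    obtain ⟨t, ht⟩ := Multiset.exists_cons_of_mem he
    rw [ht, Multiset.card_cons] at h'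
    obtain ⟨e', he'⟩ := Multiset.card_pos_iff_exists_mem.1 (show 0 < t.card by omega)
    refine ⟨e, e', ?_⟩
    rw [ht]
    exact Multiset.cons_le_cons _ (Multiset.singleton_le.2 he')
  obtain ⟨ht, hcr⟩ := Multiset.le_filter.1 ht
  obtain ⟨h1, h2⟩ := hcr e (by simp)
  obtain ⟨h1', h2'⟩ := hcr e' (by simp)
  obtain ⟨i, hi, hiX, rfl⟩ := exists_mem_cut hf hX h1 h2
  obtain ⟨j, hj, hjX, rfl⟩ := exists_mem_cut hf hX h1' h2'
  refine ⟨rfl, i, List.mem_append_left _ hiX, ?_⟩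
  by_cases hij : arcOf f i = arcOf f j
  · have h2 : 2 ≤ M.count (arcOf f i) := by
      rw [← hij] at ht
      simpa using Multiset.count_le_of_le (arcOf f i) ht
    refine ⟨i + 25, List.mem_append_right _ (List.mem_map_of_mem hiX), by omega,
      (bit_iff hi).2 (by omega), (bit_add_iff hi).2 h2⟩
  · refine ⟨j, List.mem_append_left _ hjX, fun h => hij (h ▸ rfl), ?_, ?_⟩ <;>
    · refine (bit_iff ‹_›).2 (Multiset.one_le_count_iff_mem.2 (Multiset.mem_of_le ht (by simp)))

lemma pairConstraints_holds {adj : ℕ → ℕ → Bool}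
    (h : ∀ a < 5, ∀ b < a, adj a b → (f a, f b) ∈ M ∨ (f b, f a) ∈ M) :
    ∀ c ∈ pairConstraints adj, c.Holds (Bit f M) := by
  have hmask : ∀ a < 5, ∀ b < a, ∀ e ∈ (Constraint.ofBits 0 [5 * a + b, 5 * b + a]).bits,
      (Constraint.ofBits 0 [5 * a + b, 5 * b + a]).mask.testBit e := by decide +kernel
  intro c hc
  simp only [pairConstraints, List.mem_flatMap, List.mem_map, List.mem_filter, List.mem_range] at hc
  obtain ⟨a, ha, b, ⟨hb, hab⟩, rfl⟩ := hc
  refine ⟨hmask a ha b hb, Or.inl ⟨rfl, ?_⟩⟩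
  rcases h a ha b hb hab with h | h
  · exact ⟨_, List.mem_cons_self, (bit_code ha (by omega)).2 h⟩
  · exact ⟨_, List.mem_cons_of_mem _ List.mem_cons_self, (bit_code (by omega) ha).2 h⟩

/-- The arcs coded by the bits of `b`. -/
def ofCode (f : ℕ → V) (b : ℕ) : Multiset (V × V) :=
  ((Finset.range 25).filter fun i => b.testBit i).val.map (arcOf f)

lemma arcOf_injOn {α : Type*} {f : ℕ → α} (hinj : Set.InjOn f (Finset.range 5)) :
    Set.InjOn (arcOf f) (Finset.range 25) := by
  intro i hi j hj h
  simp only [Finset.coe_range, Set.mem_Iio] at hi hj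
  simp only [arcOf, Prod.mk.injEq] at h
  have h1 := hinj (by simp; omega) (by simp; omega) h.1
  have h2 := hinj (by simp; omega) (by simp; omega) h.2
  omega

lemma count_ofCode (hinj : Set.InjOn f (Finset.range 5)) {b i : ℕ} (hi : i < 25) :
    (ofCode f b).count (arcOf f i) = if b.testBit i then 1 else 0 := by
  have hnd : (ofCode f b).Nodup := by
    refine Multiset.Nodup.map_on (fun i hi j hj h => ?_) (Finset.nodup _)
    exact arcOf_injOn hinj (Finset.filter_subset _ _ hi) (Finset.filter_subset _ _ hj) h
  have hmem : arcOf f i ∈ ofCode f b ↔ b.testBit i := by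
    simp only [ofCode, Multiset.mem_map, Finset.mem_val, Finset.mem_filter, Finset.mem_range]
    constructor
    · rintro ⟨j, ⟨hj, hb⟩, h⟩
      rwa [← arcOf_injOn hinj (by simpa using hj) (by simpa using hi) h]
    · exact fun h => ⟨i, ⟨hi, h⟩, rfl⟩
  split_ifs with h
  · exact Multiset.count_eq_one_of_mem hnd (hmem.2 h)
  · exact Multiset.count_eq_zero.2 fun h' => h (hmem.1 h')

lemma str_ofCode (hf : (Finset.range 5).image f = S) {b : ℕ} (h : strongBits b) :
    Str 1 S (ofCode f b) := by
  intro X hX hne hXS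
  have h1 : ∃ a < 5, decide (f a ∈ X) = true := by
    obtain ⟨v, hv⟩ := hne
    have := hX hv
    rw [← hf, Finset.mem_image] at this
    obtain ⟨a, ha, rfl⟩ := this
    exact ⟨a, by simpa using ha, by simpa⟩
  have h2 : ∃ b < 5, decide (f b ∈ X) = false := by
    by_contra! h
    refine hXS (hX.antisymm fun v hv => ?_)
    rw [← hf, Finset.mem_image] at hv
    obtain ⟨a, ha, rfl⟩ := hv
    simpa using h a (by simpa using ha)
  obtain ⟨X', hX', hXX⟩ := filter_mem_vertexSets (fun a => decide (f a ∈ X)) h1 h2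
  have h3 := List.all_eq_true.1 h X' hX'
  obtain ⟨i, hi, hb⟩ := List.any_eq_true.1 h3
  obtain ⟨a, ha, haX, c, hc, rfl⟩ := mem_cut.1 hi
  have hc5 := lt_of_mem_vertexSets hX' c hc
  refine arcs_pos.2 ⟨arcOf f (5 * a + c), ?_, ?_⟩
  · exact Multiset.mem_map_of_mem _ (by simp [hb]; omega)
  · rw [arcOf_code f hc5, ← hf]
    rw [hXX a ha] at haX
    rw [hXX c hc5] at hc
    simp only [decide_eq_true_eq] at haX hc
    exact ⟨Finset.mem_sdiff.2 ⟨Finset.mem_image_of_mem _ (by simpa using ha), haX⟩, hc⟩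

lemma dec_of_hasSplit (hf : (Finset.range 5).image f = S) (hS : S.card = 5) {s : ℕ}
    (h : hasSplit s) (hs : ∀ e, s.testBit e → Bit f M e) : Dec S M := by
  have hinj := injOn_of_image_range hf hS
  obtain ⟨c, -, hc⟩ := List.any_eq_true.1 h
  rw [Bool.and_eq_true, Bool.and_eq_true, Nat.beq_eq] at hc
  obtain ⟨hsc, h1, h2⟩ := hc
  refine ⟨ofCode f c, ofCode f (s ^^^ c ||| s >>> 25), ?_, str_ofCode hf h1, str_ofCode hf h2⟩
  have hle : ∀ i < 25, (ofCode f c).count (arcOf f i) +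
      (ofCode f (s ^^^ c ||| s >>> 25)).count (arcOf f i) ≤ M.count (arcOf f i) := by
    intro i hi
    rw [count_ofCode hinj hi, count_ofCode hinj hi]
    have hb := hs i
    have hb' := hs (i + 25)
    rw [bit_iff hi] at hb
    rw [bit_add_iff hi] at hb'
    have hci : c.testBit i → s.testBit i := by
      intro h
      have : (Nat.land s c).testBit i = true := by rwa [hsc]
      rw [show Nat.land s c = s &&& c from rfl, Nat.testBit_and, Bool.and_eq_true] at this
      exact this.1
    rw [Nat.testBit_or, Nat.testBit_xor, Nat.testBit_shiftRight, add_comm 25 i]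
    cases h3 : c.testBit i <;> cases h4 : s.testBit i <;> cases h5 : s.testBit (i + 25) <;>
      simp_all
    omega
  rw [Multiset.le_iff_count]
  intro e
  rw [Multiset.count_add]
  by_cases he : e ∈ ofCode f c + ofCode f (s ^^^ c ||| s >>> 25)
  · obtain ⟨i, hi, rfl⟩ : ∃ i < 25, arcOf f i = e := by
      rcases Multiset.mem_add.1 he with he | he <;>
      · obtain ⟨i, hi, rfl⟩ := Multiset.mem_map.1 he
        simp only [Finset.mem_val, Finset.mem_filter, Finset.mem_range] at hi
        exact ⟨i, hi.1, rfl⟩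
    exact hle i hi
  · rw [← Multiset.count_add, Multiset.count_eq_zero.2 he]
    exact Nat.zero_le _

end labelling

lemma lt_of_testBit {n k e : ℕ} (he : n.testBit e) (hn : n < 2 ^ k) : e < k := by
  by_contra! h
  rw [Nat.testBit_lt_two_pow (lt_of_lt_of_le hn (Nat.pow_le_pow_right two_pos h))] at he
  simp at he

lemma exists_labelling {S : Finset V} (hS : S.card = 5) :
    ∃ f : ℕ → V, (Finset.range 5).image f = S := by
  obtain ⟨v, hv⟩ := Finset.card_pos.1 (by omega : 0 < S.card)
  let e := Finset.equivFinOfCardEq hS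
  refine ⟨fun j => if h : j < 5 then e.symm ⟨j, h⟩ else v, Finset.ext fun a => ?_⟩
  simp only [Finset.mem_image, Finset.mem_range]
  constructor
  · rintro ⟨j, hj, rfl⟩
    simp [hj]
  · exact fun ha => ⟨e ⟨a, ha⟩, (e ⟨a, ha⟩).2, by simp⟩

lemma exists_hamCycle {S : Finset V} {M : Multiset (V × V)} (hS : S.card = 5) (hM : Semi S M)
    (h : Str 1 S M) : ∃ f : ℕ → V, (Finset.range 5).image f = S ∧
      ∀ j < 5, (f j, f ((j + 1) % 5)) ∈ M := by
  obtain ⟨f, hf⟩ := exists_labelling hS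
  have hinj := injOn_of_image_range hf hS
  have hfS : ∀ a < 5, f a ∈ S := fun a ha => hf ▸ Finset.mem_image_of_mem _ (by simpa)
  have hcs : ∀ c ∈ pairConstraints (fun _ _ => true) ++ connectConstraints,
      c.Holds (Bit f M) := by
    intro c hc
    rcases List.mem_append.1 hc with hc | hc
    · refine pairConstraints_holds (fun a ha b hb _ => ?_) c hc
      have hb5 : b < 5 := by omega
      exact hM _ (hfS a ha) _ (hfS b hb5) fun h =>
        hb.ne' (hinj (by simpa using ha) (by simpa using hb5) h)
    · exact connectConstraints_holds h hf hS c hc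
  obtain ⟨s, hs, hsM⟩ := search_sound (fun _ => Bit.of_add) hcs (by simp) (by simp) search_cycle
  obtain ⟨p, hp, hps⟩ := List.any_eq_true.1 hs
  rw [Nat.beq_eq] at hps
  have h1 : ∀ p ∈ hamCycles, (Finset.range 5).image (fun j => p.getD j 0) = Finset.range 5 := by
    decide +kernel
  have h2 : ∀ p ∈ hamCycles, ∀ j < 5, p.getD j 0 < 5 ∧
      (cycleBits p).testBit (5 * p.getD j 0 + p.getD ((j + 1) % 5) 0) := by
    decide +kernel
  refine ⟨fun j => f (p.getD j 0), ?_, fun j hj => ?_⟩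
  · rw [← hf]
    conv_rhs => rw [← h1 p hp]
    rw [Finset.image_image]
    rfl
  · obtain ⟨hlt, hbit⟩ := h2 p hp j hj
    rw [← hps, show Nat.land s (cycleBits p) = s &&& cycleBits p from rfl, Nat.testBit_and,
      Bool.and_eq_true] at hbit
    exact (bit_code hlt (h2 p hp _ (Nat.mod_lt _ (by norm_num))).1).1 (hsM _ hbit.1)

theorem SemiDec.five : SemiDec V 5 := by
  intro S M hS hM h2
  obtain ⟨f, hf, hcyc⟩ := exists_hamCycle hS hM fun X hX hne hXS =>
    one_le_two.trans (h2 X hX hne hXS)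
  have hinj := injOn_of_image_range hf hS
  have hfS : ∀ a < 5, f a ∈ S := fun a ha => hf ▸ Finset.mem_image_of_mem _ (by simpa)
  have hcs : ∀ c ∈ pairConstraints (fun _ _ => true) ++ cutConstraints, c.Holds (Bit f M) := by
    intro c hc
    rcases List.mem_append.1 hc with hc | hc
    · refine pairConstraints_holds (fun a ha b hb _ => ?_) c hc
      have hb5 : b < 5 := by omega
      exact hM _ (hfS a ha) _ (hfS b hb5) fun h =>
        hb.ne' (hinj (by simpa using ha) (by simpa using hb5) h)
    · exact cutConstraints_holds h2 hf hS c hc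
  have hstart : ∀ e, (2 ^ 1 + 2 ^ 7 + 2 ^ 13 + 2 ^ 19 + 2 ^ 20 : ℕ).testBit e → Bit f M e := by
    intro e he
    have key : ∀ e < 25, (2 ^ 1 + 2 ^ 7 + 2 ^ 13 + 2 ^ 19 + 2 ^ 20 : ℕ).testBit e →
        ∃ j < 5, e = 5 * j + (j + 1) % 5 := by
      decide +kernel
    obtain ⟨j, hj, rfl⟩ := key e (lt_of_testBit he (by norm_num)) he
    exact (bit_code hj (Nat.mod_lt _ (by norm_num))).2 (hcyc j hj)
  obtain ⟨s, hs, hsM⟩ := search_sound (fun _ => Bit.of_add) hcs hstart (by simp) search_semi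
  exact dec_of_hasSplit hf hS hs hsM

/-- The case of an independent vertex `t` joined in both directions to all but one vertex of a
semicomplete multidigraph on four vertices. -/
lemma dec_insert_of_four {S : Finset V} {M : Multiset (V × V)} {t v : V} (hS : S.card = 4)
    (ht : t ∉ S) (hv : v ∈ S) (hM : Semi S M) (h2 : Str 2 (insert t S) M)
    (hadj : ∀ u ∈ S, u ≠ v → (u, t) ∈ M ∧ (t, u) ∈ M) (hvt : (v, t) ∉ M) (htv : (t, v) ∉ M) :
    Dec (insert t S) M := by
  have hcard : (insert t S).card = 5 := by rw [Finset.card_insert_of_notMem ht, hS]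
  obtain ⟨a, b, c, hab, hac, hbc, habc⟩ := Finset.card_eq_three.1
    (show (S.erase v).card = 3 by rw [Finset.card_erase_of_mem hv, hS])
  set f : ℕ → V := fun j => [t, a, b, c, v].getD j t
  have hf : (Finset.range 5).image f = insert t S := by
    rw [← Finset.insert_erase hv, habc]
    ext w
    simp [Finset.range_add_one, f]
    tauto
  have hinj := injOn_of_image_range hf hcard
  have hne : ∀ i < 5, ∀ j < 5, i ≠ j → f i ≠ f j := fun i hi j hj hij h =>
    hij (hinj (by simpa using hi) (by simpa using hj) h)
  have hfS : ∀ i < 5, i ≠ 0 → f i ∈ S := by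
    intro i hi h0
    have : f i ∈ insert t S := hf ▸ Finset.mem_image_of_mem _ (by simpa)
    exact Finset.mem_of_mem_insert_of_ne this (hne i hi 0 (by norm_num) h0)
  have hft : ∀ i < 5, i ≠ 0 → i ≠ 4 → (f i, f 0) ∈ M ∧ (f 0, f i) ∈ M := fun i hi h0 h4 =>
    hadj _ (hfS i hi h0) (hne i hi 4 (by norm_num) h4)
  have hcs : ∀ c ∈ pairConstraints (fun a b => !(a == 4 && b == 0)) ++ cutConstraints,
      c.Holds (Bit f M) := by
    intro c hc
    rcases List.mem_append.1 hc with hc | hc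
    · refine pairConstraints_holds (fun a ha b hb hab => ?_) c hc
      have hb5 : b < 5 := by omega
      by_cases hb0 : b = 0
      · subst hb0
        exact Or.inl (hft a ha hb.ne' (by simpa using hab)).1
      · exact hM _ (hfS a ha (by omega)) _ (hfS b hb5 hb0) (hne a ha b hb5 hb.ne')
    · exact cutConstraints_holds h2 hf hcard c hc
  have hstart : ∀ e, (2 ^ 1 + 2 ^ 2 + 2 ^ 3 + 2 ^ 5 + 2 ^ 10 + 2 ^ 15 : ℕ).testBit e →
      Bit f M e := by
    intro e he
    have key : ∀ e < 25, (2 ^ 1 + 2 ^ 2 + 2 ^ 3 + 2 ^ 5 + 2 ^ 10 + 2 ^ 15 : ℕ).testBit e →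
        ∃ j < 5, j ≠ 0 ∧ j ≠ 4 ∧ (e = 5 * 0 + j ∨ e = 5 * j + 0) := by
      decide +kernel
    obtain ⟨j, hj, h0, h4, rfl | rfl⟩ := key e (lt_of_testBit he (by norm_num)) he
    · exact (bit_code (by norm_num) hj).2 (hft j hj h0 h4).2
    · exact (bit_code hj (by norm_num)).2 (hft j hj h0 h4).1
  have habsent : ∀ e, (2 ^ 4 + 2 ^ 20 + 2 ^ 29 + 2 ^ 45 : ℕ).testBit e → ¬ Bit f M e := by
    intro e he
    have key : ∀ e < 50, (2 ^ 4 + 2 ^ 20 + 2 ^ 29 + 2 ^ 45 : ℕ).testBit e →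
        e = 4 ∨ e = 20 ∨ e = 4 + 25 ∨ e = 20 + 25 := by
      decide +kernel
    have h4 : ¬ Bit f M 4 := mt (bit_code (a := 0) (b := 4) (by norm_num) (by norm_num)).1 htv
    have h20 : ¬ Bit f M 20 := mt (bit_code (a := 4) (b := 0) (by norm_num) (by norm_num)).1 hvt
    rcases key e (lt_of_testBit he (by norm_num)) he with rfl | rfl | rfl | rfl
    exacts [h4, h20, mt Bit.of_add h4, mt Bit.of_add h20]
  obtain ⟨s, hs, hsM⟩ := search_sound (fun _ => Bit.of_add) hcs hstart habsent search_split
  exact dec_of_hasSplit hf hcard hs hsM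

lemma str_one_of_closed {U : Finset V} {N : Multiset (V × V)}
    (h : ∀ X ⊆ U, X.Nonempty → (∀ e ∈ N, e.1 ∈ U → e.2 ∈ X → e.1 ∈ X) → U ⊆ X) : Str 1 U N := by
  intro X hX hne hXU
  by_contra hlt
  have h0 : arcs N (U \ X) X = 0 := by omega
  rw [arcs_eq_zero] at h0
  refine hXU (hX.antisymm (h X hX hne fun e he hU heX => ?_))
  by_contra hn
  exact h0 e he (Finset.mem_sdiff.2 ⟨hU, hn⟩) heX

/-- A decomposition of `M` on `U` extends to a vertex joined in both directions to two vertices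
of `U`. -/
lemma Dec.insert_of_two {U : Finset V} {M : Multiset (V × V)} {t x y : V} (h : Dec U M)
    (ht : t ∉ U) (hx : x ∈ U) (hy : y ∈ U) (hxy : x ≠ y) (hxt : (x, t) ∈ M) (hyt : (y, t) ∈ M)
    (htx : (t, x) ∈ M) (hty : (t, y) ∈ M) : Dec (insert t U) M := by
  obtain ⟨N₁, N₂, hN, h₁, h₂⟩ := h
  have hxt' : x ≠ t := fun h => ht (h ▸ hx)
  have hyt' : y ≠ t := fun h => ht (h ▸ hy)
  set p : V × V → Prop := fun e => e.1 ∈ U ∧ e.2 ∈ U with hp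
  refine ⟨N₁.filter p + {(x, t), (t, y)}, N₂.filter p + {(y, t), (t, x)}, ?_, ?_, ?_⟩
  · have hle : ({(x, t), (t, y), (y, t), (t, x)} : Multiset (V × V)) ≤ M.filter (¬ p ·) := by
      rw [Multiset.le_iff_subset (by simp [hxy, hxy.symm, hxt', hyt', hxt'.symm, hyt'.symm])]
      intro e he
      simp only [Multiset.insert_eq_cons, Multiset.mem_cons, Multiset.mem_singleton] at he
      rw [Multiset.mem_filter]
      rcases he with rfl | rfl | rfl | rfl <;> simp [*]
    calc N₁.filter p + {(x, t), (t, y)} + (N₂.filter p + {(y, t), (t, x)})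
        = (N₁ + N₂).filter p + {(x, t), (t, y), (y, t), (t, x)} := by
          rw [Multiset.filter_add, add_add_add_comm]
          rfl
      _ ≤ M.filter p + M.filter (¬ p ·) := add_le_add (Multiset.filter_le_filter _ hN) hle
      _ = M := Multiset.filter_add_not _ _
  · exact str_insert ht (P := 0) (by simpa using h₁.filter) (Multiset.le_add_right _ _)
      (by simp [lift]) ⟨x, hx, by simp⟩ ⟨y, hy, by simp⟩
  · exact str_insert ht (P := 0) (by simpa using h₂.filter) (Multiset.le_add_right _ _)
      (by simp [lift]) ⟨y, hy, by simp⟩ ⟨x, hx, by simp⟩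

/-- A triangle and two vertices joined in both directions to it. -/
lemma dec_five_of_complete {M : Multiset (V × V)} {s t x y z : V} (hst : s ≠ t) (hsx : s ≠ x)
    (hsy : s ≠ y) (hsz : s ≠ z) (htx : t ≠ x) (hty : t ≠ y) (htz : t ≠ z) (hxy : x ≠ y)
    (hxz : x ≠ z) (hyz : y ≠ z)
    (hs : ∀ u ∈ ({x, y, z} : Finset V), (u, s) ∈ M ∧ (s, u) ∈ M)
    (ht : ∀ u ∈ ({x, y, z} : Finset V), (u, t) ∈ M ∧ (t, u) ∈ M) :
    Dec {s, t, x, y, z} M := by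
  simp only [Finset.mem_insert, Finset.mem_singleton, forall_eq_or_imp, forall_eq] at hs ht
  refine ⟨{(s, x), (x, t), (t, y), (y, s), (s, z), (z, t)},
    {(t, x), (x, s), (s, y), (y, t), (t, z), (z, s)}, ?_, ?_, ?_⟩
  · rw [Multiset.le_iff_subset]
    · intro e he
      simp only [Multiset.insert_eq_cons, Multiset.mem_add, Multiset.mem_cons,
        Multiset.mem_singleton] at he
      rcases he with (rfl | rfl | rfl | rfl | rfl | rfl) | (rfl | rfl | rfl | rfl | rfl | rfl) <;>
        simp [hs, ht]
    · simp [hst, hsx, hsy, hsz, htx, hty, htz, hxy, hxz, hyz, hst.symm, hsx.symm, hsy.symm,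
        hsz.symm, htx.symm, hty.symm, htz.symm, hxy.symm, hxz.symm, hyz.symm]
  all_goals
    refine str_one_of_closed fun X hX ⟨v, hv⟩ hc => ?_
    have hvU := hX hv
    simp only [Finset.mem_insert, Finset.mem_singleton, Multiset.insert_eq_cons,
      Multiset.mem_cons, Multiset.mem_singleton, forall_eq_or_imp, forall_eq, true_or, or_true,
      true_imp_iff] at hvU hc
    simp only [Finset.insert_subset_iff, Finset.singleton_subset_iff]
    rcases hvU with rfl | rfl | rfl | rfl | rfl <;> grind only

/-- A directed triangle and a vertex joined in both directions to it. -/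
lemma dec_four_of_cycle {M : Multiset (V × V)} {t x y z : V} (htx : t ≠ x) (hty : t ≠ y)
    (htz : t ≠ z) (hxy : x ≠ y) (hxz : x ≠ z) (hyz : y ≠ z)
    (ht : ∀ u ∈ ({x, y, z} : Finset V), (u, t) ∈ M ∧ (t, u) ∈ M)
    (hc : (x, y) ∈ M ∧ (y, z) ∈ M ∧ (z, x) ∈ M) : Dec {t, x, y, z} M := by
  simp only [Finset.mem_insert, Finset.mem_singleton, forall_eq_or_imp, forall_eq] at ht
  refine ⟨{(t, x), (x, y), (y, z), (z, t)}, {(t, z), (z, x), (x, t), (t, y), (y, t)}, ?_, ?_, ?_⟩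
  · rw [Multiset.le_iff_subset]
    · intro e he
      simp only [Multiset.insert_eq_cons, Multiset.mem_add, Multiset.mem_cons,
        Multiset.mem_singleton] at he
      rcases he with (rfl | rfl | rfl | rfl) | (rfl | rfl | rfl | rfl | rfl) <;> simp [ht, hc]
    · simp [htx, hty, htz, hxy, hxz, hyz, htx.symm, hty.symm, htz.symm, hxy.symm, hxz.symm,
        hyz.symm]
  all_goals
    refine str_one_of_closed fun X hX ⟨v, hv⟩ hc => ?_
    have hvU := hX hv
    simp only [Finset.mem_insert, Finset.mem_singleton, Multiset.insert_eq_cons,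
      Multiset.mem_cons, Multiset.mem_singleton, forall_eq_or_imp, forall_eq, true_or, or_true,
      true_imp_iff] at hvU hc
    simp only [Finset.insert_subset_iff, Finset.singleton_subset_iff]
    rcases hvU with rfl | rfl | rfl | rfl <;> grind only

lemma mem_of_nodup_of_card_le {α : Type*} {S : Finset α} {O : Multiset α} (hO : O.Nodup)
    (hOS : ∀ u ∈ O, u ∈ S) (hc : S.card ≤ O.card) : ∀ u ∈ S, u ∈ O := by
  have h1 : (⟨O, hO⟩ : Finset α) ⊆ S := hOS
  have h2 := Finset.eq_of_subset_of_card_le h1 hc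
  intro u hu
  rw [← h2] at hu
  exact hu

lemma Split.card_le {S T : Finset V} {M : Multiset (V × V)} (h : Split S T M) (hT : T.Nonempty) :
    3 ≤ S.card := by
  obtain ⟨t, ht⟩ := hT
  have h1 : (⟨_, h.nodup_in t ht⟩ : Finset V) ⊆ S := fun u hu => (mem_inN.1 hu).1
  exact (h.card_in t ht).trans (Finset.card_le_card h1)

/-- A vertex of `T` is joined in both directions to every vertex of a three-element set `S'`
containing all of its neighbours. -/
lemma Split.complete {S S' T : Finset V} {M : Multiset (V × V)} (h : Split S T M)
    (hc : S'.card = 3) {t : V} (ht : t ∈ T)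
    (hN : ∀ u ∈ S, (u, t) ∈ M ∨ (t, u) ∈ M → u ∈ S') :
    ∀ u ∈ S', (u, t) ∈ M ∧ (t, u) ∈ M := by
  intro u hu
  have h1 := mem_of_nodup_of_card_le (h.nodup_in t ht)
    (fun u hu => hN u (mem_inN.1 hu).1 (Or.inl (mem_inN.1 hu).2)) (hc ▸ h.card_in t ht) u hu
  have h2 := mem_of_nodup_of_card_le (h.nodup_out t ht)
    (fun u hu => hN u (mem_outN.1 hu).1 (Or.inr (mem_outN.1 hu).2)) (hc ▸ h.card_out t ht) u hu
  exact ⟨(mem_inN.1 h1).2, (mem_outN.1 h2).2⟩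

lemma Split.exists_inner {S T : Finset V} {M : Multiset (V × V)} {t : V} (h : Split S T M)
    (ht : t ∈ T) (h2 : Str 2 (insert t S) M) {a : V} (ha : a ∈ S) :
    (∃ u ∈ S, u ≠ a ∧ (u, a) ∈ M) ∧ ∃ u ∈ S, u ≠ a ∧ (a, u) ∈ M := by
  have htS : t ∉ S := fun h' => Finset.disjoint_left.1 h.disjoint h' ht
  have hta : t ≠ a := fun h' => htS (h' ▸ ha)
  have haU : {a} ⊆ insert t S := Finset.singleton_subset_iff.2 (Finset.mem_insert_of_mem ha)
  have hU : insert t S \ {a} = {t} ∪ S \ {a} := by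
    ext u
    simp only [Finset.mem_sdiff, Finset.mem_insert, Finset.mem_singleton, Finset.mem_union]
    have : u = t → u ≠ a := fun h' => h' ▸ hta
    tauto
  have hd : Disjoint {t} (S \ {a}) := by simp [htS]
  have hcount : ∀ O : Multiset V, O.Nodup → O.countP (· ∈ ({a} : Finset V)) ≤ 1 := by
    intro O hO
    have := Multiset.nodup_iff_count_le_one.1 hO a
    rw [Multiset.count] at this
    simpa [eq_comm] using this
  have haS : {a} ⊆ S := Finset.singleton_subset_iff.2 ha
  have hne : insert t S \ {a} ≠ insert t S := fun h' => by
    have h3 := Finset.mem_insert_of_mem (b := t) ha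
    rw [← h'] at h3
    simp at h3
  constructor
  · have h3 := h2 {a} haU (Finset.singleton_nonempty a) (fun h' => hta (by
      have : t ∈ ({a} : Finset V) := h' ▸ Finset.mem_insert_self t S
      simpa using this))
    have h4 := hcount _ (h.nodup_out t ht)
    rw [countP_outN haS] at h4
    rw [hU, arcs_union_left _ hd] at h3
    obtain ⟨e, he, h5, h6⟩ := arcs_pos.1 (show 1 ≤ arcs M (S \ {a}) {a} by omega)
    obtain ⟨h8, h7⟩ := Finset.mem_sdiff.1 h5
    obtain rfl := Finset.mem_singleton.1 h6
    exact ⟨e.1, h8, by simpa using h7, he⟩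
  · have h3 := h2 (insert t S \ {a}) Finset.sdiff_subset ⟨t, by simp [hta]⟩ hne
    have h4 := hcount _ (h.nodup_in t ht)
    rw [countP_inN haS] at h4
    rw [Finset.sdiff_sdiff_eq_self haU, hU, arcs_union_right _ hd] at h3
    obtain ⟨e, he, h5, h6⟩ := arcs_pos.1 (show 1 ≤ arcs M {a} (S \ {a}) by omega)
    obtain ⟨h8, h7⟩ := Finset.mem_sdiff.1 h6
    obtain rfl := Finset.mem_singleton.1 h5
    exact ⟨e.2, h8, by simpa using h7, he⟩

lemma Split.dec_of_card_three {S T : Finset V} {M : Multiset (V × V)} (h : Split S T M)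
    (h2 : Str 2 (S ∪ T) M) (hS : S.card = 3) (hT : T.Nonempty) : Dec (S ∪ T) M := by
  have hall : ∀ t ∈ T, ∀ u ∈ S, (u, t) ∈ M ∧ (t, u) ∈ M := fun t ht =>
    h.complete hS ht fun u hu _ => hu
  have hne : ∀ t ∈ T, ∀ u ∈ S, t ≠ u := fun t ht u hu htu =>
    Finset.disjoint_left.1 h.disjoint hu (htu ▸ ht)
  obtain ⟨x, y, z, hxy, hxz, hyz, rfl⟩ := Finset.card_eq_three.1 hS
  obtain ⟨t, ht⟩ := hT
  by_cases h1 : T = {t}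
  · subst h1
    rw [Finset.union_singleton] at h2 ⊢
    have hcyc : (x, y) ∈ M ∧ (y, z) ∈ M ∧ (z, x) ∈ M ∨ (y, x) ∈ M ∧ (x, z) ∈ M ∧ (z, y) ∈ M := by
      have hx := h.exists_inner ht h2 (a := x) (by simp)
      have hy := h.exists_inner ht h2 (a := y) (by simp)
      have hz := h.exists_inner ht h2 (a := z) (by simp)
      have s1 := h.semi x (by simp) y (by simp) hxy
      have s2 := h.semi x (by simp) z (by simp) hxz
      have s3 := h.semi y (by simp) z (by simp) hyz
      simp only [Finset.mem_insert, Finset.mem_singleton, exists_eq_or_imp, exists_eq_left, ne_eq,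
        not_true_eq_false, false_and, false_or, or_false, hxy, hxz, hyz, hxy.symm, hxz.symm,
        hyz.symm, not_false_eq_true, true_and] at hx hy hz
      grind only
    have := hne t ht
    simp only [Finset.mem_insert, Finset.mem_singleton, forall_eq_or_imp, forall_eq] at this
    rcases hcyc with hc | hc
    · exact dec_four_of_cycle this.1 this.2.1 this.2.2 hxy hxz hyz (hall t ht) hc
    · rw [Finset.insert_comm x y] at hall ⊢
      exact dec_four_of_cycle this.2.1 this.1 this.2.2 hxy.symm hyz hxz (hall t ht) hc
  · obtain ⟨s, hs, hst⟩ : ∃ s ∈ T, s ≠ t := by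
      by_contra! h'
      exact h1 (Finset.eq_singleton_iff_unique_mem.2 ⟨ht, h'⟩)
    have key : ∀ R ⊆ T, Dec ({x, y, z} ∪ ({s, t} ∪ R)) M := by
      intro R
      induction R using Finset.induction_on with
      | empty =>
        intro _
        have e : ({x, y, z} ∪ ({s, t} ∪ ∅) : Finset V) = {s, t, x, y, z} := by
          ext u
          simp
          tauto
        have h3 := hne t ht
        have h4 := hne s hs
        simp only [Finset.mem_insert, Finset.mem_singleton, forall_eq_or_imp, forall_eq] at h3 h4
        rw [e]
        exact dec_five_of_complete hst h4.1 h4.2.1 h4.2.2 h3.1 h3.2.1 h3.2.2 hxy hxz hyz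
          (hall s hs) (hall t ht)
      | insert r R _ ih =>
        intro hR
        have hr : r ∈ T := hR (Finset.mem_insert_self r R)
        specialize ih ((Finset.subset_insert r R).trans hR)
        rw [Finset.union_insert, Finset.union_insert]
        by_cases hrU : r ∈ ({x, y, z} ∪ ({s, t} ∪ R) : Finset V)
        · rwa [Finset.insert_eq_of_mem hrU]
        · have hx := hall r hr x (by simp)
          have hy := hall r hr y (by simp)
          exact ih.insert_of_two hrU (by simp) (by simp) hxy hx.1 hy.1 hx.2 hy.2
    have := key T (Finset.Subset.refl T)
    rwa [Finset.union_eq_right.2 (Finset.insert_subset hs (Finset.singleton_subset_iff.2 ht))]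
      at this

lemma Split.dec_of_four_le {S T : Finset V} {M : Multiset (V × V)} (h : Split S T M)
    (h2 : Str 2 (S ∪ T) M) (hS : 4 ≤ S.card) (hST : T.Nonempty ∨ 5 ≤ S.card) :
    Dec (S ∪ T) M := by
  induction T using Finset.induction_on generalizing M with
  | empty =>
    rw [Finset.union_empty] at h2 ⊢
    have h5 : 5 ≤ S.card := hST.resolve_left (by simp)
    exact SemiDec.five.of_five h5 S M rfl h.semi h2
  | insert t T ht ih =>
    rw [Finset.union_insert] at h2 ⊢
    by_cases hT : T.Nonempty ∨ 5 ≤ S.card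
    · obtain ⟨P, hP, h2P, hdec⟩ := Split.eliminate ht h h2 hS
      exact hdec (ih hP h2P hT)
    push Not at hT
    obtain ⟨rfl, hS5⟩ := hT
    have hS4 : S.card = 4 := by omega
    have htT : t ∈ insert t (∅ : Finset V) := Finset.mem_insert_self _ _
    have htS : t ∉ S := fun h' => Finset.disjoint_left.1 h.disjoint h' htT
    rw [Finset.union_empty] at h2 ⊢
    by_cases hadj : ∀ v ∈ S, (v, t) ∈ M ∨ (t, v) ∈ M
    · refine SemiDec.five _ M (by rw [Finset.card_insert_of_notMem htS, hS4]) ?_ h2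
      intro u hu v hv huv
      rcases Finset.mem_insert.1 hu with rfl | hu' <;>
        rcases Finset.mem_insert.1 hv with rfl | hv'
      · exact absurd rfl huv
      · exact (hadj v hv').symm
      · exact hadj u hu'
      · exact h.semi u hu' v hv' huv
    · push Not at hadj
      obtain ⟨v, hv, hvt, htv⟩ := hadj
      have hc : (S.erase v).card = 3 := by rw [Finset.card_erase_of_mem hv, hS4]
      have := h.complete hc htT (by
        rintro u hu hut
        refine Finset.mem_erase.2 ⟨?_, hu⟩
        rintro rfl
        exact hut.elim hvt htv)
      exact dec_insert_of_four hS4 htS hv h.semi h2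
        (fun u hu huv => this u (Finset.mem_erase.2 ⟨huv, hu⟩)) hvt htv

theorem Split.dec {S T : Finset V} {M : Multiset (V × V)} (h : Split S T M)
    (h2 : Str 2 (S ∪ T) M) (hT : T.Nonempty) : Dec (S ∪ T) M := by
  rcases (h.card_le hT).eq_or_lt with h3 | h4
  · exact h.dec_of_card_three h2 h3.symm hT
  · exact h.dec_of_four_le h2 h4 (Or.inl hT)

section Translation

variable [Fintype V]

lemma str_of_arcStrong {k : ℕ} {A : Finset (V × V)} (h : ArcStrong k A) :
    Str k Finset.univ A.val := by
  intro X _ hne hX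
  by_contra! hlt
  obtain ⟨x, hx⟩ := hne
  obtain ⟨y, hy⟩ : ∃ y, y ∉ X := by
    by_contra! h'
    exact hX (Finset.eq_univ_iff_forall.2 h')
  have hstrong := h (A.filter fun e => e.1 ∈ Finset.univ \ X ∧ e.2 ∈ X) (Finset.filter_subset _ _)
    (by rwa [arcs, Multiset.countP_eq_card_filter] at hlt) y x
  have key : ∀ z, Relation.ReflTransGen (fun a b => (a, b) ∈
      A \ A.filter fun e => e.1 ∈ Finset.univ \ X ∧ e.2 ∈ X) y z → z ∉ X := by
    intro z hz
    induction hz with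
    | refl => exact hy
    | tail _ hbc ih =>
      intro hc
      obtain ⟨h1, h2⟩ := Finset.mem_sdiff.1 hbc
      exact h2 (Finset.mem_filter.2 ⟨h1, by simpa using ih, hc⟩)
  exact key x hstrong hx

lemma digraphStrong_of_str {M : Multiset (V × V)} {A : Finset (V × V)}
    (h : Str 1 Finset.univ M) (hM : ∀ e ∈ M, e ∈ A) : DigraphStrong A := by
  classical
  intro x y
  by_contra hy
  set X : Finset V := Finset.univ.filter fun z =>
    ¬ Relation.ReflTransGen (fun a b => (a, b) ∈ A) x z with hX
  obtain ⟨e, he, h1, h2⟩ := arcs_pos.1 (h X (Finset.subset_univ X) ⟨y, by simpa [hX] using hy⟩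
    (fun h' => by
      have : x ∈ X := h' ▸ Finset.mem_univ x
      simp only [hX, Finset.mem_filter] at this
      exact this.2 .refl))
  simp only [hX, Finset.mem_sdiff, Finset.mem_univ, true_and, Finset.mem_filter, not_not] at h1 h2
  exact h2 (h1.tail (hM e he))

lemma strongArcDecomp_of_dec {A : Finset (V × V)} (h : Dec Finset.univ A.val) :
    StrongArcDecomp A := by
  obtain ⟨M₁, M₂, hle, h₁, h₂⟩ := h
  have hd := Multiset.nodup_add.1 (Multiset.nodup_of_le hle A.nodup)
  have hM : ∀ e, e ∈ M₁ ∨ e ∈ M₂ → e ∈ A := fun e he =>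
    Multiset.mem_of_le hle (Multiset.mem_add.2 he)
  have hsub : M₁.toFinset ⊆ A := fun e he => hM e (Or.inl (Multiset.mem_toFinset.1 he))
  refine ⟨M₁.toFinset, A \ M₁.toFinset, Finset.union_sdiff_of_subset hsub,
    Finset.disjoint_sdiff, digraphStrong_of_str h₁ (by simp), digraphStrong_of_str h₂ ?_⟩
  intro e he
  refine Finset.mem_sdiff.2 ⟨hM e (Or.inr he), fun h' => ?_⟩
  exact Multiset.disjoint_left.1 hd.2.2 (Multiset.mem_toFinset.1 h') he

lemma split_of_isSplitDigraph {V₁ V₂ : Finset V} {A : Finset (V × V)}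
    (h : IsSplitDigraph V₁ V₂ A) (hdeg : ∀ t ∈ V₁, 3 ≤ outDeg A t ∧ 3 ≤ inDeg A t) :
    Split V₂ V₁ A.val := by
  obtain ⟨-, -, hd, hU, -, hind, hsemi⟩ := h
  have hV : ∀ u, u ∉ V₁ → u ∈ V₂ := fun u hu =>
    (Finset.mem_union.1 (hU ▸ Finset.mem_univ u)).resolve_left hu
  refine ⟨hd.symm, hsemi, fun e he h1 h2 => hind _ h1 _ h2 he, ?_, ?_, fun t ht => ?_,
    fun t ht => ?_⟩
  · refine fun t _ => Multiset.Nodup.map_on ?_ (A.nodup.filter _)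
    rintro ⟨a, b⟩ ha ⟨c, d⟩ hc hac
    simp only [Multiset.mem_filter] at ha hc
    simp_all
  · refine fun t _ => Multiset.Nodup.map_on ?_ (A.nodup.filter _)
    rintro ⟨a, b⟩ ha ⟨c, d⟩ hc hac
    simp only [Multiset.mem_filter] at ha hc
    simp_all
  · rw [inN, Multiset.card_map]
    refine (hdeg t ht).2.trans (le_of_eq ?_)
    refine congrArg Multiset.card (Multiset.filter_congr fun e he => ?_)
    exact ⟨fun h' => ⟨h', hV _ fun h1 => hind _ h1 _ (h' ▸ ht) he⟩, fun h' => h'.1⟩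
  · rw [outN, Multiset.card_map]
    refine (hdeg t ht).1.trans (le_of_eq ?_)
    refine congrArg Multiset.card (Multiset.filter_congr fun e he => ?_)
    exact ⟨fun h' => ⟨h', hV _ fun h1 => hind _ (h' ▸ ht) _ h1 he⟩, fun h' => h'.1⟩

end Translation

end ArcDecomp

/-- Theorem 1.9: every 2-arc-strong split digraph in which every vertex of the
independent set `V₁` has out-degree and in-degree at least 3 has a strong arc
decomposition. -/
theorem stmt0 {V : Type*} [Fintype V] [DecidableEq V]
    (V₁ V₂ : Finset V) (A : Finset (V × V))
    (hsplit : IsSplitDigraph V₁ V₂ A)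
    (h2 : ArcStrong 2 A)
    (hdeg : ∀ t ∈ V₁, 3 ≤ outDeg A t ∧ 3 ≤ inDeg A t) :
    StrongArcDecomp A := by
  have h := ArcDecomp.split_of_isSplitDigraph hsplit hdeg
  have hU : V₂ ∪ V₁ = Finset.univ := (Finset.union_comm _ _).trans hsplit.2.2.2.1
  have h2' := ArcDecomp.str_of_arcStrong h2
  rw [← hU] at h2'
  have hdec := h.dec h2' hsplit.1
  rw [hU] at hdec
  exact ArcDecomp.strongArcDecomp_of_dec hdec
end

section
/- Let D be a directed multigraph and let X be a subset of V(D) such that every vertex of V(D)∖X has at least two in-neighbors in X and at least two out-neighbors in X. If the induced subdigraph D⟨X⟩ has a strong arc decomposition, then D has a strong arc decomposition. -/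
/-- In a directed multigraph with arc multiset `B`, every ordered pair of vertices
of `X` is joined by a directed path all of whose vertices lie in `X`. -/
def MStrongOn {V : Type*} (X : Finset V) (B : Multiset (V × V)) : Prop :=
  ∀ x ∈ X, ∀ y ∈ X, Relation.ReflTransGen (fun a b => a ∈ X ∧ b ∈ X ∧ (a, b) ∈ B) x y

/-- A subdigraph that is strong on `X` extends to a spanning strong one as soon as every vertex
outside `X` receives an arc from `X` and sends an arc to `X`. -/
theorem MStrongOn.univ_of_subset {V : Type*} [Fintype V] {X : Finset V} {B C : Multiset (V × V)}
    (hB : MStrongOn X B) (hBC : B ⊆ C)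
    (hin : ∀ v ∉ X, ∃ u ∈ X, (u, v) ∈ C) (hout : ∀ v ∉ X, ∃ u ∈ X, (v, u) ∈ C) :
    MStrongOn Finset.univ C := by
  intro x _ y _
  obtain ⟨x', hx', hxx'⟩ : ∃ x' ∈ X, Relation.ReflTransGen
      (fun a b => a ∈ Finset.univ ∧ b ∈ Finset.univ ∧ (a, b) ∈ C) x x' := by
    by_cases hx : x ∈ X
    · exact ⟨x, hx, .refl⟩
    · obtain ⟨u, hu, h⟩ := hout x hx
      exact ⟨u, hu, .single ⟨Finset.mem_univ _, Finset.mem_univ _, h⟩⟩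
  obtain ⟨y', hy', hyy'⟩ : ∃ y' ∈ X, Relation.ReflTransGen
      (fun a b => a ∈ Finset.univ ∧ b ∈ Finset.univ ∧ (a, b) ∈ C) y' y := by
    by_cases hy : y ∈ X
    · exact ⟨y, hy, .refl⟩
    · obtain ⟨u, hu, h⟩ := hin y hy
      exact ⟨u, hu, .single ⟨Finset.mem_univ _, Finset.mem_univ _, h⟩⟩
  exact (hxx'.trans (Relation.ReflTransGen.mono (fun a b h =>
    ⟨Finset.mem_univ _, Finset.mem_univ _, hBC h.2.2⟩) _ _ (hB x' hx' y' hy'))).trans hyy'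

/-- Lemma 2.3: if every vertex outside `X` has at least two in-neighbours and at least
two out-neighbours in `X`, and the subdigraph induced by `X` has a strong arc
decomposition, then the whole directed multigraph has a strong arc decomposition. -/
theorem stmt2 {V : Type*} [Fintype V] [DecidableEq V]
    (A : Multiset (V × V)) (hloop : ∀ v : V, (v, v) ∉ A)
    (X : Finset V)
    (hin : ∀ v : V, v ∉ X → 2 ≤ (X.filter fun u => (u, v) ∈ A).card)
    (hout : ∀ v : V, v ∉ X → 2 ≤ (X.filter fun u => (v, u) ∈ A).card)
    (hX : ∃ B₁ B₂ : Multiset (V × V),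
      B₁ + B₂ = A.filter (fun e => e.1 ∈ X ∧ e.2 ∈ X) ∧
      MStrongOn X B₁ ∧ MStrongOn X B₂) :
    ∃ A₁ A₂ : Multiset (V × V), A₁ + A₂ = A ∧
      MStrongOn Finset.univ A₁ ∧ MStrongOn Finset.univ A₂ := by
  obtain ⟨B₁, B₂, hB, h₁, h₂⟩ := hX
  have two_in : ∀ v, ∃ a b, v ∉ X → a ∈ X ∧ b ∈ X ∧ (a, v) ∈ A ∧ (b, v) ∈ A ∧ a ≠ b := by
    intro v
    by_cases hv : v ∈ X
    · exact ⟨v, v, fun h => absurd hv h⟩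
    · obtain ⟨a, ha, b, hb, hab⟩ := Finset.one_lt_card.mp (hin v hv)
      rw [Finset.mem_filter] at ha hb
      exact ⟨a, b, fun _ => ⟨ha.1, hb.1, ha.2, hb.2, hab⟩⟩
  have two_out : ∀ v, ∃ a b, v ∉ X → a ∈ X ∧ b ∈ X ∧ (v, a) ∈ A ∧ (v, b) ∈ A ∧ a ≠ b := by
    intro v
    by_cases hv : v ∈ X
    · exact ⟨v, v, fun h => absurd hv h⟩
    · obtain ⟨a, ha, b, hb, hab⟩ := Finset.one_lt_card.mp (hout v hv)
      rw [Finset.mem_filter] at ha hb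
      exact ⟨a, b, fun _ => ⟨ha.1, hb.1, ha.2, hb.2, hab⟩⟩
  choose i i' hi using two_in
  choose o o' ho using two_out
  let R := A.filter fun e => ¬(e.1 ∈ X ∧ e.2 ∈ X)
  let p : V × V → Prop := fun e => (e.2 ∉ X ∧ e.1 = i e.2) ∨ (e.1 ∉ X ∧ e.2 = o e.1)
  refine ⟨B₁ + R.filter p, B₂ + R.filter fun e => ¬p e, ?_, ?_, ?_⟩
  · rw [add_add_add_comm, hB, Multiset.filter_add_not, Multiset.filter_add_not]
  · refine h₁.univ_of_subset (Multiset.subset_of_le (Multiset.le_add_right _ _)) ?_ ?_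
    · intro v hv
      have := hi v hv
      exact ⟨i v, this.1, by simp [R, p, hv, this]⟩
    · intro v hv
      have := ho v hv
      exact ⟨o v, this.1, by simp [R, p, hv, this]⟩
  · refine h₂.univ_of_subset (Multiset.subset_of_le (Multiset.le_add_right _ _)) ?_ ?_
    · intro v hv
      have := hi v hv
      exact ⟨i' v, this.2.1, by simp [R, p, hv, this, this.2.2.2.2.symm]⟩
    · intro v hv
      have := ho v hv
      exact ⟨o' v, this.2.1, by simp [R, p, hv, this, this.2.2.2.2.symm]⟩
end
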